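/- Let H be a unicyclic graph and G = H_T obtained by attaching unions of complete graphs at vertices in T ⊆ V(H). Then for all r ≥ 1, reg(S/I(G)^r) ≤ 2r + reg(S/I(G)) − 2. -/

import Mathlib

open MvPolynomial

noncomputable section

namespace EdgeIdealReg

open scoped Classical

/-- The edge ideal of a simple graph, in the polynomial ring with variables the vertices. -/
def edgeIdeal (K : Type) [Field K] {V : Type} (G : SimpleGraph V) :
    Ideal (MvPolynomial V K) :=
  Ideal.span { p | ∃ u v : V, G.Adj u v ∧ p = X u * X v }

/-- The edge ideal of the induced subgraph on a set `s` of vertices, viewed inside the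
polynomial ring of the ambient graph (extra variables do not change the regularity). -/
def edgeIdealOn (K : Type) [Field K] {V : Type} (G : SimpleGraph V) (s : Set V) :
    Ideal (MvPolynomial V K) :=
  Ideal.span { p | ∃ u v : V, G.Adj u v ∧ u ∈ s ∧ v ∈ s ∧ p = X u * X v }

/-- The `r`-th symbolic power of an ideal: the intersection over all minimal primes `p` of `I`
of the contraction of `I^r` localized at `p`; concretely,
`f ∈ I^{(r)}` iff for every minimal prime `p` of `I` there is `s ∉ p` with `s * f ∈ I ^ r`. -/
def symbolicPower {R : Type} [CommRing R] (I : Ideal R) (r : ℕ) : Ideal R where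
  carrier := { f | ∀ p ∈ I.minimalPrimes, ∃ s, s ∉ p ∧ s * f ∈ I ^ r }
  zero_mem' := by
    intro p hp
    exact ⟨1, (Ideal.ne_top_iff_one p).mp hp.1.1.ne_top, by simp⟩
  add_mem' := by
    intro a b ha hb p hp
    obtain ⟨s, hs, hsa⟩ := ha p hp
    obtain ⟨t, ht, htb⟩ := hb p hp
    refine ⟨s * t, fun h => ?_, ?_⟩
    · rcases hp.1.1.mem_or_mem h with h' | h'
      · exact hs h'
      · exact ht h'
    · have : s * t * (a + b) = t * (s * a) + s * (t * b) := by ring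
      rw [this]
      exact Ideal.add_mem _ (Ideal.mul_mem_left _ _ hsa) (Ideal.mul_mem_left _ _ htb)
  smul_mem' := by
    intro c f hf p hp
    obtain ⟨s, hs, hsf⟩ := hf p hp
    refine ⟨s, hs, ?_⟩
    have : s * (c • f) = c * (s * f) := by
      simp only [smul_eq_mul]; ring
    rw [this]
    exact Ideal.mul_mem_left _ _ hsf

/-- Symbolic power with an integer exponent, with the convention `I^{(k)} = S` for `k ≤ 0`. -/
def symbolicPowerZ {R : Type} [CommRing R] (I : Ideal R) (k : ℤ) : Ideal R :=
  if k ≤ 0 then ⊤ else symbolicPower I k.toNat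

/-- A graded free resolution of `S/I` over the polynomial ring `S = K[x_v]`:
`⋯ → F_{i+1} → F_i → ⋯ → F_0 = S → S/I → 0`, where `F_i` is a graded free module with
basis elements of degrees `deg i k`, the differentials are given by matrices of homogeneous
polynomials of the appropriate degrees, the image of `F_1 → F_0 = S` is `I`, and the
complex is exact in positive homological degrees. -/
structure GradedFreeResolution {K : Type} [Field K] {σ : Type}
    (I : Ideal (MvPolynomial σ K)) where
  rank : ℕ → ℕ
  deg : (i : ℕ) → Fin (rank i) → ℕ
  rank_zero : rank 0 = 1
  deg_zero : ∀ k, deg 0 k = 0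
  mat : (i : ℕ) → Matrix (Fin (rank i)) (Fin (rank (i + 1))) (MvPolynomial σ K)
  homog : ∀ i k j, mat i k j = 0 ∨
    ∃ e, deg (i + 1) j = deg i k + e ∧ (mat i k j).IsHomogeneous e
  range_zero : ∀ f : MvPolynomial σ K,
    f ∈ I ↔ (fun _ => f) ∈ LinearMap.range (Matrix.mulVecLin (mat 0))
  isExact : ∀ i, LinearMap.ker (Matrix.mulVecLin (mat i)) =
    LinearMap.range (Matrix.mulVecLin (mat (i + 1)))

/-- The Castelnuovo–Mumford regularity of the quotient `S/I` for a homogeneous ideal `I` of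
the polynomial ring: the least `d` such that some graded free resolution of `S/I` has all its
`i`-th syzygies generated in degrees `≤ d + i` (the minimal free resolution realizes the
infimum).  By convention `reg (S/S) = ⊥ = -∞`. -/

def regQuot {K : Type} [Field K] {σ : Type} (I : Ideal (MvPolynomial σ K)) : WithBot ℤ :=
  if I = ⊤ then ⊥
  else ((sInf { d : ℤ | ∃ F : GradedFreeResolution I,
      ∀ i (k : Fin (F.rank i)), (F.deg i k : ℤ) ≤ d + i } : ℤ) : WithBot ℤ)

/-- A set of edges of `G` that forms a matching: pairwise disjoint edges. -/
def IsMatchingSet {V : Type} (G : SimpleGraph V) (M : Finset (Sym2 V)) : Prop :=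
  (M : Set (Sym2 V)) ⊆ G.edgeSet ∧
    (M : Set (Sym2 V)).Pairwise fun e f => ∀ v, v ∈ e → v ∉ f

/-- An induced matching: a matching such that no two of its edges are joined by an edge
of `G`, i.e. it is the edge set of an induced subgraph. -/
def IsInducedMatchingSet {V : Type} (G : SimpleGraph V) (M : Finset (Sym2 V)) : Prop :=
  IsMatchingSet G M ∧
    (M : Set (Sym2 V)).Pairwise fun e f => ∀ u v, u ∈ e → v ∈ f → ¬G.Adj u v

/-- The matching number `mat(G)`. -/
def matchingNumber {V : Type} (G : SimpleGraph V) : ℕ :=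
  sSup { n | ∃ M, IsMatchingSet G M ∧ M.card = n }

/-- The induced matching number `ν(G)`. -/
def inducedMatchingNumber {V : Type} (G : SimpleGraph V) : ℕ :=
  sSup { n | ∃ M, IsInducedMatchingSet G M ∧ M.card = n }

/-- `G` has an induced cycle of length `n`. -/
def HasInducedCycle {V : Type} (G : SimpleGraph V) (n : ℕ) : Prop :=
  ∃ f : ZMod n → V, Function.Injective f ∧
    ∀ i j : ZMod n, G.Adj (f i) (f j) ↔ (j = i + 1 ∨ i = j + 1)

/-- A graph is chordal if every induced cycle has length `3`. -/
def Chordal {V : Type} (G : SimpleGraph V) : Prop :=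
  ∀ n, 4 ≤ n → ¬HasInducedCycle G n

/-- A graph is weakly chordal if every induced cycle in `G` and in `Gᶜ` has length at most 4. -/
def WeaklyChordal {V : Type} (G : SimpleGraph V) : Prop :=
  (∀ n, 5 ≤ n → ¬HasInducedCycle G n) ∧ ∀ n, 5 ≤ n → ¬HasInducedCycle Gᶜ n

/-- The co-chordal cover number `cochord(G)`: the least `n` such that `n` co-chordal
subgraphs of `G` cover all the edges of `G`. -/
def cochordNumber {V : Type} (G : SimpleGraph V) : ℕ :=
  sInf { n | ∃ H : Fin n → SimpleGraph V,
    (∀ i, H i ≤ G ∧ Chordal (H i)ᶜ) ∧ ∀ e ∈ G.edgeSet, ∃ i, e ∈ (H i).edgeSet }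

/-- A graph is unicyclic if it contains exactly one cycle. -/
def Unicyclic {V : Type} (G : SimpleGraph V) : Prop :=
  ∃ (v : V) (c : G.Walk v v), c.IsCycle ∧
    ∀ (w : V) (c' : G.Walk w w), c'.IsCycle → { e | e ∈ c'.edges } = { e | e ∈ c.edges }

/-- Data exhibiting `G` as the graph `H_T` obtained from the induced subgraph on `Hset`
by attaching, at each vertex of `T ⊆ Hset`, a union of complete graphs having that vertex as
their only common vertex: a family of cliques `C i` of `G`, each meeting `Hset` exactly in
its attachment vertex `a i ∈ T`, two distinct cliques meeting in at most the common
attachment vertex, together covering all vertices outside `Hset`, and all edges of `G`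
lying either inside `Hset` or inside one of the cliques. -/
structure CliqueAttachment {V : Type} (G : SimpleGraph V) (Hset T : Set V) where
  ι : Type
  C : ι → Finset V
  a : ι → V
  a_mem_T : ∀ i, a i ∈ T
  T_sub : T ⊆ Hset
  inter_H : ∀ i, (C i : Set V) ∩ Hset = {a i}
  a_mem_C : ∀ i, a i ∈ C i
  clique : ∀ i, G.IsClique (C i)
  pairwise_inter : ∀ i j, i ≠ j → (C i : Set V) ∩ (C j : Set V) ⊆ ({a i} : Set V)
  cover : Hset ∪ (⋃ i, (C i : Set V)) = Set.univ
  edges_sub : ∀ u v, G.Adj u v → (u ∈ Hset ∧ v ∈ Hset) ∨ ∃ i, u ∈ C i ∧ v ∈ C i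

end EdgeIdealReg


namespace EIR

section Koszul

variable {V : Type} [LinearOrder V] (K : Type) [Field K]

/-- sign function -/
def sgn (v : V) (τ : Finset V) : K := (-1) ^ (τ.filter (· < v)).card

variable {K}

theorem sgn_mul_self (v : V) (τ : Finset V) : sgn K v τ * sgn K v τ = 1 := by
  unfold sgn
  rw [← pow_add, ← two_mul, pow_mul]; simp

theorem sgn_insert {v x : V} {τ : Finset V} (hv : v ∉ τ) :
    sgn K x (insert v τ) = (if v < x then -1 else 1) * sgn K x τ := by
  unfold sgn
  rw [Finset.filter_insert]
  split_ifs with h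
  · rw [Finset.card_insert_of_notMem (by simp [hv]), pow_succ]; ring
  · simp

theorem sgn_comm {x v : V} {τ : Finset V} (hxv : x ≠ v) (hx : x ∉ τ) (hv : v ∉ τ) :
    sgn K x (insert v τ) * sgn K v τ = - (sgn K v (insert x τ) * sgn K x τ) := by
  rw [sgn_insert hv, sgn_insert hx]
  rcases lt_or_gt_of_ne hxv with h | h
  · simp [h, h.not_gt]; ring
  · simp [h, h.not_gt]; ring

/-- variants of the sign identity -/
theorem sgn_comm' {x v : V} {τ : Finset V} (hxv : x ≠ v) (hx : x ∉ τ) (hv : v ∉ τ) :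
    sgn K v (insert x τ) * sgn K x (insert v τ) = - (sgn K v τ * sgn K x τ) := by
  rw [sgn_insert hv, sgn_insert hx]
  rcases lt_or_gt_of_ne hxv with h | h
  · simp [h, h.not_gt]
  · simp [h, h.not_gt]

variable (B : Finset V)

/-- Koszul codifferential -/
def dl (B : Finset V) (c : Finset V → K) (τ : Finset V) : K :=
  ∑ v ∈ B \ τ, sgn K v τ * c (insert v τ)

theorem dl_sub (B : Finset V) (c c' : Finset V → K) (τ : Finset V) :
    dl B (fun s => c s - c' s) τ = dl B c τ - dl B c' τ := by
  simp [dl, mul_sub, Finset.sum_sub_distrib]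

theorem dl_add (B : Finset V) (c c' : Finset V → K) (τ : Finset V) :
    dl B (fun s => c s + c' s) τ = dl B c τ + dl B c' τ := by
  simp [dl, mul_add, Finset.sum_add_distrib]

theorem dl_neg (B : Finset V) (c : Finset V → K) (τ : Finset V) :
    dl B (fun s => - c s) τ = - dl B c τ := by
  simp [dl]

theorem dl_dl (B : Finset V) (c : Finset V → K) (τ : Finset V) :
    dl B (dl B c) τ = 0 := by
  have h1 : dl B (dl B c) τ = ∑ v ∈ B \ τ, ∑ x ∈ B \ τ,
      if x = v then 0 else sgn K v τ * (sgn K x (insert v τ) * c (insert x (insert v τ))) := by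
    unfold dl
    refine Finset.sum_congr rfl fun v hv => ?_
    rw [Finset.mul_sum]
    have : B \ insert v τ = (B \ τ).filter (fun x => ¬ x = v) := by
      ext x; simp; tauto
    rw [this, Finset.sum_filter]
    refine Finset.sum_congr rfl fun x hx => ?_
    by_cases h : x = v <;> simp [h]
  have h2 : dl B (dl B c) τ = - dl B (dl B c) τ := by
    conv_lhs => rw [h1, Finset.sum_comm]
    rw [h1, ← Finset.sum_neg_distrib]
    refine Finset.sum_congr rfl fun v hv => ?_
    rw [← Finset.sum_neg_distrib]
    refine Finset.sum_congr rfl fun x hx => ?_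
    by_cases h : v = x
    · simp [h]
    · rw [if_neg h, if_neg (Ne.symm h), Finset.insert_comm v x]
      have := sgn_comm (K := K) h (Finset.mem_sdiff.1 hv).2 (Finset.mem_sdiff.1 hx).2
      linear_combination c (insert x (insert v τ)) * this
  have h3 : dl B (dl B c) τ = 0 := by
    rw [h1]
    have : ∀ (s : Finset V) (f : V → V → K), (∀ v ∈ s, ∀ x ∈ s, f v x = - f x v) → 
      (∀ v ∈ s, f v v = 0) → ∑ v ∈ s, ∑ x ∈ s, f v x = 0 := by
      intro s
      induction s using Finset.induction_on with
      | empty => simp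
      | insert a s ha ih =>
        intro f h1 h2
        rw [Finset.sum_insert ha]
        simp only [Finset.sum_insert ha]
        rw [Finset.sum_add_distrib, ih f (fun v hv x hx => h1 v (by simp [hv]) x (by simp [hx]))
          (fun v hv => h2 v (by simp [hv])), h2 a (by simp)]
        rw [zero_add, add_zero, ← Finset.sum_add_distrib]
        refine Finset.sum_eq_zero fun x hx => ?_
        rw [h1 a (by simp) x (by simp [hx])]; ring
    apply this
    · intro v hv x hx
      by_cases h : x = v
      · simp [h]
      · rw [if_neg h, if_neg (Ne.symm h), Finset.insert_comm v x]
        have := sgn_comm (K := K) h (Finset.mem_sdiff.1 hx).2 (Finset.mem_sdiff.1 hv).2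
        linear_combination c (insert x (insert v τ)) * this
    · intro v hv; simp
  exact h3

variable (K)
/-- vanishing of relative Koszul homology -/
def Van (B : Finset V) (A : Finset V → Prop) (i : ℕ) : Prop :=
  ∀ c : Finset V → K, (∀ τ, τ ⊆ B → A τ → τ.card + 1 = i → dl B c τ = 0) →
    ∃ w : Finset V → K, ∀ σ, σ ⊆ B → A σ → σ.card = i → c σ = dl B w σ
variable {K}

theorem Van.congr {B : Finset V} {A A' : Finset V → Prop} {i : ℕ} (h : Van K B A i)
    (hA : ∀ σ ⊆ B, (A σ ↔ A' σ)) : Van K B A' i := by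
  intro c hc
  obtain ⟨w, hw⟩ := h c (fun τ h1 h2 h3 => hc τ h1 ((hA τ h1).1 h2) h3)
  exact ⟨w, fun σ h1 h2 h3 => hw σ h1 ((hA σ h1).2 h2) h3⟩

theorem Van.of_empty {B : Finset V} {A : Finset V → Prop} {i : ℕ}
    (h : ∀ σ ⊆ B, σ.card = i → ¬ A σ) : Van K B A i := by
  intro c hc
  exact ⟨fun _ => 0, fun σ h1 h2 h3 => absurd h2 (h σ h1 h3)⟩

theorem Van.ext {B B' : Finset V} {A A1 A2 : Finset V → Prop} {i : ℕ} (hB : B' ⊆ B)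
    (hup1 : ∀ τ ⊆ B, ∀ v ∈ B, A1 τ → A1 (insert v τ))
    (hup2 : ∀ τ ⊆ B', ∀ v ∈ B', A2 τ → A2 (insert v τ))
    (hup : ∀ τ ⊆ B, ∀ v ∈ B, A τ → A (insert v τ))
    (hA : ∀ τ ⊆ B, (A τ ↔ A1 τ ∨ (τ ⊆ B' ∧ A2 τ)))
    (hdis : ∀ τ ⊆ B', A1 τ → ¬ A2 τ)
    (h1 : Van K B A1 i) (h2 : Van K B' A2 i) : Van K B A i := by
  classical
  intro c hc
  obtain ⟨w, hw⟩ := h1 c (fun τ a1 a2 a3 => hc τ a1 ((hA τ a1).2 (Or.inl a2)) a3)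
  set c' : Finset V → K := fun σ => if σ ⊆ B' ∧ A2 σ then c σ - dl B w σ else 0 with hc'
  obtain ⟨w', hw'⟩ := h2 c' (by
    intro τ t1 t2 t3
    have e : dl B' c' τ = dl B (fun s => c s - dl B w s) τ := by
      unfold dl
      rw [← Finset.sum_subset (Finset.sdiff_subset_sdiff hB (le_refl τ))]
      · refine Finset.sum_congr rfl fun v hv => ?_
        simp only [hc']
        rw [if_pos]; · rfl
        exact ⟨Finset.insert_subset (Finset.mem_sdiff.1 hv).1 t1,
          hup2 τ t1 v (Finset.mem_sdiff.1 hv).1 t2⟩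
      · intro v hv hv'
        have hvB := (Finset.mem_sdiff.1 hv).1
        have hs : insert v τ ⊆ B := Finset.insert_subset hvB (t1.trans hB)
        have : A (insert v τ) := hup τ (t1.trans hB) v hvB ((hA τ (t1.trans hB)).2 (Or.inr ⟨t1, t2⟩))
        rcases (hA _ hs).1 this with h | h
        · have := hw _ hs h (by rw [Finset.card_insert_of_notMem (Finset.mem_sdiff.1 hv).2, t3])
          have : c (insert v τ) - dl B w (insert v τ) = 0 := by rw [this]; simp
          exact mul_eq_zero_of_right _ this
        · exact absurd (Finset.mem_sdiff.2 ⟨h.1 (by simp), (Finset.mem_sdiff.1 hv).2⟩) hv'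
    rw [e, dl_sub, dl_dl, hc τ (t1.trans hB) ((hA τ (t1.trans hB)).2 (Or.inr ⟨t1, t2⟩)) t3]
    simp)
  set w'' : Finset V → K := fun σ => if σ ⊆ B' ∧ A2 σ then w' σ else 0 with hw''
  refine ⟨fun s => w s + w'' s, fun σ s1 s2 s3 => ?_⟩
  rw [dl_add]
  by_cases hσ : σ ⊆ B' ∧ A2 σ
  · have e : dl B w'' σ = dl B' w' σ := by
      unfold dl
      symm
      rw [← Finset.sum_subset (Finset.sdiff_subset_sdiff hB (le_refl σ))]
      · refine Finset.sum_congr rfl fun v hv => ?_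
        simp only [hw'']
        rw [if_pos]
        exact ⟨Finset.insert_subset (Finset.mem_sdiff.1 hv).1 hσ.1,
          hup2 σ hσ.1 v (Finset.mem_sdiff.1 hv).1 hσ.2⟩
      · intro v hv hv'
        simp only [hw'']
        rw [if_neg, mul_zero]
        intro h
        exact hv' (Finset.mem_sdiff.2 ⟨h.1 (by simp), (Finset.mem_sdiff.1 hv).2⟩)
    rw [e, ← hw' σ hσ.1 hσ.2 s3]
    simp only [hc']
    rw [if_pos hσ]; ring
  · have h1 : A1 σ := by
      rcases (hA σ s1).1 s2 with h | h
      · exact h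
      · exact absurd h hσ
    have e : dl B w'' σ = 0 := by
      refine Finset.sum_eq_zero fun v hv => ?_
      simp only [hw'']
      rw [if_neg, mul_zero]
      intro h
      exact hdis _ h.1 (hup1 σ s1 v (Finset.mem_sdiff.1 hv).1 h1) h.2
    rw [e, add_zero]
    exact hw σ s1 h1 s3

theorem Van.shift {B' : Finset V} {x : V} (hx : x ∉ B') {A A' : Finset V → Prop} {i : ℕ}
    (hA : ∀ σ ⊆ insert x B', (A σ ↔ x ∈ σ ∧ A' (σ.erase x)))
    (h : Van K B' A' i) : Van K (insert x B') A (i + 1) := by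
  intro c hc
  have key : ∀ τ ⊆ B', ∀ f : Finset V → K, dl (insert x B') f (insert x τ) =
      ∑ v ∈ B' \ τ, sgn K v (insert x τ) * f (insert v (insert x τ)) := by
    intro τ hτ f
    unfold dl
    refine Finset.sum_congr ?_ fun _ _ => rfl
    ext v; simp only [Finset.mem_sdiff, Finset.mem_insert]
    constructor
    · rintro ⟨h1, h2⟩; tauto
    · rintro ⟨h1, h2⟩
      have : v ≠ x := fun e => hx (e ▸ h1)
      tauto
  obtain ⟨w1, hw1⟩ := h (fun τ => sgn K x τ * c (insert x τ)) (by
    intro τ t1 t2 t3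
    have hxτ : x ∉ τ := fun hh => hx (t1 hh)
    have := hc (insert x τ) (Finset.insert_subset_insert _ t1) ((hA _ (Finset.insert_subset_insert _ t1)).2
      ⟨by simp, by rwa [Finset.erase_insert hxτ]⟩) (by rw [Finset.card_insert_of_notMem hxτ, t3])
    rw [key τ t1] at this
    have e : dl B' (fun τ => sgn K x τ * c (insert x τ)) τ = - sgn K x τ * 
       ∑ v ∈ B' \ τ, sgn K v (insert x τ) * c (insert v (insert x τ)) := by
      unfold dl
      rw [Finset.mul_sum]
      refine Finset.sum_congr rfl fun v hv => ?_
      have hv' := Finset.mem_sdiff.1 hv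
      have hxv : x ≠ v := fun e => hx (e ▸ hv'.1)
      have := sgn_comm (K := K) hxv hxτ hv'.2
      beta_reduce
      rw [Finset.insert_comm x v]
      linear_combination c (insert v (insert x τ)) * this
    rw [e, this, mul_zero])
  refine ⟨fun ρ => - sgn K x (ρ.erase x) * w1 (ρ.erase x), fun σ s1 s2 s3 => ?_⟩
  obtain ⟨hxσ, hA'⟩ := (hA σ s1).1 s2
  obtain ⟨τ, hτ, rfl⟩ : ∃ τ, x ∉ τ ∧ insert x τ = σ := ⟨σ.erase x, by simp, Finset.insert_erase hxσ⟩
  have hτB : τ ⊆ B' := by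
    intro v hv
    have := s1 (Finset.mem_insert_of_mem hv)
    rcases Finset.mem_insert.1 this with h | h
    · exact absurd (h ▸ hv) hτ
    · exact h
  rw [Finset.erase_insert hτ] at hA'
  rw [Finset.card_insert_of_notMem hτ] at s3
  have := hw1 τ hτB hA' (by omega)
  rw [key τ hτB]
  have e : ∑ v ∈ B' \ τ, sgn K v (insert x τ) * (- sgn K x ((insert v (insert x τ)).erase x) * 
      w1 ((insert v (insert x τ)).erase x)) = sgn K x τ * dl B' w1 τ := by
    unfold dl
    rw [Finset.mul_sum]
    refine Finset.sum_congr rfl fun v hv => ?_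
    have hv' := Finset.mem_sdiff.1 hv
    have hxv : x ≠ v := fun e => hx (e ▸ hv'.1)
    rw [Finset.insert_comm v x, Finset.erase_insert (by simp [hxv, hτ])]
    have := sgn_comm' (K := K) hxv hτ hv'.2
    linear_combination - w1 (insert v τ) * this
  rw [e, ← this, ← mul_assoc, sgn_mul_self, one_mul]

theorem Van.free {B : Finset V} {x : V} (hx : x ∈ B) {A : Finset V → Prop} {i : ℕ}
    (hA : ∀ σ ⊆ B, A σ → A (σ.erase x)) : Van K B A i := by
  intro c hc
  refine ⟨fun σ => if x ∈ σ then sgn K x (σ.erase x) * c (σ.erase x) else 0, fun σ s1 s2 s3 => ?_⟩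
  by_cases hxσ : x ∈ σ
  · obtain ⟨τ, hτ, rfl⟩ : ∃ τ, x ∉ τ ∧ insert x τ = σ := ⟨σ.erase x, by simp, Finset.insert_erase hxσ⟩
    have hτB : τ ⊆ B := (Finset.subset_insert _ _).trans s1
    have h0 := hc τ hτB (by have := hA _ s1 s2; rwa [Finset.erase_insert hτ] at this)
      (by rwa [Finset.card_insert_of_notMem hτ] at s3)
    have e1 : dl B c τ = sgn K x τ * c (insert x τ) + 
        ∑ v ∈ B \ insert x τ, sgn K v τ * c (insert v τ) := by
      unfold dl
      rw [Finset.sdiff_insert, Finset.add_sum_erase (B \ τ) (fun v => sgn K v τ * c (insert v τ))]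
      exact Finset.mem_sdiff.2 ⟨hx, hτ⟩
    unfold dl
    have e2 : ∀ v ∈ B \ insert x τ, sgn K v (insert x τ) * 
        (if x ∈ insert v (insert x τ) then sgn K x ((insert v (insert x τ)).erase x) * 
          c ((insert v (insert x τ)).erase x) else 0) = - sgn K x τ * (sgn K v τ * c (insert v τ)) := by
      intro v hv
      have hv' := Finset.mem_sdiff.1 hv
      have hxv : x ≠ v := fun e => hv'.2 (by simp [e])
      have hvτ : v ∉ τ := fun e => hv'.2 (by simp [e])
      rw [if_pos (by simp), Finset.insert_comm v x, Finset.erase_insert (by simp [hxv, hτ])]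
      have := sgn_comm' (K := K) hxv hτ hvτ
      linear_combination c (insert v τ) * this
    rw [Finset.sum_congr rfl e2, ← Finset.mul_sum]
    have := sgn_mul_self (K := K) x τ
    linear_combination (-sgn K x τ) * (e1 - h0) - c (insert x τ) * this
  · unfold dl
    rw [Finset.sum_eq_single x]
    · beta_reduce
      rw [if_pos (by simp), Finset.erase_insert hxσ, ← mul_assoc, sgn_mul_self, one_mul]
    · intro v hv hvx
      beta_reduce
      rw [if_neg (by simp [Ne.symm hvx, hxσ]), mul_zero]
    · intro h; exact absurd (Finset.mem_sdiff.2 ⟨hx, hxσ⟩) h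

theorem Van.unedge {B : Finset V} {x y : V} (hx : x ∉ B) (hy : y ∉ B) (hxy : x ≠ y)
    {A A' : Finset V → Prop} {i : ℕ}
    (hA : ∀ σ ⊆ insert x (insert y B), (A' σ ↔ (x ∈ σ ∨ y ∈ σ) ∧ A ((σ.erase x).erase y)))
    (h : Van K (insert x (insert y B)) A' (i + 1)) : Van K B A i := by
  intro c hc
  have sub1 : ∀ {ρ : Finset V}, ρ ⊆ B → x ∉ ρ := fun h hh => hx (h hh)
  have sub2 : ∀ {ρ : Finset V}, ρ ⊆ B → y ∉ ρ := fun h hh => hy (h hh)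
  have keyx : ∀ τ ⊆ B, ∀ f : Finset V → K, dl (insert x (insert y B)) f (insert x τ) =
      sgn K y (insert x τ) * f (insert y (insert x τ)) +
      ∑ v ∈ B \ τ, sgn K v (insert x τ) * f (insert v (insert x τ)) := by
    intro τ hτ f
    unfold dl
    rw [← Finset.sum_insert (s := B \ τ) (a := y) (f := fun v => sgn K v (insert x τ) * f (insert v (insert x τ))) (by simp [hy])]
    refine Finset.sum_congr ?_ fun _ _ => rfl
    ext v; simp only [Finset.mem_sdiff, Finset.mem_insert]
    have := sub1 hτ; have := sub2 hτ
    have h1 : v ∈ B → v ≠ x := fun a e => hx (e ▸ a)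
    have h2 : v = y → v ∉ τ := fun e => e ▸ sub2 hτ
    have h3 : v = y → v ≠ x := fun e => e ▸ hxy.symm
    tauto
  have keyy : ∀ τ ⊆ B, ∀ f : Finset V → K, dl (insert x (insert y B)) f (insert y τ) =
      sgn K x (insert y τ) * f (insert x (insert y τ)) +
      ∑ v ∈ B \ τ, sgn K v (insert y τ) * f (insert v (insert y τ)) := by
    intro τ hτ f
    unfold dl
    rw [← Finset.sum_insert (s := B \ τ) (a := x) (f := fun v => sgn K v (insert y τ) * f (insert v (insert y τ))) (by simp [hx])]
    refine Finset.sum_congr ?_ fun _ _ => rfl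
    ext v; simp only [Finset.mem_sdiff, Finset.mem_insert]
    have h1 : v ∈ B → v ≠ y := fun a e => hy (e ▸ a)
    have h2 : v = x → v ∉ τ := fun e => e ▸ sub1 hτ
    have h3 : v = x → v ≠ y := fun e => e ▸ hxy
    tauto
  have subx : ∀ {ρ : Finset V}, ρ ⊆ B → insert x ρ ⊆ insert x (insert y B) := fun h =>
    Finset.insert_subset_insert _ (h.trans (Finset.subset_insert _ _))
  have suby : ∀ {ρ : Finset V}, ρ ⊆ B → insert y ρ ⊆ insert x (insert y B) := fun h =>
    (Finset.insert_subset_insert _ h).trans (Finset.subset_insert _ _)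
  have erx : ∀ {ρ : Finset V}, ρ ⊆ B → ((insert x ρ).erase x).erase y = ρ := fun h => by
    rw [Finset.erase_insert (sub1 h), Finset.erase_eq_of_notMem (sub2 h)]
  have ery : ∀ {ρ : Finset V}, ρ ⊆ B → ((insert y ρ).erase x).erase y = ρ := fun h => by
    rw [Finset.erase_right_comm, Finset.erase_insert (sub2 h), Finset.erase_eq_of_notMem (sub1 h)]
  set C : Finset V → K := fun σ => if x ∈ σ ∧ y ∉ σ then sgn K x (σ.erase x) * c (σ.erase x) else 0
    with hC
  obtain ⟨w, hw⟩ := h C (by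
    intro τ t1 t2 t3
    obtain ⟨h1, h2⟩ := (hA τ t1).1 t2
    by_cases hyτ : y ∈ τ
    · refine Finset.sum_eq_zero fun v hv => ?_
      simp only [hC]
      rw [if_neg (by simp [hyτ]), mul_zero]
    · have hxτ : x ∈ τ := by tauto
      obtain ⟨ρ, hρ, rfl⟩ : ∃ ρ, x ∉ ρ ∧ insert x ρ = τ :=
        ⟨τ.erase x, by simp, Finset.insert_erase hxτ⟩
      have hρB : ρ ⊆ B := by
        intro v hv
        have := t1 (Finset.mem_insert_of_mem hv)
        rcases Finset.mem_insert.1 this with h | h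
        · exact absurd (h ▸ hv) hρ
        · rcases Finset.mem_insert.1 h with h | h
          · exact absurd (Finset.mem_insert_of_mem (h ▸ hv)) hyτ
          · exact h
      rw [erx hρB] at h2
      have h0 := hc ρ hρB h2 (by rwa [Finset.card_insert_of_notMem hρ, Nat.add_right_cancel_iff] at t3)
      rw [keyx ρ hρB]
      have e1 : C (insert y (insert x ρ)) = 0 := by simp [hC]
      rw [e1, mul_zero, zero_add]
      have e2 : ∀ v ∈ B \ ρ, sgn K v (insert x ρ) * C (insert v (insert x ρ)) = 
          - sgn K x ρ * (sgn K v ρ * c (insert v ρ)) := by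
        intro v hv
        have hv' := Finset.mem_sdiff.1 hv
        have hxv : x ≠ v := fun e => hx (e ▸ hv'.1)
        have hyv : y ≠ v := fun e => hy (e ▸ hv'.1)
        simp only [hC]
        rw [if_pos ⟨by simp, by simp [hyv, sub2 hρB, hxy.symm]⟩, Finset.insert_comm v x,
          Finset.erase_insert (by simp [hxv, hρ])]
        have := sgn_comm' (K := K) hxv hρ hv'.2
        linear_combination c (insert v ρ) * this
      rw [Finset.sum_congr rfl e2, ← Finset.mul_sum]
      unfold dl at h0
      rw [h0, mul_zero])
  refine ⟨fun s => - (sgn K x s * w (insert x s)) + - (sgn K y s * w (insert y s)), fun ρ r1 r2 r3 => ?_⟩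
  have hxρ := sub1 r1
  have hyρ := sub2 r1
  have a1 := hw (insert x ρ) (subx r1) ((hA _ (subx r1)).2 ⟨by simp, by rwa [erx r1]⟩)
    (by rw [Finset.card_insert_of_notMem hxρ, r3])
  have a2 := hw (insert y ρ) (suby r1) ((hA _ (suby r1)).2 ⟨by simp, by rwa [ery r1]⟩)
    (by rw [Finset.card_insert_of_notMem hyρ, r3])
  rw [keyx ρ r1] at a1
  rw [keyy ρ r1] at a2
  have b1 : C (insert x ρ) = sgn K x ρ * c ρ := by
    simp only [hC]
    rw [if_pos ⟨by simp, by simp [hyρ, hxy.symm]⟩, Finset.erase_insert hxρ]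
  have b2 : C (insert y ρ) = 0 := by
    simp only [hC]; rw [if_neg (by simp)]
  rw [b1] at a1
  rw [b2] at a2
  have f1 : dl B (fun s => sgn K x s * w (insert x s)) ρ = - sgn K x ρ * 
      ∑ v ∈ B \ ρ, sgn K v (insert x ρ) * w (insert v (insert x ρ)) := by
    unfold dl
    rw [Finset.mul_sum]
    refine Finset.sum_congr rfl fun v hv => ?_
    have hv' := Finset.mem_sdiff.1 hv
    have hxv : x ≠ v := fun e => hx (e ▸ hv'.1)
    have := sgn_comm (K := K) hxv hxρ hv'.2
    beta_reduce
    rw [Finset.insert_comm x v]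
    linear_combination w (insert v (insert x ρ)) * this
  have f2 : dl B (fun s => sgn K y s * w (insert y s)) ρ = - sgn K y ρ * 
      ∑ v ∈ B \ ρ, sgn K v (insert y ρ) * w (insert v (insert y ρ)) := by
    unfold dl
    rw [Finset.mul_sum]
    refine Finset.sum_congr rfl fun v hv => ?_
    have hv' := Finset.mem_sdiff.1 hv
    have hyv : y ≠ v := fun e => hy (e ▸ hv'.1)
    have := sgn_comm (K := K) hyv hyρ hv'.2
    beta_reduce
    rw [Finset.insert_comm y v]
    linear_combination w (insert v (insert y ρ)) * this
  rw [dl_add, dl_neg, dl_neg, f1, f2]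
  rw [Finset.insert_comm y x] at a1
  have s1 := sgn_mul_self (K := K) x ρ
  have s2 := sgn_comm (K := K) hxy hxρ hyρ
  linear_combination (sgn K x ρ) * a1 - c ρ * s1 + sgn K y ρ * a2 + w (insert x (insert y ρ)) * s2

end Koszul

end EIR


namespace EIR

section Reg

variable {V : Type} [LinearOrder V] {K : Type} [Field K]

/-- indicator exponent of a finite set -/
noncomputable def ind (σ : Finset V) : V →₀ ℕ := Finsupp.indicator σ (fun _ _ => 1)

theorem ind_apply (σ : Finset V) (v : V) : ind σ v = if v ∈ σ then 1 else 0 := by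
  simp [ind, Finsupp.indicator_apply]

/-- unit exponent -/
noncomputable abbrev e1 (v : V) : V →₀ ℕ := Finsupp.single v 1

theorem e1_apply (v u : V) : e1 v u = if v = u then 1 else 0 := Finsupp.single_apply

theorem ind_insert {v : V} {τ : Finset V} (h : v ∉ τ) : ind (insert v τ) = ind τ + e1 v := by
  ext u
  simp only [ind_apply, Finsupp.add_apply, e1_apply, Finset.mem_insert]
  by_cases h1 : u = v
  · subst h1; simp [h]
  · simp [h1, Ne.symm h1]

theorem ind_mono {σ τ : Finset V} (h : σ ⊆ τ) : ind σ ≤ ind τ := by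
  intro u
  simp only [ind_apply]
  by_cases h1 : u ∈ σ
  · simp [h1, h h1]
  · simp [h1]

/-- up-closed sets of exponents -/
def Up (J : (V →₀ ℕ) → Prop) : Prop := ∀ f g, f ≤ g → J f → J g

variable (K) in
/-- combinatorial regularity bound on a set of vertices -/
def RegOn (Y : Set V) (J : (V →₀ ℕ) → Prop) (d : ℤ) : Prop :=
  ∀ b : V →₀ ℕ, (b.support : Set V) ⊆ Y → ∀ i : ℕ, d + i < (b.degree : ℤ) →
    Van K b.support (fun σ => ¬ J (b - ind σ)) i

theorem supp_mono {f g : V →₀ ℕ} (h : f ≤ g) : f.support ⊆ g.support := by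
  intro v hv
  have := h v
  simp only [Finsupp.mem_support_iff] at *
  omega

theorem supp_sub {f g : V →₀ ℕ} : (f - g).support ⊆ f.support := supp_mono tsub_le_self

theorem RegOn.mono {Y Y' : Set V} {J : (V →₀ ℕ) → Prop} {d d' : ℤ} (h : RegOn K Y J d)
    (hY : Y' ⊆ Y) (hd : d ≤ d') : RegOn K Y' J d' :=
  fun b hb i hi => h b (hb.trans hY) i (by omega)

theorem RegOn.congr {Y : Set V} {J J' : (V →₀ ℕ) → Prop} {d : ℤ} (h : RegOn K Y J d)
    (hJ : ∀ f : V →₀ ℕ, (f.support : Set V) ⊆ Y → (J f ↔ J' f)) : RegOn K Y J' d := by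
  intro b hb i hi
  refine (h b hb i hi).congr fun σ _ => not_congr (hJ _ ?_)
  exact (Finset.coe_subset.2 supp_sub).trans hb

theorem Up.fam {J : (V →₀ ℕ) → Prop} (hJ : Up J) (b : V →₀ ℕ) (τ : Finset V) (v : V)
    (h : ¬ J (b - ind τ)) : ¬ J (b - ind (insert v τ)) := fun h' =>
  h (hJ _ _ (tsub_le_tsub_left (ind_mono (Finset.subset_insert _ _)) _) h')

theorem sub_ind_erase {b : V →₀ ℕ} {σ : Finset V} {x : V} (hx : x ∈ σ) (hb : b x ≠ 0) :
    b - ind (σ.erase x) = b - ind σ + e1 x := by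
  ext u
  simp only [Finsupp.add_apply, Finsupp.tsub_apply, ind_apply, e1_apply, Finset.mem_erase]
  by_cases h : x = u
  · subst h; simp [hx]; omega
  · simp [h, Ne.symm h]

theorem le_ind_iff {b m : V →₀ ℕ} {σ : Finset V} (hm : m ≤ b) (hs : σ ⊆ b.support) :
    m ≤ b - ind σ ↔ σ ⊆ (b - m).support := by
  constructor
  · intro h v hv
    have h1 := h v
    have h2 := hs hv
    simp only [Finsupp.mem_support_iff, Finsupp.tsub_apply, ind_apply, hv, if_true] at *
    omega
  · intro h v
    have h1 := hm v
    simp only [Finsupp.tsub_apply, ind_apply]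
    split_ifs with hv
    · have := h hv
      simp only [Finsupp.mem_support_iff, Finsupp.tsub_apply] at this
      omega
    · simpa using h1

theorem degree_sub {b m : V →₀ ℕ} (hm : m ≤ b) : ((b - m).degree : ℤ) = b.degree - m.degree := by
  have : b.degree = (b - m).degree + m.degree := by
    rw [← map_add, tsub_add_cancel_of_le hm]
  omega

/-- exact sequence for adding a monomial -/
theorem RegOn.addMon {Y : Set V} {J : (V →₀ ℕ) → Prop} (hJ : Up J) {D : ℤ} (m : V →₀ ℕ)
    (h1 : RegOn K Y (fun f => J f ∨ m ≤ f) D)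
    (h2 : RegOn K Y (fun f => J (m + f)) (D - m.degree)) : RegOn K Y J D := by
  intro b hb i hi
  by_cases hm : m ≤ b
  · have hBB : (b - m).support ⊆ b.support := supp_sub
    have hadd : ∀ τ ⊆ (b - m).support, m + (b - m - ind τ) = b - ind τ := by
      intro τ hτ
      have h3 := (le_ind_iff hm (hτ.trans hBB)).2 hτ
      ext v
      have := h3 v
      simp only [Finsupp.add_apply, Finsupp.tsub_apply] at *
      omega
    refine Van.ext (B' := (b - m).support) (A2 := fun σ => ¬ J (m + (b - m - ind σ))) hBB
      ?_ ?_ ?_ ?_ ?_ (h1 b hb i hi) (h2 (b - m) ?_ i ?_)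
    · intro τ _ v _ h
      refine Up.fam (J := fun f => J f ∨ m ≤ f) ?_ b τ v h
      intro f g hfg hf
      rcases hf with hf | hf
      · exact Or.inl (hJ _ _ hfg hf)
      · exact Or.inr (hf.trans hfg)
    · intro τ hτ v hv h
      refine Up.fam (J := fun f => J (m + f)) ?_ (b - m) τ v h
      intro f g hfg hf
      exact hJ _ _ (by gcongr) hf
    · intro τ _ v _ h
      exact Up.fam hJ b τ v h
    · intro τ hτ
      have h3 := le_ind_iff hm hτ
      by_cases h4 : τ ⊆ (b - m).support
      · simp only [h3, h4, or_true, true_and, hadd τ h4, not_true_eq_false, false_or]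
      · simp only [h3, h4, or_false, false_and]
    · intro τ hτ h
      exact absurd (Or.inr ((le_ind_iff hm (hτ.trans hBB)).2 hτ)) h
    · exact (Finset.coe_subset.2 hBB).trans hb
    · rw [degree_sub hm]; omega
  · refine (h1 b hb i hi).congr fun σ _ => ?_
    have : ¬ m ≤ b - ind σ := fun h => hm (h.trans tsub_le_self)
    simp [this]

/-- adding variables -/
def plusVars (J : (V →₀ ℕ) → Prop) (S : Set V) : (V →₀ ℕ) → Prop :=
  fun f => J f ∨ ∃ z ∈ S, f z ≠ 0

theorem RegOn.plusVar {Y : Set V} {J : (V →₀ ℕ) → Prop} {d : ℤ} (x : V)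
    (h : RegOn K (Y \ {x}) J d) : RegOn K Y (fun f => J f ∨ f x ≠ 0) d := by
  intro b hb i hi
  by_cases hx0 : b x = 0
  · refine (h b ?_ i hi).congr fun σ _ => ?_
    · intro v hv
      refine ⟨hb hv, ?_⟩
      rintro rfl
      simp [hx0] at hv
    · simp [hx0]
  by_cases hx1 : b x = 1
  · have hle : e1 x ≤ b := by
      intro v; rw [e1_apply]; split_ifs with h
      · subst h; omega
      · exact Nat.zero_le _
    have hS : b.support = insert x (b - e1 x).support := by
      ext v
      simp only [Finsupp.mem_support_iff, Finset.mem_insert, Finsupp.tsub_apply, e1_apply]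
      by_cases h : x = v
      · subst h; simp [hx0]
      · simp [h, Ne.symm h]
    have hxS : x ∉ (b - e1 x).support := by
      simp [hx1]
    have hdeg := degree_sub hle
    have hd1 : (e1 x).degree = 1 := by simp
    rw [hd1] at hdeg
    rcases i with _ | i
    · apply Van.of_empty
      intro σ hσ hc
      rw [Finset.card_eq_zero] at hc
      subst hc
      simp [ind_apply, hx1]
    · have h' := h (b - e1 x) (by
        intro v hv
        refine ⟨hb (supp_sub hv), ?_⟩
        rintro rfl
        exact hxS hv) i (by push_cast at *; omega)
      rw [hS]
      refine Van.shift hxS (fun σ hσ => ?_) h'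
      by_cases hxσ : x ∈ σ
      · have e : b - ind σ = b - e1 x - ind (σ.erase x) := by
          conv_lhs => rw [← Finset.insert_erase hxσ]
          rw [ind_insert (by simp), tsub_tsub, add_comm]
        have e2 : (b - ind σ) x = 0 := by simp [ind_apply, hxσ, hx1]
        rw [← e]
        simp [hxσ, e2]
      · have e2 : (b - ind σ) x ≠ 0 := by simp [ind_apply, hxσ, hx1]
        simp only [hxσ, e2, ne_eq, not_false_eq_true, or_true, not_true_eq_false, false_and]
  · apply Van.of_empty
    intro σ hσ hc h
    apply h
    right
    rw [Finsupp.tsub_apply, ind_apply]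
    split_ifs <;> omega

theorem RegOn.of_supp {Y : Set V} {J : (V →₀ ℕ) → Prop} {d : ℤ} 
    (h : ∀ B : Finset V, (B : Set V) ⊆ Y → RegOn K (B : Set V) J d) : RegOn K Y J d :=
  fun b hb i hi => h b.support hb b (le_refl _) i hi

theorem RegOn.plusVars {Y : Set V} {J : (V →₀ ℕ) → Prop} {d : ℤ} (S : Set V)
    (h : RegOn K (Y \ S) J d) : RegOn K Y (plusVars J S) d := by
  classical
  have fin : ∀ (T : Finset V) (Y : Set V), RegOn K (Y \ (T : Set V)) J d →
      RegOn K Y (EIR.plusVars J (T : Set V)) d := by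
    intro T
    induction T using Finset.induction_on with
    | empty => intro Y h; refine (h.mono (by simp) le_rfl).congr ?_; intro f _; simp [EIR.plusVars]
    | insert a T ha ih =>
      intro Y h
      have := RegOn.plusVar a (ih (Y \ {a}) (h.mono (by
        intro v hv; simp only [Finset.coe_insert, Set.mem_diff, Set.mem_insert_iff, Set.mem_singleton_iff] at *
        tauto) le_rfl))
      refine this.congr fun f _ => ?_
      simp only [EIR.plusVars, Finset.coe_insert, Set.mem_insert_iff, exists_eq_or_imp]
      rw [or_assoc]; exact or_congr_right or_comm
  refine RegOn.of_supp fun B hB => ?_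
  have := fin (B.filter (· ∈ S)) B (h.mono (by
    intro v hv
    simp only [Set.mem_diff, Finset.mem_coe, Finset.mem_filter] at hv
    exact ⟨hB hv.1, fun h => hv.2 ⟨hv.1, h⟩⟩) le_rfl)
  refine this.congr fun f hf => ?_
  simp only [EIR.plusVars, Finset.coe_filter, Set.mem_setOf_eq]
  constructor
  · rintro (h | ⟨z, hz, h⟩)
    · exact Or.inl h
    · exact Or.inr ⟨z, hz.2, h⟩
  · rintro (h | ⟨z, hz, h⟩)
    · exact Or.inl h
    · exact Or.inr ⟨z, ⟨hf (by simpa using h), hz⟩, h⟩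

theorem RegOn.free {Y Z : Set V} {J : (V →₀ ℕ) → Prop} {d : ℤ} 
    (hf : ∀ x ∈ Y, x ∉ Z → ∀ f : V →₀ ℕ, (f.support : Set V) ⊆ Y → J (f + e1 x) → J f)
    (h : RegOn K Z J d) : RegOn K Y J d := by
  intro b hb i hi
  by_cases hZ : (b.support : Set V) ⊆ Z
  · exact h b hZ i hi
  · obtain ⟨x, hx, hxZ⟩ := Set.not_subset.1 hZ
    refine Van.free (Finset.mem_coe.1 hx) fun σ hσ hA => ?_
    by_cases hxσ : x ∈ σ
    · rw [sub_ind_erase hxσ (by simpa using hx)]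
      intro h'
      exact hA (hf x (hb hx) hxZ _ ((Finset.coe_subset.2 supp_sub).trans hb) h')
    · rwa [Finset.erase_eq_of_notMem hxσ]

/-- quadratic monomial ideal of a relation -/
def quad (D : V → V → Prop) : (V →₀ ℕ) → Prop := fun f => ∃ u v, D u v ∧ e1 u + e1 v ≤ f

theorem quad_up (D : V → V → Prop) : Up (quad D) := by
  rintro f g hfg ⟨u, v, h1, h2⟩
  exact ⟨u, v, h1, h2.trans hfg⟩

theorem le_supp {u v : V} {f : V →₀ ℕ} (h : e1 u + e1 v ≤ f) : u ∈ f.support ∧ v ∈ f.support := by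
  have h1 := h u
  have h2 := h v
  simp only [Finsupp.add_apply, e1_apply, Finsupp.mem_support_iff] at *
  simp at h1 h2
  omega

theorem quad_congr {D D' : V → V → Prop} {f : V →₀ ℕ} {Y : Set V} (hf : (f.support : Set V) ⊆ Y)
    (h : ∀ u ∈ Y, ∀ v ∈ Y, (D u v ↔ D' u v)) : quad D f ↔ quad D' f := by
  constructor
  · rintro ⟨u, v, h1, h2⟩
    exact ⟨u, v, (h u (hf (le_supp h2).1) v (hf (le_supp h2).2)).1 h1, h2⟩
  · rintro ⟨u, v, h1, h2⟩
    exact ⟨u, v, (h u (hf (le_supp h2).1) v (hf (le_supp h2).2)).2 h1, h2⟩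

theorem RegOn.quad_congr {Y : Set V} {D D' : V → V → Prop} {d : ℤ} (h : RegOn K Y (quad D) d)
    (hD : ∀ u ∈ Y, ∀ v ∈ Y, (D u v ↔ D' u v)) : RegOn K Y (quad D') d :=
  h.congr fun _ hf => EIR.quad_congr hf hD

/-- vertex removal -/
theorem RegOn.removeVertex {Y : Set V} {D : V → V → Prop} (hD : ∀ u v, D u v → D v u) {d : ℤ} (x : V)
    (h1 : RegOn K (Y \ {x}) (quad D) d)
    (h2 : RegOn K (Y \ {u | D x u}) (quad D) (d - 1)) : RegOn K Y (quad D) d := by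
  refine RegOn.addMon (quad_up D) (e1 x) ?_ ?_
  · refine (RegOn.plusVar x h1).congr fun f _ => or_congr_right ?_
    constructor
    · intro h v
      rw [e1_apply]; split_ifs with hv
      · subst hv; omega
      · exact Nat.zero_le _
    · intro h
      have := h x
      simp at this; omega
  · have hd1 : (e1 x).degree = 1 := by simp
    rw [hd1]
    refine (RegOn.plusVars {u | D x u} h2).congr fun f _ => ?_
    constructor
    · rintro (⟨u, v, h, h'⟩ | ⟨z, hz, h⟩)
      · exact ⟨u, v, h, h'.trans (by simp)⟩
      · refine ⟨x, z, hz, ?_⟩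
        gcongr
        intro v
        rw [e1_apply]; split_ifs with hv
        · subst hv; omega
        · exact Nat.zero_le _
    · rintro ⟨u, v, h, h'⟩
      by_cases hu : x = u
      · right
        subst hu
        refine ⟨v, h, ?_⟩
        have : e1 v ≤ f := le_of_add_le_add_left h'
        have := this v
        simp at this; omega
      · by_cases hv : x = v
        · right
          subst hv
          refine ⟨u, hD _ _ h, ?_⟩
          rw [add_comm] at h'
          have : e1 u ≤ f := le_of_add_le_add_left h'
          have := this u
          simp at this; omega
        · left
          refine ⟨u, v, h, fun z => ?_⟩
          have := h' z
          simp only [Finsupp.add_apply, e1_apply] at *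
          by_cases hz : x = z
          · subst hz; simp [Ne.symm hu, Ne.symm hv]
          · simpa [hz] using this

theorem RegOn.nonneg {Y : Set V} {J : (V →₀ ℕ) → Prop} {d : ℤ} (h : RegOn K Y J d) (h0 : ¬ J 0) :
    0 ≤ d := by
  by_contra hd
  push Not at hd
  obtain ⟨w, hw⟩ := h 0 (by simp) 0 (by simpa using hd) (fun _ => 1) (by simp)
  have := hw ∅ (by simp) (by simpa using h0) (by simp)
  simp [dl] at this

theorem quad_zero (D : V → V → Prop) : ¬ quad D 0 := by
  rintro ⟨u, v, _, h⟩
  have := (le_supp h).1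
  simp at this

theorem RegOn.of_no_edges {Y : Set V} {D : V → V → Prop} {d : ℤ} (hd : 0 ≤ d)
    (h : ∀ u ∈ Y, ∀ v ∈ Y, ¬ D u v) : RegOn K Y (quad D) d := by
  have key : ∀ f : V →₀ ℕ, (f.support : Set V) ⊆ Y → ¬ quad D f := by
    rintro f hf ⟨u, v, h1, h2⟩
    exact h u (hf (le_supp h2).1) v (hf (le_supp h2).2) h1
  refine RegOn.free (Z := ∅) ?_ ?_
  · intro x hx _ f hf hJ
    exfalso
    refine key _ ?_ hJ
    intro v hv
    by_cases hvx : v = x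
    · rwa [hvx]
    · apply hf
      simpa [Ne.symm hvx, e1_apply] using hv
  · intro b hb i hi
    have : b = 0 := by
      rw [← Finsupp.support_eq_empty]; simpa using hb
    subst this
    simp at hi; omega

/-- removing an edge with its neighbourhood drops the regularity -/
theorem RegOn.unedge {Y W : Set V} {D : V → V → Prop} (hD : ∀ u v, D u v → D v u) {d : ℤ} {x y : V}
    (hxx : ¬ D x x) (hyy : ¬ D y y)
    (hxy : D x y) (hx : x ∈ Y) (hy : y ∈ Y) (hWY : W ⊆ Y)
    (hWx : ∀ w ∈ W, w ≠ x ∧ ¬ D x w) (hWy : ∀ w ∈ W, w ≠ y ∧ ¬ D y w)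
    (h : RegOn K Y (quad D) d) : RegOn K W (quad D) (d - 1) := by
  intro b hb i hi
  have hne : x ≠ y := by rintro rfl; exact hxx hxy
  have hxb : x ∉ b.support := fun hh => (hWx x (hb hh)).1 rfl
  have hyb : y ∉ b.support := fun hh => (hWy y (hb hh)).1 rfl
  have hxb0 : b x = 0 := by simpa using hxb
  have hyb0 : b y = 0 := by simpa using hyb
  have hS : (b + e1 x + e1 y).support = insert x (insert y b.support) := by
    ext v
    simp only [Finsupp.mem_support_iff, Finset.mem_insert, Finsupp.add_apply, e1_apply]
    by_cases h : x = v
    · simp [h]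
    · by_cases h' : y = v
      · simp [h']
      · simp [h, h', Ne.symm h, Ne.symm h']
  have h' := h (b + e1 x + e1 y) (by
    rw [hS]
    intro v hv
    simp only [Finset.coe_insert, Set.mem_insert_iff] at hv
    rcases hv with rfl | rfl | hv
    · exact hx
    · exact hy
    · exact hWY (hb hv)) (i + 1) (by simp [map_add]; omega)
  rw [hS] at h'
  refine Van.unedge hxb hyb hne (fun σ hσ => ?_) h'
  set ρ := (σ.erase x).erase y with hρ
  have hb' : ∀ v, v ≠ x → v ≠ y → (b + e1 x + e1 y - ind σ) v = (b - ind ρ) v := by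
    intro v h1 h2
    simp [ind_apply, hρ, h1, h2, Ne.symm h1, Ne.symm h2]
  have hbx : (b - ind ρ) x = 0 := by simp [hxb0]
  have hby : (b - ind ρ) y = 0 := by simp [hyb0]
  have hcx : (b + e1 x + e1 y - ind σ) x = if x ∈ σ then 0 else 1 := by
    simp [ind_apply, hxb0, Ne.symm hne]; split_ifs <;> rfl
  have hcy : (b + e1 x + e1 y - ind σ) y = if y ∈ σ then 0 else 1 := by
    simp [ind_apply, hyb0, hne]; split_ifs <;> rfl
  constructor
  · intro hA
    refine ⟨?_, ?_⟩
    · by_contra hcon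
      push Not at hcon
      apply hA
      refine ⟨x, y, hxy, fun v => ?_⟩
      simp only [Finsupp.add_apply, e1_apply]
      by_cases h1 : x = v
      · subst h1; rw [hcx]; simp [hcon.1, Ne.symm hne]
      · by_cases h2 : y = v
        · subst h2; rw [hcy]; simp [hcon.2, hne]
        · simp [h1, h2]
    · rintro ⟨u, v, h1, h2⟩
      apply hA
      refine ⟨u, v, h1, h2.trans fun z => ?_⟩
      by_cases hz : z = x
      · subst hz; rw [hbx]; exact Nat.zero_le _
      · by_cases hz' : z = y
        · subst hz'; rw [hby]; exact Nat.zero_le _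
        · rw [hb' z hz hz']
  · rintro ⟨hor, hA⟩ ⟨u, v, h1, h2⟩
    apply hA
    have hs := le_supp h2
    have hmem : ∀ w, w ∈ (b + e1 x + e1 y - ind σ).support → w = x ∨ w = y ∨ w ∈ W := by
      intro w hw
      have := supp_sub hw
      rw [hS] at this
      simp only [Finset.mem_insert] at this
      rcases this with h | h | h
      · exact Or.inl h
      · exact Or.inr (Or.inl h)
      · exact Or.inr (Or.inr (hb h))
    have hnot : ¬ (x ∈ (b + e1 x + e1 y - ind σ).support ∧ y ∈ (b + e1 x + e1 y - ind σ).support) := by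
      rw [Finsupp.mem_support_iff, Finsupp.mem_support_iff, hcx, hcy]
      rcases hor with h | h <;> simp [h]
    have huW : u ≠ x ∧ u ≠ y ∧ v ≠ x ∧ v ≠ y := by
      have key : ∀ u v, D u v → u ∈ (b + e1 x + e1 y - ind σ).support → 
          v ∈ (b + e1 x + e1 y - ind σ).support → u ≠ x ∧ u ≠ y := by
        intro u v h1 hu hv
        constructor
        · rintro rfl
          rcases hmem v hv with rfl | rfl | h
          · exact hxx h1
          · exact hnot ⟨hu, hv⟩
          · exact (hWx v h).2 h1
        · rintro rfl
          rcases hmem v hv with rfl | rfl | h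
          · exact hnot ⟨hv, hu⟩
          · exact hyy h1
          · exact (hWy v h).2 h1
      exact ⟨(key u v h1 hs.1 hs.2).1, (key u v h1 hs.1 hs.2).2,
        (key v u (hD _ _ h1) hs.2 hs.1).1, (key v u (hD _ _ h1) hs.2 hs.1).2⟩
    refine ⟨u, v, h1, fun z => ?_⟩
    by_cases hz : z = x
    · subst hz; simp [huW.1, huW.2.2.1]
    · by_cases hz' : z = y
      · subst hz'; simp [huW.2.1, huW.2.2.2]
      · rw [← hb' z hz hz']; exact h2 z

end Reg

end EIR


namespace EIR

section Conn

variable {V : Type} [LinearOrder V]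

/-- exponent of an edge -/
noncomputable def ed : Sym2 V → (V →₀ ℕ) := Sym2.lift ⟨fun u v => e1 u + e1 v, fun _ _ => add_comm _ _⟩

theorem ed_mk (u v : V) : ed s(u, v) = e1 u + e1 v := rfl

/-- exponent of a multiset of edges -/
noncomputable def dg (M : Multiset (Sym2 V)) : V →₀ ℕ := (M.map ed).sum

theorem dg_zero : dg (0 : Multiset (Sym2 V)) = 0 := rfl
theorem dg_cons (e : Sym2 V) (M : Multiset (Sym2 V)) : dg (e ::ₘ M) = ed e + dg M := by simp [dg]
theorem dg_add (M N : Multiset (Sym2 V)) : dg (M + N) = dg M + dg N := by simp [dg]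

theorem dg_degree (M : Multiset (Sym2 V)) : (dg M).degree = 2 * Multiset.card M := by
  induction M using Multiset.induction_on with
  | empty => simp [dg_zero]
  | cons e M ih =>
    rw [dg_cons, map_add, ih, Multiset.card_cons]
    induction e using Sym2.ind with
    | _ u v => rw [ed_mk, map_add]; simp; ring

/-- the edges of a relation -/
def IsE (A : V → V → Prop) (e : Sym2 V) : Prop := ∃ u v, A u v ∧ e = s(u, v)

theorem IsE.mk_iff {A : V → V → Prop} (hA : ∀ u v, A u v → A v u) {u v : V} : IsE A s(u, v) ↔ A u v := by
  constructor
  · rintro ⟨a, b, h, e⟩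
    rcases Sym2.eq_iff.1 e with ⟨rfl, rfl⟩ | ⟨rfl, rfl⟩
    · exact h
    · exact hA _ _ h
  · intro h; exact ⟨u, v, h, rfl⟩

/-- even connection -/
inductive EC (A : V → V → Prop) : Multiset (Sym2 V) → V → V → Prop
  | base {M u v} : A u v → EC A M u v
  | step {N M u p q v} : A u p → N = s(p, q) ::ₘ M → EC A M q v → EC A N u v

/-- alternating path ending with a token -/
inductive AP (A : V → V → Prop) : Multiset (Sym2 V) → V → V → Prop
  | base {N M z p y} : A z p → N = s(p, y) ::ₘ M → AP A N z y
  | step {N M z p q y} : A z p → N = s(p, q) ::ₘ M → AP A M q y → AP A N z y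

variable {A : V → V → Prop}

theorem cons_le {e : Sym2 V} {M N' : Multiset (Sym2 V)} (h : e ::ₘ M ≤ N') :
    ∃ M', N' = e ::ₘ M' ∧ M ≤ M' := by
  obtain ⟨R, rfl⟩ := Multiset.le_iff_exists_add.1 h
  exact ⟨M + R, by simp, by simp⟩

theorem EC.mono {A' : V → V → Prop} (hA : ∀ u v, A u v → A' u v) {M M' : Multiset (Sym2 V)} {u v : V} (h : EC A M u v) (hM : M ≤ M') : EC A' M' u v := by
  induction h generalizing M' with
  | base h => exact .base (hA _ _ h)
  | step h e _ ih =>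
    subst e
    obtain ⟨M'', rfl, hM''⟩ := cons_le hM
    exact .step (hA _ _ h) rfl (ih hM'')

theorem AP.mono {A' : V → V → Prop} (hA : ∀ u v, A u v → A' u v) {M M' : Multiset (Sym2 V)} {u v : V} (h : AP A M u v) (hM : M ≤ M') : AP A' M' u v := by
  induction h generalizing M' with
  | base h e =>
    subst e
    obtain ⟨M'', rfl, hM''⟩ := cons_le hM
    exact .base (hA _ _ h) rfl
  | step h e _ ih =>
    subst e
    obtain ⟨M'', rfl, hM''⟩ := cons_le hM
    exact .step (hA _ _ h) rfl (ih hM'')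

theorem EC.snoc {M : Multiset (Sym2 V)} {u q p v : V} (h : EC A M u q) (hp : A p v) :
    EC A (s(q, p) ::ₘ M) u v := by
  induction h with
  | base h => exact .step h rfl (.base hp)
  | step h e _ ih =>
    subst e
    exact .step h (Multiset.cons_swap _ _ _) ih

theorem EC.symm (hA : ∀ u v, A u v → A v u) {M : Multiset (Sym2 V)} {u v : V} (h : EC A M u v) :
    EC A M v u := by
  induction h with
  | base h => exact .base (hA _ _ h)
  | step h e _ ih =>
    subst e
    have := ih.snoc (hA _ _ h)
    rwa [Sym2.eq_swap] at this

theorem EC.ap {M : Multiset (Sym2 V)} {v q p : V} (h : EC A M v q) : AP A (s(q, p) ::ₘ M) v p := by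
  induction h with
  | base h => exact .base h rfl
  | step h e _ ih =>
    subst e
    exact .step h (Multiset.cons_swap _ _ _) ih

theorem EC.deg {M : Multiset (Sym2 V)} {u v : V} (h : EC A M u v) (hM : ∀ e ∈ M, IsE A e) :
    ∃ N : Multiset (Sym2 V), Multiset.card N = Multiset.card M + 1 ∧ (∀ e ∈ N, IsE A e) ∧
      dg N = dg M + e1 u + e1 v := by
  induction h with
  | @base M u v h =>
    refine ⟨s(u, v) ::ₘ M, by simp, ?_, ?_⟩
    · intro e he
      rcases Multiset.mem_cons.1 he with rfl | he
      · exact ⟨u, v, h, rfl⟩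
      · exact hM e he
    · rw [dg_cons, ed_mk]; abel
  | @step N M u p q v h e _ ih =>
    subst e
    obtain ⟨N', h1, h2, h3⟩ := ih (fun e he => hM e (by simp [he]))
    refine ⟨s(u, p) ::ₘ N', by simp [h1], ?_, ?_⟩
    · intro e he
      rcases Multiset.mem_cons.1 he with rfl | he
      · exact ⟨_, _, h, rfl⟩
      · exact h2 e he
    · rw [dg_cons, dg_cons, ed_mk, ed_mk, h3]; abel

theorem AP.deg {M : Multiset (Sym2 V)} {z y : V} (h : AP A M z y) (hM : ∀ e ∈ M, IsE A e) :
    ∃ N : Multiset (Sym2 V), Multiset.card N = Multiset.card M ∧ (∀ e ∈ N, IsE A e) ∧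
      dg N + e1 y = dg M + e1 z := by
  induction h with
  | @base N M z p y h e =>
    subst e
    refine ⟨s(z, p) ::ₘ M, by simp, ?_, ?_⟩
    · intro e he
      rcases Multiset.mem_cons.1 he with rfl | he
      · exact ⟨_, _, h, rfl⟩
      · exact hM e (by simp [he])
    · rw [dg_cons, dg_cons, ed_mk, ed_mk]; abel
  | @step N M z p q y h e _ ih =>
    subst e
    obtain ⟨N', h1, h2, h3⟩ := ih (fun e he => hM e (by simp [he]))
    refine ⟨s(z, p) ::ₘ N', by simp [h1], ?_, ?_⟩
    · intro e he
      rcases Multiset.mem_cons.1 he with rfl | he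
      · exact ⟨_, _, h, rfl⟩
      · exact h2 e he
    · rw [dg_cons, dg_cons, ed_mk, ed_mk, add_assoc, h3]; abel

theorem dg_pos {M : Multiset (Sym2 V)} {z : V} (h : dg M z ≠ 0) :
    ∃ p M', M = s(z, p) ::ₘ M' := by
  induction M using Multiset.induction_on with
  | empty => simp [dg_zero] at h
  | cons e M ih =>
    induction e using Sym2.ind with
    | _ u v =>
      by_cases hu : u = z
      · subst hu; exact ⟨v, M, rfl⟩
      · by_cases hv : v = z
        · subst hv; exact ⟨u, M, by rw [Sym2.eq_swap]⟩
        · rw [dg_cons, ed_mk] at h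
          simp [hu, hv] at h
          obtain ⟨p, M', rfl⟩ := ih h
          exact ⟨p, s(u, v) ::ₘ M', Multiset.cons_swap _ _ _⟩

theorem path_lemma (hA : ∀ u v, A u v → A v u) (hirr : ∀ u, ¬ A u u) (n : ℕ) :
    ∀ (M N : Multiset (Sym2 V)), Multiset.card N = n → (∀ e ∈ M, IsE A e) → (∀ e ∈ N, IsE A e) →
    ∀ z, dg M z < dg N z →
    (∃ v, EC A M z v ∧ dg M v + (if z = v then 1 else 0) < dg N v) ∨
    (∃ y P Q M' N', M = P + M' ∧ N = Q + N' ∧ AP A P z y ∧ dg Q + e1 y = dg P + e1 z ∧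
      dg N y < dg M y ∧ Multiset.card N' < n) := by
  induction n using Nat.strong_induction_on with
  | _ n ih =>
  intro M N hn hM hN z hz
  obtain ⟨p, N1, rfl⟩ := dg_pos (M := N) (z := z) (by omega)
  have hzp : A z p := (IsE.mk_iff hA).1 (hN _ (by simp))
  have hne : z ≠ p := by rintro rfl; exact hirr _ hzp
  by_cases hp : dg M p < dg (s(z, p) ::ₘ N1) p
  · left
    exact ⟨p, .base hzp, by simpa [hne] using hp⟩
  obtain ⟨q, M1, rfl⟩ := dg_pos (M := M) (z := p) (by
    rw [dg_cons, ed_mk] at hp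
    simp at hp; omega)
  have hpq : A p q := (IsE.mk_iff hA).1 (hM _ (by simp))
  have hpq' : p ≠ q := by rintro rfl; exact hirr _ hpq
  have eN : ∀ u, dg (s(z, p) ::ₘ N1) u = (if z = u then 1 else 0) + (if p = u then 1 else 0) + dg N1 u := by
    intro u; rw [dg_cons, ed_mk]; simp [e1_apply]
  have eM : ∀ u, dg (s(p, q) ::ₘ M1) u = (if p = u then 1 else 0) + (if q = u then 1 else 0) + dg M1 u := by
    intro u; rw [dg_cons, ed_mk]; simp [e1_apply]
  simp only [Multiset.card_cons] at hn
  by_cases hq : dg M1 q < dg N1 q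
  · rcases ih (Multiset.card N1) (by omega) M1 N1 rfl (fun e he => hM e (by simp [he]))
      (fun e he => hN e (by simp [he])) q hq with ⟨v, h1, h2⟩ | ⟨y, P, Q, M', N', h1, h2, h3, h4, h5, h6⟩
    · left
      refine ⟨v, .step hzp rfl h1, ?_⟩
      rw [eN, eM]
      omega
    · right
      refine ⟨y, s(p, q) ::ₘ P, s(z, p) ::ₘ Q, M', N', by rw [h1]; simp, by rw [h2]; simp,
        .step hzp rfl h3, ?_, ?_, by omega⟩
      · rw [dg_cons, dg_cons, ed_mk, ed_mk, add_assoc, h4]; abel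
      · rw [eN, eM] at hz ⊢
        by_cases hzy : z = y
        · subst hzy
          simp [hne.symm] at hz
          omega
        · simp [hzy]; omega
  · right
    refine ⟨q, {s(p, q)}, {s(z, p)}, M1, N1, by simp, by simp, .base (M := 0) hzp (by simp), ?_, ?_, by omega⟩
    · simp [dg, ed_mk]; abel
    · rw [eN, eM] at hz ⊢
      by_cases hzq : z = q
      · subst hzq; simp [hne.symm] at hz; omega
      · simp [hzq, hpq']; omega

theorem exchange (hA : ∀ u v, A u v → A v u) (hirr : ∀ u, ¬ A u u) (n : ℕ) :
    ∀ (M N : Multiset (Sym2 V)), Multiset.card N = n → (∀ e ∈ M, IsE A e) → (∀ e ∈ N, IsE A e) →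
    (∃ u v, EC A M u v ∧ e1 u + e1 v ≤ dg N - dg M) ∨
    (∃ L : Multiset (V × V), (∀ x ∈ L, AP A M x.1 x.2) ∧ (L.map (fun x => e1 x.1)).sum = dg N - dg M ∧
      (L.map (fun x => e1 x.2)).sum ≤ dg M - dg N) := by
  induction n using Nat.strong_induction_on with
  | _ n ih =>
  intro M N hn hM hN
  by_cases hz : ∃ z, dg M z < dg N z
  · obtain ⟨z, hz⟩ := hz
    rcases path_lemma hA hirr n M N hn hM hN z hz with ⟨v, h1, h2⟩ | ⟨y, P, Q, M', N', h1, h2, h3, h4, h5, h6⟩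
    · left
      refine ⟨z, v, h1, fun u => ?_⟩
      simp only [Finsupp.add_apply, Finsupp.tsub_apply, e1_apply]
      by_cases huv : v = u
      · subst huv; split_ifs at * <;> simp at * <;> omega
      · by_cases huz : z = u
        · subst huz; simp [huv]; omega
        · simp [huv, huz]
    · subst h1 h2
      have hzy : z ≠ y := by rintro rfl; omega
      have hpt : ∀ u, dg Q u + (if y = u then 1 else 0) = dg P u + (if z = u then 1 else 0) := by
        intro u
        have := DFunLike.congr_fun h4 u
        simpa only [Finsupp.add_apply, e1_apply] using this
      have e1' : dg (Q + N') - dg (P + M') = e1 z + (dg N' - dg M') := by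
        ext u
        have := hpt u
        rw [dg_add, dg_add] at *
        simp only [Finsupp.add_apply, Finsupp.tsub_apply, e1_apply] at *
        by_cases huz : z = u
        · subst huz; simp [hzy.symm] at *; omega
        · by_cases huy : y = u
          · subst huy; simp [huz] at *; omega
          · simp [huz, huy] at *; omega
      have e2' : dg (P + M') - dg (Q + N') = e1 y + (dg M' - dg N') := by
        ext u
        have := hpt u
        rw [dg_add, dg_add] at *
        simp only [Finsupp.add_apply, Finsupp.tsub_apply, e1_apply] at *
        by_cases huz : z = u
        · subst huz; simp [hzy.symm] at *; omega
        · by_cases huy : y = u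
          · subst huy; simp [huz] at *; omega
          · simp [huz, huy] at *; omega
      rcases ih _ h6 M' N' rfl (fun e he => hM e (by simp [he])) (fun e he => hN e (by simp [he])) with
        ⟨u, v, g1, g2⟩ | ⟨L, g1, g2, g3⟩
      · left
        refine ⟨u, v, g1.mono (fun _ _ h => h) (by simp), ?_⟩
        rw [e1']; exact g2.trans (by simp)
      · right
        refine ⟨(z, y) ::ₘ L, ?_, ?_, ?_⟩
        · intro x hx
          rcases Multiset.mem_cons.1 hx with rfl | hx
          · exact h3.mono (fun _ _ h => h) (by simp)
          · exact (g1 x hx).mono (fun _ _ h => h) (by simp)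
        · rw [e1', Multiset.map_cons, Multiset.sum_cons, g2]
        · rw [e2', Multiset.map_cons, Multiset.sum_cons]; gcongr
  · right
    push Not at hz
    refine ⟨0, by simp, ?_, by simp⟩
    symm
    rw [Multiset.map_zero, Multiset.sum_zero]
    exact tsub_eq_zero_of_le hz

/-- monomials of the `s`-th power -/
def Jp (A : V → V → Prop) (s : ℕ) : (V →₀ ℕ) → Prop := fun f =>
  ∃ N : Multiset (Sym2 V), Multiset.card N = s ∧ (∀ e ∈ N, IsE A e) ∧ dg N ≤ f

theorem Jp_up (s : ℕ) : Up (Jp A s) := by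
  rintro f g hfg ⟨N, h1, h2, h3⟩
  exact ⟨N, h1, h2, h3.trans hfg⟩

theorem Jp_one (f : V →₀ ℕ) : Jp A 1 f ↔ quad A f := by
  constructor
  · rintro ⟨N, h1, h2, h3⟩
    obtain ⟨e, rfl⟩ := Multiset.card_eq_one.1 h1
    obtain ⟨u, v, h, rfl⟩ := h2 e (by simp)
    exact ⟨u, v, h, by simpa [dg, ed_mk] using h3⟩
  · rintro ⟨u, v, h, h'⟩
    refine ⟨{s(u, v)}, by simp, ?_, by simpa [dg, ed_mk] using h'⟩
    intro e he
    rw [Multiset.mem_singleton] at he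
    exact ⟨u, v, h, he⟩

theorem Jp_succ {s : ℕ} {f : V →₀ ℕ} (h : Jp A (s + 1) f) : Jp A s f := by
  obtain ⟨N, h1, h2, h3⟩ := h
  obtain ⟨e, N', rfl⟩ := Multiset.card_pos_iff_exists_mem.1 (by omega : 0 < Multiset.card N) |>.imp
    fun e he => Multiset.exists_cons_of_mem he
  refine ⟨N', by simpa using h1, fun e he => h2 e (by simp [he]), le_trans ?_ h3⟩
  rw [dg_cons]; simp

/-- killed vertices -/
def Kset (A : V → V → Prop) (w : V → ℕ) (M : Multiset (Sym2 V)) : Set V :=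
  {z | ∃ y, AP A M z y ∧ w y < w z}

theorem dg_supp {M : Multiset (Sym2 V)} (hM : ∀ e ∈ M, IsE A e) {W : Set V} 
    (hW : ∀ u v, A u v → u ∈ W ∧ v ∈ W) : ((dg M).support : Set V) ⊆ W := by
  intro z hz
  obtain ⟨p, M', rfl⟩ := dg_pos (M := M) (z := z) (by simpa using hz)
  obtain ⟨u, v, h, e⟩ := hM s(z, p) (by simp)
  rcases Sym2.eq_iff.1 e with ⟨rfl, rfl⟩ | ⟨rfl, rfl⟩
  · exact (hW _ _ h).1
  · exact (hW _ _ h).2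

/-- weight of an exponent -/
noncomputable def om (w : V → ℕ) (f : V →₀ ℕ) : ℕ := f.sum fun v n => n * w v

theorem om_add (w : V → ℕ) (f g : V →₀ ℕ) : om w (f + g) = om w f + om w g := by
  unfold om
  exact Finsupp.sum_add_index' (by simp) (by intros; ring)

theorem om_e1 (w : V → ℕ) (v : V) : om w (e1 v) = w v := by
  simp [om]

theorem om_sum (w : V → ℕ) (L : Multiset (V × V)) (g : V × V → V) :
    om w (L.map (fun x => e1 (g x))).sum = (L.map (fun x => w (g x))).sum := by
  induction L using Multiset.induction_on with
  | empty => simp [om]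
  | cons a L ih => simp only [Multiset.map_cons, Multiset.sum_cons, om_add, om_e1, ih]

theorem degree_sum (L : Multiset (V × V)) (g : V × V → V) :
    ((L.map (fun x => e1 (g x))).sum : V →₀ ℕ).degree = Multiset.card L := by
  induction L using Multiset.induction_on with
  | empty => simp
  | cons a L ih => simp only [Multiset.map_cons, Multiset.sum_cons, map_add, ih]; simp; ring

theorem sum_apply_pos (L : Multiset (V × V)) (g : V × V → V) {x : V × V} (hx : x ∈ L) :
    ((L.map (fun x => e1 (g x))).sum : V →₀ ℕ) (g x) ≠ 0 := by
  obtain ⟨L', rfl⟩ := Multiset.exists_cons_of_mem hx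
  simp

theorem colon_sub (hA : ∀ u v, A u v → A v u) (hirr : ∀ u, ¬ A u u) (w : V → ℕ)
    {W : Set V} (hW : ∀ u v, A u v → u ∈ W ∧ v ∈ W) (hw : Set.InjOn w W)
    {M N : Multiset (Sym2 V)} (hM : ∀ e ∈ M, IsE A e) (hN : ∀ e ∈ N, IsE A e)
    (hMN : Multiset.card N = Multiset.card M + 1 ∨ 
      (Multiset.card N = Multiset.card M ∧ dg N ≠ dg M ∧ om w (dg M) ≤ om w (dg N)))
    {f : V →₀ ℕ} (hf : dg N ≤ dg M + f) : plusVars (quad (EC A M)) (Kset A w M) f := by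
  have hf' : dg N - dg M ≤ f := by
    rw [tsub_le_iff_left]; exact hf
  have hdec : dg N + (dg M - dg N) = dg M + (dg N - dg M) := by
    ext u; simp only [Finsupp.add_apply, Finsupp.tsub_apply]; omega
  rcases exchange hA hirr _ M N rfl hM hN with ⟨u, v, h1, h2⟩ | ⟨L, h1, h2, h3⟩
  · left
    exact ⟨u, v, h1, h2.trans hf'⟩
  · right
    have hd := congrArg Finsupp.degree hdec
    rw [map_add, map_add, dg_degree, dg_degree, ← h2, degree_sum] at hd
    have hc : Multiset.card L ≤ (dg M - dg N).degree := by
      rw [← degree_sum L Prod.snd]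
      obtain ⟨g, hg⟩ := le_iff_exists_add.1 h3
      rw [hg, map_add]; omega
    rcases hMN with h | ⟨hcard, hne, hom⟩
    · omega
    · have h3' : (L.map (fun x => e1 x.2)).sum = dg M - dg N := by
        obtain ⟨g, hg⟩ := le_iff_exists_add.1 h3
        have : g.degree = 0 := by
          have h4 := congrArg Finsupp.degree hg
          rw [map_add, degree_sum L Prod.snd] at h4
          omega
        rw [Finsupp.degree_eq_zero_iff] at this
        rw [hg, this, add_zero]
      by_contra hcon
      push Not at hcon
      have hle : ∀ x ∈ L, w x.1 ≤ w x.2 := by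
        intro x hx
        by_contra hlt
        push Not at hlt
        have := hcon
        have h5 : f x.1 ≠ 0 := by
          have := hf' x.1
          rw [← h2] at this
          have h6 := sum_apply_pos L Prod.fst hx
          omega
        exact h5 (this x.1 ⟨x.2, h1 x hx, hlt⟩)
      have ho := congrArg (om w) hdec
      rw [om_add, om_add, ← h2, ← h3', om_sum w L Prod.fst, om_sum w L Prod.snd] at ho
      have hlt : L = 0 := by
        by_contra hL
        obtain ⟨x, hx⟩ := Multiset.exists_mem_of_ne_zero hL
        have hstrict : ∃ x ∈ L, w x.1 < w x.2 := by
          refine ⟨x, hx, lt_of_le_of_ne (hle x hx) fun he => ?_⟩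
          have a1 : (dg N - dg M) x.1 ≠ 0 := by rw [← h2]; exact sum_apply_pos L Prod.fst hx
          have a2 : (dg M - dg N) x.2 ≠ 0 := by rw [← h3']; exact sum_apply_pos L Prod.snd hx
          have m1 : x.1 ∈ W := dg_supp hN hW (supp_sub (Finsupp.mem_support_iff.2 a1))
          have m2 : x.2 ∈ W := dg_supp hM hW (supp_sub (Finsupp.mem_support_iff.2 a2))
          have := hw m1 m2 he
          rw [← this] at a2
          simp only [Finsupp.tsub_apply] at a1 a2
          omega
        have := Multiset.sum_lt_sum (s := L) (f := fun x => w x.1) (g := fun x => w x.2) hle hstrict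
        omega
      subst hlt
      simp only [Multiset.map_zero, Multiset.sum_zero] at h2 h3'
      rw [← h2, ← h3'] at hdec
      exact hne (by simpa using hdec)

variable {K : Type} [Field K]

theorem banerjee_step (hA : ∀ u v, A u v → A v u) (hirr : ∀ u, ¬ A u u) (w : V → ℕ)
    (W : Finset V) (hW : ∀ u v, A u v → u ∈ W ∧ v ∈ W) (hw : Set.InjOn w (W : Set V))
    (s : ℕ) (d : ℤ)
    (hs : RegOn K (W : Set V) (Jp A s) (2 * s + d))
    (hM : ∀ M : Multiset (Sym2 V), (∀ e ∈ M, IsE A e) →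
      RegOn K ((W : Set V) \ Kset A w M) (quad (EC A M)) d) :
    RegOn K (W : Set V) (Jp A (s + 1)) (2 * s + d) := by
  classical
  set Gens : Finset (V →₀ ℕ) := (W.finsuppAntidiag (2 * s)).filter
    (fun m => ∃ M : Multiset (Sym2 V), Multiset.card M = s ∧ (∀ e ∈ M, IsE A e) ∧ dg M = m) with hGens
  have memGens : ∀ M : Multiset (Sym2 V), Multiset.card M = s → (∀ e ∈ M, IsE A e) → dg M ∈ Gens := by
    intro M h1 h2
    have hsup : (dg M).support ⊆ W := Finset.coe_subset.1 (dg_supp h2 hW)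
    rw [hGens, Finset.mem_filter, Finset.mem_finsuppAntidiag]
    refine ⟨⟨?_, hsup⟩, M, h1, h2, rfl⟩
    rw [← h1, ← dg_degree, Finsupp.degree_apply]
    symm
    exact Finset.sum_subset hsup (by intro x _ hx; simpa using hx)
  have main : ∀ n (T : Finset (V →₀ ℕ)), T ⊆ Gens → (Gens \ T).card = n →
      (∀ a ∈ T, ∀ m ∈ Gens \ T, om w m ≤ om w a) → 
      RegOn K (W : Set V) (fun f => Jp A (s + 1) f ∨ ∃ m ∈ T, m ≤ f) (2 * s + d) := by
    intro n
    induction n with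
    | zero =>
      intro T hT hn _
      have hTG : T = Gens := by
        apply Finset.Subset.antisymm hT
        rw [Finset.card_eq_zero] at hn
        exact Finset.sdiff_eq_empty_iff_subset.1 hn
      subst hTG
      refine hs.congr fun f _ => ?_
      constructor
      · rintro ⟨N, h1, h2, h3⟩
        exact Or.inr ⟨dg N, memGens N h1 h2, h3⟩
      · rintro (h | ⟨m, hm, h⟩)
        · exact Jp_succ h
        · obtain ⟨_, M, h1, h2, rfl⟩ := Finset.mem_filter.1 hm
          exact ⟨M, h1, h2, h⟩
    | succ n ih =>
      intro T hT hn hord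
      obtain ⟨m, hm, hmax⟩ := Finset.exists_max_image (Gens \ T) (om w) (by
        rw [← Finset.card_pos]; omega)
      have hm' := Finset.mem_sdiff.1 hm
      obtain ⟨_, M, h1, h2, rfl⟩ := Finset.mem_filter.1 hm'.1
      refine RegOn.addMon ?_ (dg M) ?_ ?_
      · rintro f g hfg (h | ⟨a, ha, h⟩)
        · exact Or.inl (Jp_up _ f g hfg h)
        · exact Or.inr ⟨a, ha, h.trans hfg⟩
      · refine (ih (insert (dg M) T) (Finset.insert_subset hm'.1 hT) ?_ ?_).congr fun f _ => ?_
        · rw [Finset.sdiff_insert, Finset.card_erase_of_mem hm, hn]; rfl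
        · intro a ha b hb
          rw [Finset.mem_sdiff, Finset.mem_insert] at hb
          rcases Finset.mem_insert.1 ha with rfl | ha
          · exact hmax b (Finset.mem_sdiff.2 ⟨hb.1, fun h => hb.2 (Or.inr h)⟩)
          · exact hord a ha b (Finset.mem_sdiff.2 ⟨hb.1, fun h => hb.2 (Or.inr h)⟩)
        · simp only [Finset.mem_insert, exists_eq_or_imp]
          rw [or_assoc]; exact or_congr_right or_comm
      · rw [dg_degree, h1]
        have : (2 * (s : ℤ) + d - ((2 * s : ℕ) : ℤ)) = d := by push_cast; ring
        rw [this]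
        refine (RegOn.plusVars _ (hM M h2)).congr fun f _ => ?_
        constructor
        · rintro (⟨u, v, g1, g2⟩ | ⟨z, ⟨y, g1, g2⟩, g3⟩)
          · left
            obtain ⟨N, n1, n2, n3⟩ := g1.deg h2
            refine ⟨N, by omega, n2, ?_⟩
            rw [n3, add_assoc]; gcongr
          · obtain ⟨N, n1, n2, n3⟩ := g1.deg h2
            have hle : dg N ≤ dg M + f := by
              have : dg N ≤ dg M + e1 z := by rw [← n3]; simp
              refine this.trans ?_
              gcongr
              intro v
              rw [e1_apply]; split_ifs with hv
              · subst hv; omega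
              · exact Nat.zero_le _
            right
            refine ⟨dg N, ?_, hle⟩
            have hmem := memGens N (by omega) n2
            by_contra hT'
            have h5 := hmax _ (Finset.mem_sdiff.2 ⟨hmem, hT'⟩)
            have h6 := congrArg (om w) n3
            rw [om_add, om_add, om_e1, om_e1] at h6
            omega
        · rintro (⟨N, n1, n2, n3⟩ | ⟨a, ha, n3⟩)
          · exact colon_sub hA hirr w hW hw h2 n2 (Or.inl (by omega)) n3
          · obtain ⟨_, N, g1, g2, rfl⟩ := Finset.mem_filter.1 (hT ha)
            refine colon_sub hA hirr w hW hw h2 g2 (Or.inr ⟨by omega, ?_, hord _ ha _ hm⟩) n3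
            intro e
            rw [e] at ha
            exact hm'.2 ha
  refine (main _ ∅ (by simp) rfl (by simp)).congr fun f _ => ?_
  simp

theorem powers_bound (hA : ∀ u v, A u v → A v u) (hirr : ∀ u, ¬ A u u) (w : V → ℕ)
    (W : Finset V) (hW : ∀ u v, A u v → u ∈ W ∧ v ∈ W) (hw : Set.InjOn w (W : Set V)) (d : ℤ)
    (h1 : RegOn K (W : Set V) (quad A) d)
    (hM : ∀ M : Multiset (Sym2 V), (∀ e ∈ M, IsE A e) →
      RegOn K ((W : Set V) \ Kset A w M) (quad (EC A M)) d) (r : ℕ) :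
    RegOn K (W : Set V) (Jp A (r + 1)) (2 * r + d) := by
  induction r with
  | zero =>
    simp only [Nat.cast_zero, mul_zero, zero_add]
    exact h1.congr fun f _ => (Jp_one f).symm
  | succ r ih =>
    refine banerjee_step hA hirr w W hW hw (r + 1) d (ih.mono (le_refl _) (by push_cast; omega)) hM

end Conn

end EIR


namespace EIR

section Psi

variable {V : Type} [LinearOrder V]

/-- restricted relation -/
def AF (A : V → V → Prop) (F : Set V) (u v : V) : Prop := A u v ∧ u ∈ F ∧ v ∈ F

open Classical in
/-- restriction of a multiset of edges -/
noncomputable def rs (F : Set V) (M : Multiset (Sym2 V)) : Multiset (Sym2 V) :=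
  M.filter (fun e => ∀ z ∈ e, z ∈ F)

theorem rs_le (F : Set V) (M : Multiset (Sym2 V)) : rs F M ≤ M := by
  classical
  exact Multiset.filter_le _ _

theorem rs_mono (F : Set V) {M N : Multiset (Sym2 V)} (h : M ≤ N) : rs F M ≤ rs F N := by
  classical
  exact Multiset.filter_le_filter _ h

theorem rs_cons {F : Set V} {p q : V} (hp : p ∈ F) (hq : q ∈ F) (M : Multiset (Sym2 V)) :
    rs F (s(p, q) ::ₘ M) = s(p, q) ::ₘ rs F M := by
  classical
  unfold rs
  rw [Multiset.filter_cons_of_pos]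
  intro z hz
  rcases Sym2.mem_iff.1 hz with rfl | rfl <;> assumption

variable {A : V → V → Prop}

theorem rs_edges {F F' : Set V} (hF : F' ⊆ F) {M : Multiset (Sym2 V)} (hM : ∀ e ∈ M, IsE (AF A F) e) :
    ∀ e ∈ rs F' M, IsE (AF A F') e := by
  classical
  intro e he
  unfold rs at he
  rw [Multiset.mem_filter] at he
  obtain ⟨u, v, h, rfl⟩ := hM e he.1
  exact ⟨u, v, ⟨h.1, he.2 u (by simp), he.2 v (by simp)⟩, rfl⟩

theorem AF_mono {F F' : Set V} (hF : F' ⊆ F) : ∀ u v, AF A F' u v → AF A F u v :=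
  fun _ _ h => ⟨h.1, hF h.2.1, hF h.2.2⟩

theorem AF_symm (hA : ∀ u v, A u v → A v u) (F : Set V) : ∀ u v, AF A F u v → AF A F v u :=
  fun _ _ h => ⟨hA _ _ h.1, h.2.2, h.2.1⟩

theorem Kset_mono {F F' : Set V} (hF : F' ⊆ F) (w : V → ℕ) (M : Multiset (Sym2 V)) :
    Kset (AF A F') w (rs F' M) ⊆ Kset (AF A F) w M := by
  rintro z ⟨y, h1, h2⟩
  exact ⟨y, h1.mono (AF_mono hF) (rs_le _ _), h2⟩

theorem EC_rs_mono {F F' : Set V} (hF : F' ⊆ F) {M : Multiset (Sym2 V)} {u v : V}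
    (h : EC (AF A F') (rs F' M) u v) : EC (AF A F) M u v := h.mono (AF_mono hF) (rs_le _ _)

/-- closed neighbourhood complement -/
def cn (A : V → V → Prop) (F : Set V) (a : V) : Set V := {u | u ∈ F ∧ u ≠ a ∧ ¬ A a u}

theorem cn_sub (F : Set V) (a : V) : cn A F a ⊆ F := fun _ h => h.1

theorem lemmaA (hA : ∀ u v, A u v → A v u) {F : Set V} {a : V} (ha : a ∈ F)
    {N : Multiset (Sym2 V)} {u v : V} (h : EC (AF A F) N u v) (hua : u ≠ a) (hva : v ≠ a)
    (hu : ¬ EC (AF A F) N a u) (hv : ¬ EC (AF A F) N a v) :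
    EC (AF A (cn A F a)) (rs (cn A F a) N) u v := by
  induction h with
  | base h =>
    exact .base ⟨h.1, ⟨h.2.1, hua, fun h' => hu (.base ⟨h', ha, h.2.1⟩)⟩,
      ⟨h.2.2, hva, fun h' => hv (.base ⟨h', ha, h.2.2⟩)⟩⟩
  | @step N M u p q v h e hq ih =>
    subst e
    have hs := AF_symm hA F
    have hqa : ¬ EC (AF A F) M a q := fun h' => hu (h'.snoc (hs _ _ h) |> fun t => by rwa [Sym2.eq_swap] at t)
    have hqne : q ≠ a := by
      rintro rfl
      exact hv (hq.mono (fun _ _ h => h) (Multiset.le_cons_self _ _))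
    have hpne : p ≠ a := by
      rintro rfl
      exact hu (.base (hs _ _ h))
    have hap : ¬ A a p := fun h' => hv (.step ⟨h', ha, h.2.2⟩ rfl hq)
    have hqF : q ∈ F := by
      cases hq with
      | base h => exact h.2.1
      | step h _ _ => exact h.2.1
    have haq : ¬ A a q := fun h' => hqa (.base ⟨h', ha, hqF⟩)
    have hp' : p ∈ cn A F a := ⟨h.2.2, hpne, hap⟩
    have hq' : q ∈ cn A F a := ⟨hqF, hqne, haq⟩
    have hu' : u ∈ cn A F a := ⟨h.2.1, hua, fun h' => hu (.base ⟨h', ha, h.2.1⟩)⟩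
    refine .step ⟨h.1, hu', hp'⟩ (rs_cons hp' hq' M) (ih hqne hva hqa ?_)
    exact fun h' => hv (h'.mono (fun _ _ h => h) (Multiset.le_cons_self _ _))

variable {K : Type} [Field K]

theorem RegOn.isolated {Y : Set V} {D : V → V → Prop} (hD : ∀ u v, D u v → D v u) {d : ℤ} (x : V)
    (hx : x ∈ Y → ∀ u ∈ Y, ¬ D x u) (h : RegOn K (Y \ {x}) (quad D) d) : RegOn K Y (quad D) d := by
  refine RegOn.free (Z := Y \ {x}) ?_ h
  intro y hy hyZ f hf hJ
  have : y = x := by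
    by_contra hne
    exact hyZ ⟨hy, hne⟩
  subst this
  obtain ⟨u, v, h1, h2⟩ := hJ
  have hsup : ∀ z, z ∈ (f + e1 y).support → z ∈ Y := by
    intro z hz
    by_cases hzy : z = y
    · rwa [hzy]
    · apply hf; simpa [Ne.symm hzy, e1_apply] using hz
  have hu := hsup u (le_supp h2).1
  have hv := hsup v (le_supp h2).2
  have huy : u ≠ y := by rintro rfl; exact hx hy v hv h1
  have hvy : v ≠ y := by rintro rfl; exact hx hy u hu (hD _ _ h1)
  refine ⟨u, v, h1, fun z => ?_⟩
  have := h2 z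
  by_cases hz : y = z
  · subst hz; simp [huy, hvy]
  · simpa [hz, e1_apply] using this

theorem RegOn.removeMany {D : V → V → Prop} (hD : ∀ u v, D u v → D v u) {d : ℤ} (S : Finset V) :
    ∀ (Y : Set V), (∀ x ∈ S, x ∈ Y → ∀ Y' ⊆ Y, RegOn K (Y' \ {u | D x u}) (quad D) (d - 1)) →
    RegOn K (Y \ (S : Set V)) (quad D) d → RegOn K Y (quad D) d := by
  induction S using Finset.induction_on with
  | empty => intro Y _ h; exact h.mono (by simp) le_rfl
  | insert a S ha ih =>
    intro Y hS h
    have key : RegOn K (Y \ {a}) (quad D) d := by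
      refine ih (Y \ {a}) (fun x hx hxY Y' hY' => hS x (by simp [hx]) hxY.1 Y' (hY'.trans Set.diff_subset)) ?_
      refine h.mono ?_ le_rfl
      intro v hv
      simp only [Finset.coe_insert, Set.mem_diff, Set.mem_insert_iff, Set.mem_singleton_iff] at *
      tauto
    by_cases haY : a ∈ Y
    · exact RegOn.removeVertex hD a key (hS a (by simp) haY Y (le_refl _))
    · exact key.mono (by intro v hv; exact ⟨hv, by rintro rfl; exact haY hv⟩) le_rfl

/-- twin vertices in the set X -/
def Tw (A : V → V → Prop) (X F : Set V) : Prop :=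
  ∀ x ∈ F, x ∈ X → ∃ x' ∈ F, A x x' ∧ ∀ u, u ≠ x → u ≠ x' → (A x u ↔ A x' u)

theorem Tw.cn (hA : ∀ u v, A u v → A v u) {X F : Set V} (h : Tw A X F) (a : V) : Tw A X (cn A F a) := by
  intro x hx hxX
  obtain ⟨x', h1, h2, h3⟩ := h x hx.1 hxX
  refine ⟨x', ⟨h1, ?_, ?_⟩, h2, h3⟩
  · rintro rfl
    exact hx.2.2 (hA _ _ h2)
  · intro h'
    by_cases hax : a = x'
    · subst hax; exact hx.2.2 (hA _ _ h2)
    · exact hx.2.2 (hA _ _ ((h3 a (Ne.symm hx.2.1) hax).2 (hA _ _ h')))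

variable (K) in
/-- the conclusion of the main induction, for one set `F` -/
def Psi (A : V → V → Prop) (w : V → ℕ) (F : Set V) : Prop :=
  ∀ d : ℤ, RegOn K F (quad A) d → ∀ M : Multiset (Sym2 V), (∀ e ∈ M, IsE (AF A F) e) →
    RegOn K (F \ Kset (AF A F) w M) (quad (EC (AF A F) M)) d

theorem rem (hA : ∀ u v, A u v → A v u) {w : V → ℕ} {F : Set V} {a : V} (ha : a ∈ F) {d : ℤ}
    (hreg : RegOn K (cn A F a) (quad A) (d - 1)) (hpsi : Psi K A w (cn A F a))
    {M : Multiset (Sym2 V)} (hM : ∀ e ∈ M, IsE (AF A F) e) {Y : Set V}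
    (hY : Y ⊆ F \ Kset (AF A F) w M) :
    RegOn K (Y \ {u | EC (AF A F) M a u}) (quad (EC (AF A F) M)) (d - 1) := by
  have hs : ∀ u v, EC (AF A F) M u v → EC (AF A F) M v u := fun u v h => h.symm (AF_symm hA F)
  refine RegOn.isolated hs a (fun haY u hu h => hu.2 h) ?_
  have := hpsi _ hreg (rs (cn A F a) M) (rs_edges (cn_sub F a) hM)
  refine (this.mono (Y' := (Y \ {u | EC (AF A F) M a u}) \ {a}) ?_ le_rfl).quad_congr ?_
  · rintro u ⟨⟨h1, h2⟩, h3⟩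
    refine ⟨⟨(hY h1).1, h3, fun h => h2 (.base ⟨h, ha, (hY h1).1⟩)⟩, fun h => (hY h1).2 (Kset_mono (cn_sub F a) w M h)⟩
  · rintro u ⟨⟨h1, h2⟩, h3⟩ v ⟨⟨g1, g2⟩, g3⟩
    constructor
    · exact EC_rs_mono (cn_sub F a)
    · intro h
      exact lemmaA hA ha h h3 g3 h2 g2

theorem lemmaX (hA : ∀ u v, A u v → A v u) {F X : Set V} {N : Multiset (Sym2 V)} {u v : V}
    (h : EC (AF A F) N u v) (huX : u ∉ X) (hvX : v ∉ X)
    (hu : ∀ y ∈ X, ¬ AP (AF A F) N u y) (hv : ∀ y ∈ X, ¬ AP (AF A F) N v y) :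
    EC (AF A (F \ X)) (rs (F \ X) N) u v := by
  induction h with
  | base h => exact .base ⟨h.1, ⟨h.2.1, huX⟩, ⟨h.2.2, hvX⟩⟩
  | @step N M u p q v h e hq ih =>
    subst e
    have hqX : q ∉ X := fun h' => hu q h' (.base h rfl)
    have hpX : p ∉ X := fun h' => hv p h' (by
      have := (hq.symm (AF_symm hA F)).ap (p := p)
      rwa [Sym2.eq_swap] at this)
    have hqF : q ∈ F := by
      cases hq with
      | base h => exact h.2.1
      | step h _ _ => exact h.2.1
    have hp' : p ∈ F \ X := ⟨h.2.2, hpX⟩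
    have hq' : q ∈ F \ X := ⟨hqF, hqX⟩
    refine .step ⟨h.1, ⟨h.2.1, huX⟩, hp'⟩ (rs_cons hp' hq' M) (ih hqX hvX ?_ ?_)
    · intro y hy h'
      exact hu y hy (.step h rfl h')
    · intro y hy h'
      exact hv y hy (h'.mono (fun _ _ h => h) (Multiset.le_cons_self _ _))

theorem caseT (hA : ∀ u v, A u v → A v u) (hirr : ∀ u, ¬ A u u) {w : V → ℕ} {F X : Set V} (hfin : F.Finite)
    (hw : ∀ x ∈ F, x ∈ X → ∀ z ∈ F, z ∉ X → w x < w z) (htw : Tw A X F)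
    (hpsi1 : ∀ a ∈ F, Psi K A w (cn A F a)) (hpsi2 : Psi K A w (F \ X)) : Psi K A w F := by
  classical
  intro d hd M hM
  have hs : ∀ u v, EC (AF A F) M u v → EC (AF A F) M v u := fun u v h => h.symm (AF_symm hA F)
  refine RegOn.removeMany hs (hfin.toFinset.filter (· ∈ X)) _ ?_ ?_
  · intro x hx hxY Y' hY'
    have hx' := Finset.mem_filter.1 hx
    have hxF : x ∈ F := by simpa using hx'.1
    refine rem hA hxF ?_ (hpsi1 x hxF) hM hY'
    obtain ⟨x', h1, h2, h3⟩ := htw x hxF hx'.2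
    refine RegOn.unedge hA (hirr x) (hirr x') h2 hxF h1 (cn_sub F x) ?_ ?_ hd
    · intro u hu; exact hu.2
    · intro u hu
      have hne : u ≠ x' := by rintro rfl; exact hu.2.2 h2
      exact ⟨hne, fun h => hu.2.2 ((h3 u hu.2.1 hne).2 h)⟩
  · have := hpsi2 d (hd.mono Set.diff_subset le_rfl) (rs (F \ X) M) (rs_edges Set.diff_subset hM)
    have hsub : (F \ Kset (AF A F) w M) \ ((hfin.toFinset.filter (· ∈ X) : Finset V) : Set V) ⊆ 
        (F \ Kset (AF A F) w M) \ X := by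
      rintro u ⟨h1, h2⟩
      refine ⟨h1, fun h => h2 ?_⟩
      simp [h1.1, h]
    refine RegOn.mono ?_ hsub le_rfl
    refine (this.mono (Y' := (F \ Kset (AF A F) w M) \ X) ?_ le_rfl).quad_congr ?_
    · rintro u ⟨h1, h2⟩
      exact ⟨⟨h1.1, h2⟩, fun h => h1.2 (Kset_mono Set.diff_subset w M h)⟩
    · have apF : ∀ (N : Multiset (Sym2 V)) u y, AP (AF A F) N u y → (∀ e ∈ N, IsE (AF A F) e) → y ∈ F := by
        intro N u y h
        induction h with
        | @base N M z p y h e =>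
          intro hN; subst e
          exact ((IsE.mk_iff (u := p) (v := y) (AF_symm hA F)).1 (hN s(p, y) (by simp))).2.2
        | step h e _ ih =>
          intro hN; subst e
          exact ih fun e he => hN e (by simp [he])
      have key : ∀ u, u ∈ (F \ Kset (AF A F) w M) \ X → ∀ y ∈ X, ¬ AP (AF A F) M u y := by
        intro u hu y hy h
        exact hu.1.2 ⟨y, h, hw y (apF M u y h hM) hy u hu.1.1 hu.2⟩
      intro u hu v hv
      exact ⟨EC_rs_mono Set.diff_subset, fun h => lemmaX hA h hu.2 hv.2 (key u hu) (key v hv)⟩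

theorem caseC (hA : ∀ u v, A u v → A v u) {w : V → ℕ} {F : Set V} (hfin : F.Finite)
    (hgood : ∀ d : ℤ, RegOn K F (quad A) d → ∀ a ∈ F, (∃ u ∈ F, A a u) → RegOn K (cn A F a) (quad A) (d - 1))
    (hpsi1 : ∀ a ∈ F, Psi K A w (cn A F a)) : Psi K A w F := by
  classical
  intro d hd M hM
  have hs : ∀ u v, EC (AF A F) M u v → EC (AF A F) M v u := fun u v h => h.symm (AF_symm hA F)
  refine RegOn.removeMany hs (hfin.toFinset.filter (fun a => ∃ u ∈ F, A a u)) _ ?_ ?_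
  · intro x hx hxY Y' hY'
    have hx' := Finset.mem_filter.1 hx
    have hxF : x ∈ F := by simpa using hx'.1
    exact rem hA hxF (hgood d hd x hxF hx'.2) (hpsi1 x hxF) hM hY'
  · refine RegOn.of_no_edges (hd.nonneg (quad_zero A)) ?_
    rintro u ⟨hu, hu2⟩ v hv h
    apply hu2
    have : ∃ p ∈ F, A u p := by
      cases h with
      | base h => exact ⟨_, h.2.2, h.1⟩
      | step h _ _ => exact ⟨_, h.2.2, h.1⟩
    simpa [hu.1] using this

theorem lemmaL (hA : ∀ u v, A u v → A v u) {F : Set V} {x g : V}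
    (hx : ∀ u ∈ F, A x u → u = g) (n : ℕ) : ∀ {N : Multiset (Sym2 V)} {u v : V}, 
    Multiset.card N = n → (∀ e ∈ N, IsE (AF A F) e) →
    EC (AF A F) N u v → u ≠ x → v ≠ x → EC (AF A (F \ {x})) (rs (F \ {x}) N) u v := by
  induction n using Nat.strong_induction_on with
  | _ n ih =>
  intro N u v hn hN h hux hvx
  cases h with
  | base h => exact .base ⟨h.1, ⟨h.2.1, hux⟩, ⟨h.2.2, hvx⟩⟩
  | @step N M u p q v h e hq =>
    subst e
    have hpq : AF A F p q := (IsE.mk_iff (AF_symm hA F)).1 (hN _ (by simp))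
    have hM : ∀ e ∈ M, IsE (AF A F) e := fun e he => hN e (by simp [he])
    simp only [Multiset.card_cons] at hn
    have mono : ∀ {u v}, EC (AF A (F \ {x})) (rs (F \ {x}) M) u v →
        EC (AF A (F \ {x})) (rs (F \ {x}) (s(p, q) ::ₘ M)) u v := fun h =>
      h.mono (fun _ _ h => h) (rs_mono _ (Multiset.le_cons_self _ _))
    by_cases hpx : p = x
    · subst hpx
      have h1 : u = g := hx u h.2.1 (hA _ _ h.1)
      have h2 : q = g := hx q hpq.2.2 hpq.1
      subst h1 h2
      exact mono (ih _ (by omega) rfl hM hq hux hvx)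
    · by_cases hqx : q = x
      · subst hqx
        have h1 : p = g := hx p hpq.2.1 (hA _ _ hpq.1)
        subst h1
        cases hq with
        | base h' =>
          have h2 := hx _ h'.2.2 h'.1
          subst h2
          exact .base ⟨h.1, ⟨h.2.1, hux⟩, ⟨h.2.2, hpx⟩⟩
        | @step _ M2 _ p2 q2 _ h' e2 hq2 =>
          have h2 := hx _ h'.2.2 h'.1
          subst h2
          exact mono (ih _ (by omega) rfl hM (.step h e2 hq2) hux hvx)
      · have hp' : p ∈ F \ {x} := ⟨h.2.2, hpx⟩
        have hq' : q ∈ F \ {x} := ⟨hpq.2.2, hqx⟩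
        refine .step ⟨h.1, ⟨h.2.1, hux⟩, hp'⟩ (rs_cons hp' hq' M) ?_
        exact ih _ (by omega) rfl hM hq hqx hvx

theorem EC_leaf {F : Set V} {x g : V}
    (hx : ∀ u ∈ F, A x u → u = g) {N : Multiset (Sym2 V)} {y u : V} (h : EC (AF A F) N y u) (hy : y = x)
    (hN : ∀ c M1, N = s(g, c) ::ₘ M1 → c = x) : u = g := by
  induction h with
  | base h => subst hy; exact hx _ h.2.2 h.1
  | @step N M u p q v h e hq ih =>
    subst hy e
    have := hx _ h.2.2 h.1
    subst this
    have := hN q M rfl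
    subst this
    refine ih rfl ?_
    intro c M1 e
    subst e
    exact hN c (s(p, q) ::ₘ M1) (Multiset.cons_swap _ _ _)

theorem caseL (hA : ∀ u v, A u v → A v u) (hirr : ∀ u, ¬ A u u) {w : V → ℕ} {F : Set V}
    {x g : V} (hxF : x ∈ F) (hgF : g ∈ F) (hxg : A x g) (hx : ∀ u ∈ F, A x u → u = g)
    (hc : ∀ c ∈ F, A g c → c ≠ x → (w c < w x ∨ ∀ u ∈ F, A g u → u = x ∨ u = c))
    (hpsi1 : ∀ a ∈ F, Psi K A w (cn A F a)) (hpsi2 : Psi K A w (F \ {x}))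
    (hpsi3 : ∀ a ∈ F, ∀ b ∈ F, Psi K A w (cn A (cn A F a) b)) : Psi K A w F := by
  intro d hd M hM
  have hs : ∀ u v, EC (AF A F) M u v → EC (AF A F) M v u := fun u v h => h.symm (AF_symm hA F)
  have hgx : g ≠ x := by rintro rfl; exact hirr _ hxg
  -- remove g
  refine RegOn.removeVertex hs g ?_ ?_
  swap
  · refine rem hA hgF ?_ (hpsi1 g hgF) hM (le_refl _)
    refine RegOn.unedge hA (hirr x) (hirr g) hxg hxF hgF (cn_sub F g) ?_ ?_ hd
    · intro u hu
      refine ⟨?_, fun h => ?_⟩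
      · rintro rfl; exact hu.2.2 (hA _ _ hxg)
      · exact hu.2.1 (hx u hu.1 h)
    · intro u hu; exact hu.2
  -- the rest after removing x
  have hrest : RegOn K (((F \ Kset (AF A F) w M) \ {g}) \ {x}) (quad (EC (AF A F) M)) d := by
    have := hpsi2 d (hd.mono Set.diff_subset le_rfl) (rs (F \ {x}) M) (rs_edges Set.diff_subset hM)
    refine (this.mono (Y' := (((F \ Kset (AF A F) w M) \ {g}) \ {x})) ?_ le_rfl).quad_congr ?_
    · rintro u ⟨h1, h2⟩
      exact ⟨⟨h1.1.1, h2⟩, fun h => h1.1.2 (Kset_mono Set.diff_subset w M h)⟩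
    · intro u hu v hv
      exact ⟨EC_rs_mono Set.diff_subset, fun h => lemmaL hA hx _ rfl hM h hu.2 hv.2⟩
  by_cases hxK : x ∈ F \ Kset (AF A F) w M
  swap
  · refine hrest.mono ?_ le_rfl
    intro u hu
    exact ⟨hu, by rintro rfl; exact hxK hu.1⟩
  by_cases htok : ∃ c M1, M = s(g, c) ::ₘ M1 ∧ c ≠ x
  · obtain ⟨c, M1, rfl, hcx⟩ := htok
    have hgc : AF A F g c := (IsE.mk_iff (AF_symm hA F)).1 (hM _ (by simp))
    have hcg : c ≠ g := by rintro rfl; exact hirr _ hgc.1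
    have hNg : ∀ u ∈ F, A g u → u = x ∨ u = c := by
      rcases hc c hgc.2.2 hgc.1 hcx with h | h
      · exact absurd ⟨c, .base ⟨hxg, hxF, hgF⟩ rfl, h⟩ hxK.2
      · exact h
    have hcF1 : c ∈ cn A F x := ⟨hgc.2.2, hcx, fun h => hcg (hx c hgc.2.2 h)⟩
    set F1 := cn A F x with hF1
    have hgF1 : g ∉ F1 := fun h => h.2.2 hxg
    set F2 := cn A F1 c with hF2
    have hF2F : F2 ⊆ F := (cn_sub _ _).trans (cn_sub _ _)
    refine RegOn.removeVertex hs x hrest ?_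
    refine RegOn.isolated hs x (fun _ u hu h => hu.2 h) ?_
    -- D agrees with EC F1
    set M := s(g, c) ::ₘ M1 with hMdef
    have hFM : ∀ u, u ∈ (((F \ Kset (AF A F) w M) \ {g}) \ {u | EC (AF A F) M x u}) \ {x} →
       ¬ EC (AF A F1) (rs F1 M) c u := by
      intro u hu h
      apply hu.1.2
      have hle : rs F1 M ≤ M1 := by
        rw [hMdef]
        classical
        unfold rs
        rw [Multiset.filter_cons_of_neg]
        · exact Multiset.filter_le _ _
        · intro h; exact hgF1 (h g (by simp))
      exact EC.step (A := AF A F) (N := M) ⟨hxg, hxF, hgF⟩ hMdef (h.mono (AF_mono (cn_sub _ _)) hle)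
    have hDF1 : ∀ u, u ∈ (((F \ Kset (AF A F) w M) \ {g}) \ {u | EC (AF A F) M x u}) \ {x} →
       ∀ v, v ∈ (((F \ Kset (AF A F) w M) \ {g}) \ {u | EC (AF A F) M x u}) \ {x} →
       (EC (AF A F) M u v → EC (AF A F1) (rs F1 M) u v) := by
      intro u hu v hv h
      exact lemmaA hA hxF h hu.2 hv.2 hu.1.2 hv.1.2
    refine RegOn.isolated hs c (fun hcY u hu h => hFM u hu (hDF1 c hcY u hu h)) ?_
    have hreg2 : RegOn K F2 (quad A) (d - 1) := by
      refine RegOn.unedge hA (hirr x) (hirr g) hxg hxF hgF hF2F ?_ ?_ hd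
      · intro u hu; exact hu.1.2
      · intro u hu
        refine ⟨?_, fun h => ?_⟩
        · rintro rfl; exact hgF1 hu.1
        · rcases hNg u hu.1.1 h with h' | h'
          · exact hu.1.2.1 h'
          · exact hu.2.1 h'
    have := hpsi3 x hxF c hgc.2.2 _ hreg2 (rs F2 (rs F1 M))
      (rs_edges (cn_sub _ _) (rs_edges (cn_sub _ _) hM))
    refine (this.mono (Y' := ((((F \ Kset (AF A F) w M) \ {g}) \ {u | EC (AF A F) M x u}) \ {x}) \ {c}) ?_ le_rfl).quad_congr ?_
    · rintro u ⟨h1, h2⟩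
      have hu1 : u ∈ F1 := ⟨h1.1.1.1.1, h1.2, fun h => h1.1.2 (.base ⟨h, hxF, h1.1.1.1.1⟩)⟩
      refine ⟨⟨hu1, h2, fun h => ?_⟩, fun h => ?_⟩
      · exact hFM u h1 (.base ⟨h, hcF1, hu1⟩)
      · exact h1.1.1.1.2 (Kset_mono (cn_sub _ _) w M (Kset_mono (cn_sub _ _) w _ h))
    · rintro u ⟨h1, h2⟩ v ⟨h3, h4⟩
      constructor
      · intro h; exact EC_rs_mono (cn_sub _ _) (EC_rs_mono (cn_sub _ _) h)
      · intro h
        exact lemmaA hA hcF1 (hDF1 u h1 v h3 h) h2 h4 (hFM u h1) (hFM v h3)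
  · push Not at htok
    refine RegOn.isolated hs x (fun hxY u hu h => ?_) hrest
    exact hu.2 (EC_leaf hx h rfl htok)

/-- the main induction -/
theorem psi_main (hA : ∀ u v, A u v → A v u) (hirr : ∀ u, ¬ A u u) (w : V → ℕ) (W X : Set V) (hfin : W.Finite)
    (hw : ∀ x ∈ W, x ∈ X → ∀ z ∈ W, z ∉ X → w x < w z)
    (hstr : ∀ F ⊆ W, F ∩ X = ∅ → 
      (∃ x ∈ F, ∃ g ∈ F, A x g ∧ (∀ u ∈ F, A x u → u = g) ∧
        (∀ c ∈ F, A g c → c ≠ x → (w c < w x ∨ ∀ u ∈ F, A g u → u = x ∨ u = c))) ∨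
      (∀ d : ℤ, RegOn K F (quad A) d → ∀ a ∈ F, (∃ u ∈ F, A a u) → RegOn K (cn A F a) (quad A) (d - 1)))
    (n : ℕ) : ∀ F ⊆ W, F.ncard = n → Tw A X F → Psi K A w F := by
  induction n using Nat.strong_induction_on with
  | _ n ih =>
  intro F hF hn htw
  have hFfin := hfin.subset hF
  have ih' : ∀ F' ⊆ F, ∀ a ∈ F, a ∉ F' → Tw A X F' → Psi K A w F' := by
    intro F' hF' a ha ha' htw'
    refine ih F'.ncard ?_ F' (hF'.trans hF) rfl htw'
    rw [← hn]
    exact Set.ncard_lt_ncard ⟨hF', fun h => ha' (h ha)⟩ hFfin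
  have h1 : ∀ a ∈ F, Psi K A w (cn A F a) := fun a ha =>
    ih' _ (cn_sub F a) a ha (fun h => h.2.1 rfl) (htw.cn hA a)
  by_cases hX : F ∩ X = ∅
  · have hXn : ∀ u ∈ F, u ∉ X := fun u hu hu' => by
      have : u ∈ F ∩ X := ⟨hu, hu'⟩
      rw [hX] at this; exact this
    rcases hstr F hF hX with ⟨x, hx, g, hg, h2, h3, h4⟩ | h2
    · refine caseL hA hirr hx hg h2 h3 h4 h1 ?_ ?_
      · exact ih' _ Set.diff_subset x hx (by simp) (fun u hu hu' => absurd hu' (hXn u hu.1))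
      · intro a ha b hb
        exact ih' _ ((cn_sub _ _).trans (cn_sub _ _)) a ha (fun h => h.1.2.1 rfl) ((htw.cn hA a).cn hA b)
    · exact caseC hA hFfin h2 h1
  · obtain ⟨x, hx, hxX⟩ := Set.nonempty_iff_ne_empty.2 hX
    refine caseT hA hirr hFfin (fun x hx h z hz h' => hw x (hF hx) h z (hF hz) h') htw h1 ?_
    exact ih' _ Set.diff_subset x hx (fun h => h.2 hxX) (fun u hu hu' => absurd hu' hu.2)

end Psi

end EIR


namespace EIR

section Cyc

variable {V : Type} [LinearOrder V] {K : Type} [Field K]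

theorem Van.L2 {B : Finset V} {a : V} (ha : a ∉ B) {A A0 A1 : Finset V → Prop} {i : ℕ}
    (h0 : ∀ σ ⊆ B, (A σ ↔ A0 σ)) (h1 : ∀ σ ⊆ B, (A (insert a σ) ↔ A1 σ))
    (h01 : ∀ σ ⊆ B, A0 σ → A1 σ)
    (hv : Van K (insert a B) A i) (hv1 : Van K B A1 i) : Van K B A0 i := by
  classical
  intro c hc
  have hsplit : ∀ (g : Finset V → K) τ, τ ⊆ B → 
      dl (insert a B) g τ = sgn K a τ * g (insert a τ) + dl B g τ := by
    intro g τ hτ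
    unfold dl
    have haτ : a ∉ τ := fun h => ha (hτ h)
    rw [Finset.insert_sdiff_of_notMem _ haτ, Finset.sum_insert]
    intro h; exact ha (Finset.mem_sdiff.1 h).1
  have hsplit2 : ∀ (g : Finset V → K) τ, τ ⊆ B → 
      dl (insert a B) g (insert a τ) = ∑ v ∈ B \ τ, sgn K v (insert a τ) * g (insert a (insert v τ)) := by
    intro g τ hτ
    unfold dl
    have : insert a B \ insert a τ = B \ τ := by
      ext v; simp only [Finset.mem_sdiff, Finset.mem_insert]
      constructor
      · rintro ⟨h1, h2⟩; tauto
      · rintro ⟨k1, k2⟩; refine ⟨Or.inr k1, ?_⟩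
        rintro (e | h)
        · subst e; exact ha k1
        · exact k2 h
    rw [this]
    exact Finset.sum_congr rfl fun v _ => by rw [Finset.insert_comm]
  obtain ⟨w, hw⟩ := hv (fun σ => if a ∈ σ then 0 else c σ) (by
    intro τ t1 t2 t3
    by_cases haτ : a ∈ τ
    · refine Finset.sum_eq_zero fun v _ => ?_
      simp [haτ]
    · have hτ : τ ⊆ B := (Finset.subset_insert_iff_of_notMem haτ).1 t1
      rw [hsplit _ _ hτ, if_pos (by simp), mul_zero, zero_add]
      have hcc := hc τ hτ ((h0 τ hτ).1 t2) t3
      refine Eq.trans ?_ hcc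
      unfold dl
      refine Finset.sum_congr rfl fun v hv => ?_
      beta_reduce
      rw [if_neg]
      simp only [Finset.mem_insert, haτ, or_false]
      rintro rfl; exact ha (Finset.mem_sdiff.1 hv).1)
  obtain ⟨w', hw'⟩ := hv1 (fun σ => sgn K a σ * w (insert a σ)) (by
    intro τ t1 t2 t3
    have haτ : a ∉ τ := fun h => ha (t1 h)
    have := hw (insert a τ) (Finset.insert_subset_insert _ t1) ((h1 τ t1).2 t2) (by
      rw [Finset.card_insert_of_notMem haτ, t3])
    rw [if_pos (by simp), hsplit2 _ _ t1] at this
    have e : dl B (fun σ => sgn K a σ * w (insert a σ)) τ = 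
       - sgn K a τ * ∑ v ∈ B \ τ, sgn K v (insert a τ) * w (insert a (insert v τ)) := by
      rw [Finset.mul_sum]
      unfold dl
      refine Finset.sum_congr rfl fun v hv => ?_
      have hv' := Finset.mem_sdiff.1 hv
      have hav : a ≠ v := by rintro rfl; exact ha hv'.1
      have := sgn_comm (K := K) hav haτ hv'.2
      linear_combination w (insert a (insert v τ)) * this
    rw [e, ← this, mul_zero])
  refine ⟨fun σ => w σ + w' σ, fun σ s1 s2 s3 => ?_⟩
  have haσ : a ∉ σ := fun h => ha (s1 h)
  have e1 := hw σ (s1.trans (Finset.subset_insert _ _)) ((h0 σ s1).2 s2) s3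
  have e2 := hw' σ s1 (h01 σ s1 s2) s3
  rw [if_neg haσ, hsplit _ _ s1] at e1
  rw [dl_add]
  beta_reduce at e2
  rw [e1, e2]; ring

theorem Van.unshift {B : Finset V} {x : V} (hx : x ∉ B) {A A' : Finset V → Prop} {i : ℕ}
    (hA : ∀ σ ⊆ B, A' σ → A (insert x σ)) (hA2 : ∀ σ ⊆ insert x B, A σ → x ∈ σ ∧ A' (σ.erase x))
    (h : Van K (insert x B) A (i + 1)) : Van K B A' i := by
  classical
  intro c hc
  have hsd : ∀ τ, τ ⊆ B → insert x B \ insert x τ = B \ τ := by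
    intro τ hτ
    ext v; simp only [Finset.mem_sdiff, Finset.mem_insert]
    constructor
    · rintro ⟨h1, h2⟩; tauto
    · rintro ⟨h1, h2⟩; refine ⟨Or.inr h1, ?_⟩
      rintro (rfl | h); exacts [hx h1, h2 h]
  obtain ⟨w, hw⟩ := h (fun σ => sgn K x (σ.erase x) * c (σ.erase x)) (by
    intro σ s1 s2 s3
    obtain ⟨hxσ, s4⟩ := hA2 σ s1 s2
    obtain ⟨τ, hτ, rfl⟩ : ∃ τ, x ∉ τ ∧ insert x τ = σ := ⟨σ.erase x, by simp, Finset.insert_erase hxσ⟩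
    rw [Finset.erase_insert hτ] at s4
    have hτB : τ ⊆ B := (Finset.subset_insert_iff_of_notMem hτ).1 ((Finset.subset_insert _ _).trans s1)
    rw [Finset.card_insert_of_notMem hτ] at s3
    have h0 := hc τ hτB s4 (by omega)
    have e : dl (insert x B) (fun σ => sgn K x (σ.erase x) * c (σ.erase x)) (insert x τ) = 
        - sgn K x τ * dl B c τ := by
      unfold dl
      rw [hsd τ hτB, Finset.mul_sum]
      refine Finset.sum_congr rfl fun v hv => ?_
      have hv' := Finset.mem_sdiff.1 hv
      have hxv : x ≠ v := by rintro rfl; exact hx hv'.1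
      beta_reduce
      rw [Finset.insert_comm v x, Finset.erase_insert (by simp [hxv, hτ])]
      have := sgn_comm' (K := K) hxv hτ hv'.2
      linear_combination c (insert v τ) * this
    rw [e, h0, mul_zero])
  refine ⟨fun σ => - (sgn K x σ * w (insert x σ)), fun σ s1 s2 s3 => ?_⟩
  have hxσ : x ∉ σ := fun h => hx (s1 h)
  have := hw (insert x σ) (Finset.insert_subset_insert _ s1) (hA σ s1 s2) (by
    rw [Finset.card_insert_of_notMem hxσ, s3])
  rw [Finset.erase_insert hxσ] at this
  have e : dl B (fun σ => - (sgn K x σ * w (insert x σ))) σ = 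
      sgn K x σ * dl (insert x B) w (insert x σ) := by
    unfold dl
    rw [hsd σ s1, Finset.mul_sum]
    refine Finset.sum_congr rfl fun v hv => ?_
    have hv' := Finset.mem_sdiff.1 hv
    have hxv : x ≠ v := by rintro rfl; exact hx hv'.1
    rw [Finset.insert_comm v x]
    have := sgn_comm (K := K) hxv hxσ hv'.2
    linear_combination (- w (insert x (insert v σ))) * this
  rw [e, ← this, ← mul_assoc, sgn_mul_self, one_mul]

theorem Van.shiftN (N : Finset V) : ∀ {B : Finset V} {Q : Finset V → Prop} {i : ℕ},
    Disjoint N B → (Van K (N ∪ B) (fun σ => N ⊆ σ ∧ Q (σ \ N)) (i + N.card) ↔ Van K B Q i) := by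
  classical
  induction N using Finset.induction_on with
  | empty => intro B Q i _; simp
  | insert x N hx ih =>
    intro B Q i hd
    rw [Finset.disjoint_insert_left] at hd
    have hxNB : x ∉ N ∪ B := by simp [hx, hd.1]
    rw [← ih hd.2, Finset.insert_union, Finset.card_insert_of_notMem hx]
    have key : ∀ σ : Finset V, σ.erase x \ N = σ \ insert x N := by
      intro σ; ext v; simp only [Finset.mem_sdiff, Finset.mem_erase, Finset.mem_insert]; tauto
    have key2 : ∀ σ : Finset V, x ∈ σ → (N ⊆ σ.erase x ↔ insert x N ⊆ σ) := by
      intro σ hσ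
      rw [Finset.insert_subset_iff]
      constructor
      · intro h; exact ⟨hσ, h.trans (Finset.erase_subset _ _)⟩
      · intro h v hv
        refine Finset.mem_erase.2 ⟨?_, h.2 hv⟩
        rintro rfl; exact hx hv
    constructor
    · intro h
      refine Van.unshift hxNB ?_ ?_ h
      · rintro σ hσ ⟨h1, h2⟩
        have hxσ : x ∉ σ := fun h => hxNB (hσ h)
        refine ⟨Finset.insert_subset_insert _ h1, ?_⟩
        rw [← key, Finset.erase_insert hxσ]; exact h2
      · rintro σ hσ ⟨h1, h2⟩
        have hxσ : x ∈ σ := h1 (by simp)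
        refine ⟨hxσ, (key2 σ hxσ).2 h1, ?_⟩
        rw [key]; exact h2
    · intro h
      refine Van.shift hxNB ?_ h
      intro σ hσ
      constructor
      · rintro ⟨h1, h2⟩
        have hxσ : x ∈ σ := h1 (by simp)
        exact ⟨hxσ, (key2 σ hxσ).2 h1, by rw [key]; exact h2⟩
      · rintro ⟨h0, h1, h2⟩
        exact ⟨(key2 σ h0).1 h1, by rw [← key]; exact h2⟩

variable (K) in
/-- top multidegree vanishing of an induced subgraph -/
def cx (D : V → V → Prop) (B : Finset V) (i : ℕ) : Prop :=
  Van K B (fun σ => ∀ u ∈ B, ∀ v ∈ B, u ∉ σ → v ∉ σ → ¬ D u v) i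

variable {D : V → V → Prop}

theorem cx_iso (hD : ∀ u v, D u v → D v u) {B : Finset V} {x : V} (hx : x ∈ B) (h : ∀ u ∈ B, ¬ D x u) (i : ℕ) :
    cx K D B i := by
  refine Van.free hx ?_
  intro σ _ hσ u hu v hv hu' hv' huv
  simp only [Finset.mem_erase, not_and] at hu' hv'
  by_cases hux : u = x
  · subst hux; exact h v hv huv
  by_cases hvx : v = x
  · subst hvx; exact h u hu (hD _ _ huv)
  exact hσ u hu v hv (hu' hux) (hv' hvx) huv

theorem cx_empty : ¬ cx K D ∅ 0 := by
  intro h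
  obtain ⟨w, hw⟩ := h (fun _ => 1) (by intro τ _ _ h; omega)
  have := hw ∅ (le_refl _) (by simp) rfl
  simp [dl] at this

theorem cx_aux (hD : ∀ u v, D u v → D v u) {B N : Finset V} {a : V} (ha : a ∈ B) (haa : ¬ D a a)
    (hN : ∀ u, u ∈ N ↔ u ∈ B ∧ D a u) : a ∉ B.erase a ∧ insert a (B.erase a) = B ∧ 
     Disjoint N (B \ insert a N) ∧ N ∪ (B \ insert a N) = B.erase a ∧
     (∀ σ ⊆ B.erase a, ((∀ u ∈ B, ∀ v ∈ B, u ∉ σ → v ∉ σ → ¬ D u v) ↔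
       N ⊆ σ ∧ ∀ u ∈ B \ insert a N, ∀ v ∈ B \ insert a N, u ∉ σ \ N → v ∉ σ \ N → ¬ D u v)) := by
  have haN : a ∉ N := fun h => haa ((hN a).1 h).2
  refine ⟨by simp, Finset.insert_erase ha, ?_, ?_, ?_⟩
  · rw [Finset.disjoint_left]; intro u hu hu'
    simp [hu] at hu'
  · ext u
    have := hN u
    simp only [Finset.mem_union, Finset.mem_sdiff, Finset.mem_insert, Finset.mem_erase, not_or]
    constructor
    · rintro (h | h)
      · exact ⟨by rintro rfl; exact haN h, ((hN u).1 h).1⟩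
      · exact ⟨h.2.1, h.1⟩
    · rintro ⟨h1, h2⟩
      by_cases h : u ∈ N
      · exact Or.inl h
      · exact Or.inr ⟨h2, h1, h⟩
  · intro σ hσ
    have haσ : a ∉ σ := fun h => by simpa using hσ h
    constructor
    · intro h
      refine ⟨?_, ?_⟩
      · intro u hu
        by_contra hu'
        exact h a ha u ((hN u).1 hu).1 haσ hu' ((hN u).1 hu).2
      · intro u hu v hv hu' hv'
        simp only [Finset.mem_sdiff, Finset.mem_insert, not_or, not_and, not_not] at *
        exact h u hu.1 v hv.1 (fun h => hu.2.2 (hu' h)) (fun h => hv.2.2 (hv' h))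
    · rintro ⟨h1, h2⟩ u hu v hv hu' hv' huv
      by_cases hua : u = a
      · subst hua; exact hv' (h1 ((hN v).2 ⟨hv, huv⟩))
      by_cases hva : v = a
      · subst hva; exact hu' (h1 ((hN u).2 ⟨hu, hD _ _ huv⟩))
      refine h2 u ?_ v ?_ ?_ ?_ huv
      · simp only [Finset.mem_sdiff, Finset.mem_insert, not_or]
        exact ⟨hu, hua, fun h => hu' (h1 h)⟩
      · simp only [Finset.mem_sdiff, Finset.mem_insert, not_or]
        exact ⟨hv, hva, fun h => hv' (h1 h)⟩
      · simp [hu']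
      · simp [hv']

theorem cx_ins {B : Finset V} {a : V} : ∀ σ ⊆ B.erase a, 
    ((∀ u ∈ B, ∀ v ∈ B, u ∉ insert a σ → v ∉ insert a σ → ¬ D u v) ↔
      (∀ u ∈ B.erase a, ∀ v ∈ B.erase a, u ∉ σ → v ∉ σ → ¬ D u v)) := by
  intro σ hσ
  constructor
  · intro h u hu v hv hu' hv'
    rw [Finset.mem_erase] at hu hv
    exact h u hu.2 v hv.2 (by simp [hu.1, hu']) (by simp [hv.1, hv'])
  · intro h u hu v hv hu' hv'
    simp only [Finset.mem_insert, not_or] at hu' hv'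
    exact h u (by simp [hu'.1, hu]) v (by simp [hv'.1, hv]) hu'.2 hv'.2

theorem cx_down (hD : ∀ u v, D u v → D v u) {B N : Finset V} {a : V} (ha : a ∈ B) (haa : ¬ D a a)
    (hN : ∀ u, u ∈ N ↔ u ∈ B ∧ D a u) {i : ℕ} (h1 : cx K D B (i + N.card))
    (h2 : cx K D (B.erase a) (i + N.card)) : cx K D (B \ insert a N) i := by
  obtain ⟨q1, q2, q3, q4, q5⟩ := cx_aux hD ha haa hN
  refine (Van.shiftN N q3).1 ?_
  rw [q4]
  refine Van.L2 (a := a) q1 q5 cx_ins ?_ (by rw [q2]; exact h1) h2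
  intro σ hσ h u hu v hv
  exact (q5 σ hσ).2 h u (Finset.mem_of_mem_erase hu) v (Finset.mem_of_mem_erase hv)

theorem cx_up (hD : ∀ u v, D u v → D v u) {B N : Finset V} {a : V} (ha : a ∈ B) (haa : ¬ D a a)
    (hN : ∀ u, u ∈ N ↔ u ∈ B ∧ D a u) (h1 : ∀ i, cx K D (B \ insert a N) i)
    (h2 : ∀ i, cx K D (B.erase a) i) (i : ℕ) : cx K D B i := by
  obtain ⟨q1, q2, q3, q4, q5⟩ := cx_aux hD ha haa hN
  have hmono : ∀ τ ⊆ B, ∀ v ∈ B, (∀ u ∈ B, ∀ v ∈ B, u ∉ τ → v ∉ τ → ¬ D u v) →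
     (∀ u ∈ B, ∀ v' ∈ B, u ∉ insert v τ → v' ∉ insert v τ → ¬ D u v') := by
    intro τ _ x _ h u hu v hv hu' hv'
    exact h u hu v hv (fun h => hu' (by simp [h])) (fun h => hv' (by simp [h]))
  refine Van.ext (B' := B.erase a) (A1 := fun σ => a ∈ σ ∧ ∀ u ∈ B, ∀ v ∈ B, u ∉ σ → v ∉ σ → ¬ D u v)
    (A2 := fun σ => ∀ u ∈ B, ∀ v ∈ B, u ∉ σ → v ∉ σ → ¬ D u v) (Finset.erase_subset _ _) ?_ ?_ hmono ?_ ?_ ?_ ?_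
  · rintro τ hτ v hv ⟨h1, h2⟩
    exact ⟨by simp [h1], hmono τ hτ v hv h2⟩
  · intro τ hτ v hv h
    exact hmono τ (hτ.trans (Finset.erase_subset _ _)) v (Finset.mem_of_mem_erase hv) h
  · intro τ hτ
    constructor
    · intro h
      by_cases haτ : a ∈ τ
      · exact Or.inl ⟨haτ, h⟩
      · refine Or.inr ⟨fun v hv => Finset.mem_erase.2 ⟨?_, hτ hv⟩, h⟩
        rintro rfl; exact haτ hv
    · rintro (h | h); exacts [h.2, h.2]
  · intro τ hτ h
    have := hτ h.1
    simp at this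
  · rcases i with _ | i
    · refine Van.of_empty ?_
      intro σ _ h h'
      rw [Finset.card_eq_zero] at h; subst h; simp at h'
    · conv => arg 2; rw [← q2]
      refine Van.shift q1 ?_ (h2 i)
      intro σ hσ
      by_cases haσ : a ∈ σ
      · have := cx_ins (D := D) (B := B) (a := a) (σ.erase a) (by
          rw [q2] at hσ; exact Finset.erase_subset_erase _ hσ)
        rw [Finset.insert_erase haσ] at this
        rw [this]
      · simp [haσ]
  · by_cases hi : N.card ≤ i
    · obtain ⟨j, rfl⟩ := Nat.exists_eq_add_of_le' hi
      have := (Van.shiftN N q3).2 (h1 j)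
      rw [q4] at this
      exact this.congr fun σ hσ => (q5 σ hσ).symm
    · refine Van.of_empty fun σ hσ hc h => ?_
      have := Finset.card_le_card ((q5 σ hσ).1 h).1
      omega

theorem RegOn.cx {Y : Set V} {d : ℤ} (h : RegOn K Y (quad D) d) (hirr : ∀ u, ¬ D u u) {B : Finset V} (hB : (B : Set V) ⊆ Y)
    {i : ℕ} (hi : d + i < B.card) : cx K D B i := by
  have hs : (ind B).support = B := by ext v; simp [ind_apply]
  have hdeg : (ind B).degree = B.card := by
    rw [Finsupp.degree_apply, hs]
    simp [ind_apply]
  have := h (ind B) (by rw [hs]; exact hB) i (by rw [hdeg]; exact hi)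
  rw [hs] at this
  refine this.congr fun σ hσ => ?_
  constructor
  · intro h u hu v hv hu' hv' huv
    refine h ⟨u, v, huv, fun z => ?_⟩
    have huv' : u ≠ v := by rintro rfl; exact hirr _ huv
    simp only [Finsupp.coe_add, Pi.add_apply, e1_apply, Finsupp.tsub_apply, ind_apply]
    split_ifs <;> simp_all
  · rintro h ⟨u, v, huv, hle⟩
    have := le_supp hle
    simp only [Finsupp.mem_support_iff, Finsupp.tsub_apply, ind_apply] at this
    have h1 : u ∈ B ∧ u ∉ σ := by
      by_contra hh
      apply this.1
      split_ifs <;> simp_all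
    have h2 : v ∈ B ∧ v ∉ σ := by
      by_contra hh
      apply this.2
      split_ifs <;> simp_all
    exact h u h1.1 v h2.1 h1.2 h2.2 huv

end Cyc

end EIR


namespace EIR

section Cyc2

variable {V : Type} [LinearOrder V] {K : Type} [Field K] {D : V → V → Prop}

/-- `f` restricted to `[s,e)` is an induced path -/
def Pth (D : V → V → Prop) (f : ℕ → V) (s e : ℕ) : Prop :=
  (∀ i j, s ≤ i → i < e → s ≤ j → j < e → f i = f j → i = j) ∧
  (∀ i j, s ≤ i → i < e → s ≤ j → j < e → (D (f i) (f j) ↔ (j = i + 1 ∨ i = j + 1)))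

theorem Pth.sub {f : ℕ → V} {s e s' e' : ℕ} (h : Pth D f s e) (hs : s ≤ s') (he : e' ≤ e) : Pth D f s' e' :=
  ⟨fun i j a b c d => h.1 i j (by omega) (by omega) (by omega) (by omega),
   fun i j a b c d => h.2 i j (by omega) (by omega) (by omega) (by omega)⟩

/-- image of an interval -/
def im (f : ℕ → V) (s e : ℕ) : Finset V := (Finset.Ico s e).image f

theorem mem_im {f : ℕ → V} {s e : ℕ} {v : V} : v ∈ im f s e ↔ ∃ i, s ≤ i ∧ i < e ∧ f i = v := by
  simp [im, and_assoc]

theorem Pth.step_aux {f : ℕ → V} {s e : ℕ} (h : Pth D f s e) (he : s + 2 ≤ e) :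
    ∃ N : Finset V, (∀ u, u ∈ N ↔ u ∈ im f s e ∧ D (f (s+1)) u) ∧
      N.card = (if s + 2 = e then 1 else 2) ∧ im f s e \ insert (f (s+1)) N = im f (s+3) e ∧
      (∀ u ∈ (im f s e).erase (f (s+1)), ¬ D (f s) u) := by
  have hN : ∀ u, (u ∈ im f s e ∧ D (f (s+1)) u) ↔ (u = f s ∨ (s + 2 < e ∧ u = f (s+2))) := by
    intro u
    constructor
    · rintro ⟨hu, hd⟩
      obtain ⟨i, h1, h2, rfl⟩ := mem_im.1 hu
      rcases (h.2 (s+1) i (by omega) (by omega) h1 h2).1 hd with e | e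
      · right; subst e; exact ⟨by omega, rfl⟩
      · left; congr 1; omega
    · rintro (rfl | ⟨h1, rfl⟩)
      · exact ⟨mem_im.2 ⟨s, by omega, by omega, rfl⟩, (h.2 _ _ (by omega) (by omega) (by omega) (by omega)).2 (Or.inr rfl)⟩
      · exact ⟨mem_im.2 ⟨s+2, by omega, by omega, rfl⟩, (h.2 _ _ (by omega) (by omega) (by omega) (by omega)).2 (Or.inl rfl)⟩
  have hfs : ∀ u ∈ (im f s e).erase (f (s+1)), ¬ D (f s) u := by
    intro u hu hd
    rw [Finset.mem_erase] at hu
    obtain ⟨i, h1, h2, rfl⟩ := mem_im.1 hu.2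
    rcases (h.2 s i (by omega) (by omega) h1 h2).1 hd with e | e
    · subst e; exact hu.1 rfl
    · omega
  have hsd : ∀ N : Finset V, (∀ u, u ∈ N ↔ (u = f s ∨ (s + 2 < e ∧ u = f (s+2)))) → 
      im f s e \ insert (f (s+1)) N = im f (s+3) e := by
    intro N hN'
    ext u
    simp only [Finset.mem_sdiff, Finset.mem_insert, not_or, hN', mem_im]
    constructor
    · rintro ⟨⟨i, h1, h2, rfl⟩, h3, h4, h5⟩
      refine ⟨i, ?_, h2, rfl⟩
      by_contra hlt
      have : i = s ∨ i = s + 1 ∨ i = s + 2 := by omega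
      rcases this with rfl | rfl | rfl
      · exact h4 rfl
      · exact h3 rfl
      · exact h5 ⟨h2, rfl⟩
    · rintro ⟨i, h1, h2, rfl⟩
      refine ⟨⟨i, by omega, h2, rfl⟩, fun h' => ?_, fun h' => ?_, fun h' => ?_⟩
      · have := h.1 _ _ (by omega) h2 (by omega) (by omega) h'; omega
      · have := h.1 _ _ (by omega) h2 (by omega) (by omega) h'; omega
      · have := h.1 _ _ (by omega) h2 (by omega) (by omega) h'.2; omega
  by_cases he2 : s + 2 = e
  · have hN1 : ∀ u, u ∈ ({f s} : Finset V) ↔ (u = f s ∨ (s + 2 < e ∧ u = f (s+2))) := by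
      intro u; simp; intro h; omega
    exact ⟨{f s}, fun u => (hN1 u).trans (hN u).symm, by simp [he2], hsd _ hN1, hfs⟩
  · have hN1 : ∀ u, u ∈ ({f s, f (s+2)} : Finset V) ↔ (u = f s ∨ (s + 2 < e ∧ u = f (s+2))) := by
      have hlt : s + 2 < e := by omega
      intro u; simp [hlt]
    refine ⟨{f s, f (s+2)}, fun u => (hN1 u).trans (hN u).symm, ?_, hsd _ hN1, hfs⟩
    rw [if_neg he2, Finset.card_pair]
    intro h'
    have := h.1 _ _ (by omega) (by omega) (by omega) (by omega) h'; omega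

theorem Pth.all (hD : ∀ u v, D u v → D v u) (hirr : ∀ u, ¬ D u u) {f : ℕ → V} (q : ℕ) : ∀ {s e : ℕ}, Pth D f s e → e = s + 3 * q + 1 → 
    ∀ i, cx K D (im f s e) i := by
  induction q with
  | zero =>
    intro s e h he i
    refine cx_iso (x := f s) hD (mem_im.2 ⟨s, by omega, by omega, rfl⟩) ?_ i
    intro u hu
    obtain ⟨j, h1, h2, rfl⟩ := mem_im.1 hu
    have : j = s := by omega
    subst this; exact hirr _
  | succ q ih =>
    intro s e h he i
    obtain ⟨N, h1, h2, h3, h4⟩ := h.step_aux (by omega)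
    refine cx_up (N := N) hD (a := f (s+1)) (mem_im.2 ⟨s+1, by omega, by omega, rfl⟩) (hirr _) h1 ?_ ?_ i
    · rw [h3]
      exact ih (h.sub (by omega) le_rfl) (by omega)
    · refine cx_iso (x := f s) hD ?_ h4
      refine Finset.mem_erase.2 ⟨fun h' => ?_, mem_im.2 ⟨s, by omega, by omega, rfl⟩⟩
      have := h.1 _ _ (by omega) (by omega) (by omega) (by omega) h'; omega

theorem Pth.not_cx (hD : ∀ u v, D u v → D v u) (hirr : ∀ u, ¬ D u u) {f : ℕ → V} (q : ℕ) : ∀ {s e : ℕ}, Pth D f s e → e = s + 3 * q + 2 → 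
    ¬ cx K D (im f s e) (2 * q + 1) := by
  induction q with
  | zero =>
    intro s e h he hc
    obtain ⟨N, h1, h2, h3, h4⟩ := h.step_aux (by omega)
    rw [if_pos (by omega)] at h2
    have := cx_down (K := K) (i := 0) hD (a := f (s+1)) (mem_im.2 ⟨s+1, by omega, by omega, rfl⟩) (hirr _) h1 
      (by rw [h2]; exact hc) (by
        refine cx_iso (x := f s) hD ?_ h4 _
        refine Finset.mem_erase.2 ⟨fun h' => ?_, mem_im.2 ⟨s, by omega, by omega, rfl⟩⟩
        have := h.1 _ _ (by omega) (by omega) (by omega) (by omega) h'; omega)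
    rw [h3] at this
    have e0 : im f (s+3) e = ∅ := by
      ext u; rw [mem_im]; simp; intro x _ _; omega
    rw [e0] at this
    exact cx_empty this
  | succ q ih =>
    intro s e h he hc
    obtain ⟨N, h1, h2, h3, h4⟩ := h.step_aux (by omega)
    rw [if_neg (by omega)] at h2
    have := cx_down (K := K) (i := 2 * q + 1) hD (a := f (s+1)) (mem_im.2 ⟨s+1, by omega, by omega, rfl⟩) (hirr _) h1 
      (by rw [h2]; exact hc) (by
        refine cx_iso (x := f s) hD ?_ h4 _
        refine Finset.mem_erase.2 ⟨fun h' => ?_, mem_im.2 ⟨s, by omega, by omega, rfl⟩⟩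
        have := h.1 _ _ (by omega) (by omega) (by omega) (by omega) h'; omega)
    rw [h3] at this
    exact ih (h.sub (by omega) le_rfl) (by omega) this

theorem Pth.lower (hD : ∀ u v, D u v → D v u) (hirr : ∀ u, ¬ D u u) {f : ℕ → V} (k : ℕ) : ∀ {s e : ℕ}, Pth D f s e → e - s = k → 
    ∀ {d : ℤ}, RegOn K (im f s e : Set V) (quad D) d → (((k + 1) / 3 : ℕ) : ℤ) ≤ d := by
  induction k using Nat.strong_induction_on with
  | _ k ih =>
  intro s e h he d hd
  by_cases hk : k < 2
  · have := hd.nonneg (quad_zero D)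
    have : (k + 1) / 3 = 0 := by omega
    rw [this]; simpa
  · have hin : ∀ i, s ≤ i → i < e → f i ∈ (im f s e : Set V) := fun i h1 h2 => mem_im.2 ⟨i, h1, h2, rfl⟩
    have := hd.unedge (W := im f (s+3) e) hD (hirr (f s)) (hirr (f (s+1))) 
      ((h.2 s (s+1) (by omega) (by omega) (by omega) (by omega)).2 (Or.inl rfl)) (hin _ (by omega) (by omega))
      (hin _ (by omega) (by omega)) (by
        intro u hu
        obtain ⟨i, h1, h2, rfl⟩ := mem_im.1 hu
        exact hin _ (by omega) h2) (by
        intro u hu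
        obtain ⟨i, h1, h2, rfl⟩ := mem_im.1 hu
        refine ⟨fun h' => ?_, fun h' => ?_⟩
        · have := h.1 _ _ (by omega) h2 (by omega) (by omega) h'; omega
        · have := (h.2 _ _ (by omega) (by omega) (by omega) h2).1 h'; omega) (by
        intro u hu
        obtain ⟨i, h1, h2, rfl⟩ := mem_im.1 hu
        refine ⟨fun h' => ?_, fun h' => ?_⟩
        · have := h.1 _ _ (by omega) h2 (by omega) (by omega) h'; omega
        · have := (h.2 _ _ (by omega) (by omega) (by omega) h2).1 h'; omega)
    have := ih (k - 3) (by omega) (h.sub (s' := s+3) (by omega) le_rfl) (by omega) this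
    omega

theorem RegOn.isolatedSet {Y Z : Set V} (hD : ∀ u v, D u v → D v u) {d : ℤ}
    (hx : ∀ x ∈ Y, x ∉ Z → ∀ u ∈ Y, ¬ D x u) (h : RegOn K Z (quad D) d) : RegOn K Y (quad D) d := by
  refine RegOn.free (Z := Z) ?_ h
  intro y hy hyZ f hf hJ
  obtain ⟨u, v, h1, h2⟩ := hJ
  have hsup : ∀ z, z ∈ (f + e1 y).support → z ∈ Y := by
    intro z hz
    by_cases hzy : z = y
    · rwa [hzy]
    · apply hf; simpa [Ne.symm hzy, e1_apply] using hz
  have hu := hsup u (le_supp h2).1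
  have hv := hsup v (le_supp h2).2
  have huy : u ≠ y := by rintro rfl; exact hx _ hy hyZ v hv h1
  have hvy : v ≠ y := by rintro rfl; exact hx _ hy hyZ u hu (hD _ _ h1)
  refine ⟨u, v, h1, fun z => ?_⟩
  have := h2 z
  by_cases hz : y = z
  · subst hz; simp [huy, hvy]
  · simpa [hz, e1_apply] using this

theorem Pth.upper (hD : ∀ u v, D u v → D v u) (hirr : ∀ u, ¬ D u u) {f : ℕ → V} (k : ℕ) : ∀ {s e : ℕ}, Pth D f s e → e - s = k → 
    RegOn K (im f s e : Set V) (quad D) (((k + 1) / 3 : ℕ) : ℤ) := by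
  induction k using Nat.strong_induction_on with
  | _ k ih =>
  intro s e h he
  by_cases hk : k < 2
  · refine RegOn.of_no_edges (by positivity) ?_
    intro u hu v hv
    obtain ⟨i, h1, h2, rfl⟩ := mem_im.1 hu
    obtain ⟨j, h3, h4, rfl⟩ := mem_im.1 hv
    have : i = j := by omega
    subst this; exact hirr _
  · obtain ⟨N, h1, h2, h3, h4⟩ := h.step_aux (by omega)
    refine RegOn.removeVertex hD (f (s+1)) ?_ ?_
    · have := ih (k - 2) (by omega) (h.sub (s' := s+2) (by omega) le_rfl) (by omega)
      refine (RegOn.isolatedSet hD ?_ this).mono (le_refl _) (by omega)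
      rintro x ⟨hx, hx'⟩ hx2 u ⟨hu, hu'⟩
      obtain ⟨i, k1, k2, rfl⟩ := mem_im.1 hx
      have : i = s ∨ i = s + 1 ∨ s + 2 ≤ i := by omega
      rcases this with rfl | rfl | k3
      · exact h4 u (Finset.mem_erase.2 ⟨hu', hu⟩)
      · exact absurd rfl hx'
      · exact absurd (mem_im.2 ⟨i, k3, k2, rfl⟩) hx2
    · have := ih (k - 3) (by omega) (h.sub (s' := s+3) (by omega) le_rfl) (by omega)
      refine (RegOn.isolatedSet hD ?_ this).mono (le_refl _) (by omega)
      rintro x ⟨hx, hx'⟩ hx2 u ⟨hu, hu'⟩ hd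
      obtain ⟨i, k1, k2, rfl⟩ := mem_im.1 hx
      have hx3 : f i ∈ im f s e \ insert (f (s+1)) N → False := by
        rw [h3]; exact hx2
      by_cases hi : f i = f (s+1)
      · rw [hi] at hd; exact hu' hd
      · refine hx3 (Finset.mem_sdiff.2 ⟨hx, ?_⟩)
        rw [Finset.mem_insert]
        rintro (h' | h')
        · exact hi h'
        · exact hx' ((h1 _).1 h').2

/-- induced cycle -/
def Cyc (D : V → V → Prop) (f : ℕ → V) (n : ℕ) : Prop :=
  3 ≤ n ∧ (∀ i j, i < n → j < n → f i = f j → i = j) ∧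
  (∀ i j, i < n → j < n → (D (f i) (f j) ↔ (j = i + 1 ∨ i = j + 1 ∨ (i = 0 ∧ j = n - 1) ∨ (j = 0 ∧ i = n - 1))))

theorem Cyc.pth {f : ℕ → V} {n : ℕ} (h : Cyc D f n) : Pth D f 1 n :=
  ⟨fun i j _ b _ d => h.2.1 i j b d, fun i j a b c d => by
    rw [h.2.2 i j b d]
    constructor
    · rintro (h | h | h | h) <;> omega
    · rintro (h | h) <;> omega⟩

theorem Cyc.lower (hD : ∀ u v, D u v → D v u) (hirr : ∀ u, ¬ D u u) {f : ℕ → V} {n : ℕ} (h : Cyc D f n)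
    {Y : Set V} (hY : ∀ i < n, f i ∈ Y) {d : ℤ} (hd : RegOn K Y (quad D) d) : (((n + 1) / 3 : ℕ) : ℤ) ≤ d := by
  have hn := h.1
  by_cases hm : n % 3 = 2
  · by_contra hlt
    push Not at hlt
    obtain ⟨q, hq⟩ : ∃ q, n = 3 * (q + 1) + 2 := ⟨n / 3 - 1, by omega⟩
    have hinj : Set.InjOn f (Finset.Ico 0 n) := by
      intro i hi j hj; simp at hi hj; exact h.2.1 i j hi hj
    have hcard : (im f 0 n).card = n := by
      unfold im; rw [Finset.card_image_of_injOn hinj]; simp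
    have hc : cx K D (im f 0 n) (2 * q + 1 + 2) := by
      refine hd.cx hirr ?_ ?_
      · intro u hu
        obtain ⟨i, _, h2, rfl⟩ := mem_im.1 hu
        exact hY i h2
      · rw [hcard]; push_cast; omega
    have h01 : f 1 ≠ f (n-1) := fun h' => by
      have := h.2.1 _ _ (by omega) (by omega) h'; omega
    have hcN : ({f 1, f (n-1)} : Finset V).card = 2 := Finset.card_pair h01
    have hd0 := cx_down (K := K) (D := D) (N := {f 1, f (n-1)}) (i := 2 * q + 1) hD (a := f 0) 
      (B := im f 0 n) (mem_im.2 ⟨0, le_rfl, by omega, rfl⟩) (hirr _) (by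
        intro u
        simp only [Finset.mem_insert, Finset.mem_singleton]
        constructor
        · rintro (rfl | rfl)
          · exact ⟨mem_im.2 ⟨1, by omega, by omega, rfl⟩, (h.2.2 _ _ (by omega) (by omega)).2 (by omega)⟩
          · exact ⟨mem_im.2 ⟨n-1, by omega, by omega, rfl⟩, (h.2.2 _ _ (by omega) (by omega)).2 (by omega)⟩
        · rintro ⟨h1, h2⟩
          obtain ⟨i, _, h3, rfl⟩ := mem_im.1 h1
          rcases (h.2.2 _ _ (by omega) h3).1 h2 with e | e | e | e
          · left; rw [e]
          · omega
          · right; rw [e.2]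
          · omega) (by rw [hcN]; exact hc) (by
        have := h.pth.all (K := K) hD hirr (q + 1) (by omega)
        have e : (im f 0 n).erase (f 0) = im f 1 n := by
          ext u
          simp only [Finset.mem_erase, mem_im]
          constructor
          · rintro ⟨h1, i, _, h2, rfl⟩
            refine ⟨i, ?_, h2, rfl⟩
            by_contra h0
            have : i = 0 := by omega
            subst this; exact h1 rfl
          · rintro ⟨i, h1, h2, rfl⟩
            refine ⟨fun h' => ?_, i, by omega, h2, rfl⟩
            have := h.2.1 _ _ (by omega) (by omega) h'; omega
        rw [e]; exact this _)
    have e : im f 0 n \ insert (f 0) {f 1, f (n-1)} = im f 2 (n-1) := by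
      ext u
      simp only [Finset.mem_sdiff, Finset.mem_insert, Finset.mem_singleton, mem_im, not_or]
      constructor
      · rintro ⟨⟨i, _, h2, rfl⟩, h3, h4, h5⟩
        have k0 : i ≠ 0 := by rintro rfl; exact h3 rfl
        have k1 : i ≠ 1 := by rintro rfl; exact h4 rfl
        have k2 : i ≠ n - 1 := by rintro rfl; exact h5 rfl
        exact ⟨i, by omega, by omega, rfl⟩
      · rintro ⟨i, h1, h2, rfl⟩
        refine ⟨⟨i, by omega, by omega, rfl⟩, fun h' => ?_, fun h' => ?_, fun h' => ?_⟩
        all_goals have := h.2.1 _ _ (by omega) (by omega) h'; omega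
    rw [e] at hd0
    exact (h.pth.sub (s' := 2) (e' := n - 1) (by omega) (by omega)).not_cx hD hirr q (by omega) hd0
  · have := hd.unedge (W := im f 3 (n-1)) hD (hirr (f 0)) (hirr (f 1)) 
      ((h.2.2 0 1 (by omega) (by omega)).2 (Or.inl rfl)) (hY _ (by omega))
      (hY _ (by omega)) (by
        intro u hu
        obtain ⟨i, h1, h2, rfl⟩ := mem_im.1 hu
        exact hY _ (by omega)) (by
        intro u hu
        obtain ⟨i, h1, h2, rfl⟩ := mem_im.1 hu
        refine ⟨fun h' => ?_, fun h' => ?_⟩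
        · have := h.2.1 _ _ (by omega) (by omega) h'; omega
        · have := (h.2.2 _ _ (by omega) (by omega)).1 h'; omega) (by
        intro u hu
        obtain ⟨i, h1, h2, rfl⟩ := mem_im.1 hu
        refine ⟨fun h' => ?_, fun h' => ?_⟩
        · have := h.2.1 _ _ (by omega) (by omega) h'; omega
        · have := (h.2.2 _ _ (by omega) (by omega)).1 h'; omega)
    have := (h.pth.sub (s' := 3) (e' := n - 1) (by omega) (by omega)).lower hD hirr (n - 4) (by omega) this
    omega

theorem Cyc.good (hD : ∀ u v, D u v → D v u) (hirr : ∀ u, ¬ D u u) {f : ℕ → V} {n : ℕ} (h : Cyc D f n)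
    {F : Set V} (hF : ∀ i < n, f i ∈ F) (hiso : ∀ u ∈ F, ∀ v ∈ F, D u v → ∃ i < n, u = f i) 
    {d : ℤ} (hd : RegOn K F (quad D) d) : RegOn K (cn D F (f 0)) (quad D) (d - 1) := by
  have hn := h.1
  have h1 := h.lower hD hirr hF hd
  have h2 := (h.pth.sub (s' := 2) (e' := n - 1) (by omega) (by omega)).upper (K := K) hD hirr (n - 3) (by omega)
  refine (RegOn.isolatedSet hD ?_ h2).mono (le_refl _) (by omega)
  intro x hx hx2 u hu hxu
  obtain ⟨i, hi, rfl⟩ := hiso x hx.1 u hu.1 hxu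
  apply hx2
  refine mem_im.2 ⟨i, ?_, ?_, rfl⟩
  · by_contra hlt
    have : i = 0 ∨ i = 1 := by omega
    rcases this with rfl | rfl
    · exact hx.2.1 rfl
    · exact hx.2.2 ((h.2.2 _ _ (by omega) hi).2 (Or.inl rfl))
  · by_contra hlt
    have : i = n - 1 := by omega
    subst this
    exact hx.2.2 ((h.2.2 _ _ (by omega) hi).2 (by omega))

theorem Cyc.rot {f : ℕ → V} {n : ℕ} (h : Cyc D f n) (k : ℕ) : Cyc D (fun i => f ((i + k) % n)) n := by
  have hn := h.1
  have hlt : ∀ i, (i + k) % n < n := fun i => Nat.mod_lt _ (by omega)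
  have hinj : ∀ i j, i < n → j < n → (i + k) % n = (j + k) % n → i = j := by
    intro i j hi hj e
    have : i ≡ j [MOD n] := Nat.ModEq.add_right_cancel' k e
    exact Nat.ModEq.eq_of_lt_of_lt this hi hj
  have hsucc : ∀ a b, a < n → b < n → ((b = a + 1 ∨ (b = 0 ∧ a = n - 1)) ↔ (a + 1) % n = b) := by
    intro a b ha hb
    by_cases hc : a + 1 = n
    · rw [hc, Nat.mod_self]; omega
    · rw [Nat.mod_eq_of_lt (by omega)]; omega
  have hsucc2 : ∀ i j, i < n → j < n → ((((i + k) % n) + 1) % n = (j + k) % n ↔ (i + 1) % n = j) := by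
    intro i j hi hj
    rw [Nat.mod_add_mod]
    constructor
    · intro e
      have e' : (i + 1) + k ≡ j + k [MOD n] := by
        unfold Nat.ModEq; rw [← e]; congr 1; omega
      have : i + 1 ≡ j [MOD n] := Nat.ModEq.add_right_cancel' k e'
      unfold Nat.ModEq at this
      rwa [Nat.mod_eq_of_lt hj] at this
    · intro e
      have : i + 1 ≡ j [MOD n] := by unfold Nat.ModEq; rwa [Nat.mod_eq_of_lt hj]
      have := this.add_right k
      unfold Nat.ModEq at this
      rw [← this]; congr 1; omega
  refine ⟨hn, fun i j hi hj e => hinj i j hi hj (h.2.1 _ _ (hlt _) (hlt _) e), fun i j hi hj => ?_⟩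
  rw [h.2.2 _ _ (hlt _) (hlt _)]
  have a1 := hsucc _ _ (hlt i) (hlt j)
  have a2 := hsucc _ _ (hlt j) (hlt i)
  have b1 := hsucc i j hi hj
  have b2 := hsucc j i hj hi
  have c1 := hsucc2 i j hi hj
  have c2 := hsucc2 j i hj hi
  have d1 := a1.trans (c1.trans b1.symm)
  have d2 := a2.trans (c2.trans b2.symm)
  generalize (i + k) % n = p at d1 d2 ⊢
  generalize (j + k) % n = q at d1 d2 ⊢
  clear a1 a2 b1 b2 c1 c2 hsucc hsucc2 hlt hinj
  constructor
  · rintro (e | e | e | e)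
    · rcases d1.1 (Or.inl e) with e | e
      · exact Or.inl e
      · exact Or.inr (Or.inr (Or.inr e))
    · rcases d2.1 (Or.inl e) with e | e
      · exact Or.inr (Or.inl e)
      · exact Or.inr (Or.inr (Or.inl e))
    · rcases d2.1 (Or.inr e) with e | e
      · exact Or.inr (Or.inl e)
      · exact Or.inr (Or.inr (Or.inl e))
    · rcases d1.1 (Or.inr e) with e | e
      · exact Or.inl e
      · exact Or.inr (Or.inr (Or.inr e))
  · rintro (e | e | e | e)
    · rcases d1.2 (Or.inl e) with e | e
      · exact Or.inl e
      · exact Or.inr (Or.inr (Or.inr e))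
    · rcases d2.2 (Or.inl e) with e | e
      · exact Or.inr (Or.inl e)
      · exact Or.inr (Or.inr (Or.inl e))
    · rcases d2.2 (Or.inr e) with e | e
      · exact Or.inr (Or.inl e)
      · exact Or.inr (Or.inr (Or.inl e))
    · rcases d1.2 (Or.inr e) with e | e
      · exact Or.inl e
      · exact Or.inr (Or.inr (Or.inr e))

theorem Cyc.good' (hD : ∀ u v, D u v → D v u) (hirr : ∀ u, ¬ D u u) {f : ℕ → V} {n : ℕ} (h : Cyc D f n)
    {F : Set V} (hF : ∀ i < n, f i ∈ F) (hiso : ∀ u ∈ F, ∀ v ∈ F, D u v → ∃ i < n, u = f i) 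
    {d : ℤ} (hd : RegOn K F (quad D) d) (a : V) (ha : a ∈ F) (ha' : ∃ u ∈ F, D a u) : RegOn K (cn D F a) (quad D) (d - 1) := by
  obtain ⟨u, hu, hau⟩ := ha'
  obtain ⟨k, hk, rfl⟩ := hiso a ha u hu hau
  have hn := h.1
  have := (h.rot k).good (K := K) hD hirr (F := F) (fun i _ => hF _ (Nat.mod_lt _ (by omega))) (by
    intro u hu v hv huv
    obtain ⟨i, hi, rfl⟩ := hiso u hu v hv huv
    refine ⟨(i + (n - k)) % n, Nat.mod_lt _ (by omega), ?_⟩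
    beta_reduce
    congr 1
    rw [Nat.mod_add_mod]
    rw [show i + (n - k) + k = i + n by omega, Nat.add_mod_right, Nat.mod_eq_of_lt hi]) hd
  simpa [Nat.mod_eq_of_lt hk] using this

end Cyc2

end EIR


namespace EIR

section UniC

open SimpleGraph

variable {U : Type} {Γ : SimpleGraph U}

theorem mem_edges_getVert {u v : U} (p : Γ.Walk u v) (e : Sym2 U) :
    e ∈ p.edges ↔ ∃ i < p.length, e = s(p.getVert i, p.getVert (i+1)) := by
  induction p with
  | nil => simp
  | @cons a b c h p ih =>
    rw [Walk.edges_cons, List.mem_cons, ih]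
    constructor
    · rintro (rfl | ⟨i, hi, rfl⟩)
      · exact ⟨0, by simp, by simp⟩
      · exact ⟨i+1, by simpa using hi, by simp⟩
    · rintro ⟨i, hi, rfl⟩
      rcases i with _ | i
      · left; simp
      · right; exact ⟨i, by simpa using hi, by simp⟩

/-- connected in the complement of a vertex -/
def conn (Γ : SimpleGraph U) (v x y : U) : Prop := ∃ p : Γ.Walk x y, v ∉ p.support

theorem conn.symm {v x y : U} (h : conn Γ v x y) : conn Γ v y x := by
  obtain ⟨p, hp⟩ := h
  exact ⟨p.reverse, by simpa using hp⟩

theorem conn.trans {v x y z : U} (h : conn Γ v x y) (h' : conn Γ v y z) : conn Γ v x z := by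
  obtain ⟨p, hp⟩ := h
  obtain ⟨q, hq⟩ := h'
  exact ⟨p.append q, by rw [Walk.mem_support_append_iff]; tauto⟩

theorem conn.refl {v x : U} (h : v ≠ x) : conn Γ v x x := ⟨.nil, by simpa using h⟩

theorem conn.ne {v x y : U} (h : conn Γ v x y) : v ≠ x := by
  obtain ⟨p, hp⟩ := h
  rintro rfl; exact hp p.start_mem_support

variable {z0 : U} {c : Γ.Walk z0 z0}

theorem chordless
    (huniq : ∀ (w : U) (c' : Γ.Walk w w), c'.IsCycle → { e | e ∈ c'.edges } = { e | e ∈ c.edges })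
    {u v : U} (hu : u ∈ c.support) (hv : v ∈ c.support) (h : Γ.Adj u v) : s(u, v) ∈ c.edges := by
  classical
  by_contra hne
  have hrot : v ∈ (c.rotate u hu).support := by
    rw [Walk.mem_support_rotate_iff]; exact hv
  set p := (c.rotate u hu).takeUntil v hrot with hp
  have hed : ∀ e, e ∈ p.reverse.bypass.edges → e ∈ c.edges := by
    intro e he
    have h1 := Walk.edges_bypass_subset_edges _ he
    rw [Walk.edges_reverse, List.mem_reverse] at h1
    have h2 := Walk.edges_takeUntil_subset_edges _ _ h1
    exact (c.rotate_edges u hu).mem_iff.1 h2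
  have hcyc : (Walk.cons h p.reverse.bypass).IsCycle := by
    rw [Walk.cons_isCycle_iff]
    exact ⟨Walk.bypass_isPath _, fun h' => hne (hed _ h')⟩
  have := huniq _ _ hcyc
  have h1 : s(u, v) ∈ { e | e ∈ c.edges } := by
    rw [← this]; simp
  exact hne h1

theorem sep
    (huniq : ∀ (w : U) (c' : Γ.Walk w w), c'.IsCycle → { e | e ∈ c'.edges } = { e | e ∈ c.edges })
    {v u1 u2 : U} (hv : v ∉ c.support) (hne : u1 ≠ u2) (h1 : Γ.Adj v u1) (h2 : Γ.Adj v u2) :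
    ¬ conn Γ v u1 u2 := by
  classical
  rintro ⟨p, hp⟩
  have hp' : v ∉ p.bypass.support := fun h => hp (Walk.support_bypass_subset_support _ h)
  have hpath : (p.bypass.concat h2.symm).IsPath := by
    rw [Walk.concat_isPath_iff]
    exact ⟨Walk.bypass_isPath _, hp'⟩
  have hcyc : (Walk.cons h1 (p.bypass.concat h2.symm)).IsCycle := by
    rw [Walk.cons_isCycle_iff]
    refine ⟨hpath, ?_⟩
    rw [Walk.edges_concat, List.concat_eq_append, List.mem_append, List.mem_singleton]
    rintro (h | h)
    · exact hp' (Walk.fst_mem_support_of_mem_edges _ h)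
    · rw [Sym2.eq_iff] at h
      rcases h with h | h
      · exact h2.ne h.1
      · exact hne h.2
  have := huniq _ _ hcyc
  have h1' : s(v, u1) ∈ { e | e ∈ c.edges } := by
    rw [← this]; simp
  exact hv (Walk.fst_mem_support_of_mem_edges _ h1')

theorem zconn {v z1 z2 : U} (hv : v ∉ c.support) (h1 : z1 ∈ c.support) (h2 : z2 ∈ c.support) : conn Γ v z1 z2 := by
  classical
  have hrot : z2 ∈ (c.rotate z1 h1).support := by
    rw [Walk.mem_support_rotate_iff]; exact h2
  refine ⟨(c.rotate z1 h1).takeUntil z2 hrot, fun h => hv ?_⟩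
  have := Walk.support_takeUntil_subset_support _ _ h
  rwa [Walk.mem_support_rotate_iff] at this

theorem elim
    (huniq : ∀ (w : U) (c' : Γ.Walk w w), c'.IsCycle → { e | e ∈ c'.edges } = { e | e ∈ c.edges })
    (S : Finset U) (hS : ∃ s ∈ S, s ∉ c.support) : ∃ v ∈ S, v ∉ c.support ∧
    ∀ u1 ∈ S, ∀ u2 ∈ S, Γ.Adj v u1 → Γ.Adj v u2 → u1 = u2 := by
  classical
  by_contra hcon
  push Not at hcon
  have main : ∀ n, ∀ u ∈ S, ∀ v, v ∉ c.support → Γ.Adj u v → (S.filter (fun y => conn Γ v u y)).card = n → 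
      (∀ z ∈ c.support, ¬ conn Γ v u z) → False := by
    intro n
    induction n using Nat.strong_induction_on with
    | _ n ih =>
    intro u hu v hv huv hn hz
    have huc : u ∉ c.support := fun h => hz u h (conn.refl huv.ne.symm)
    obtain ⟨u1, hu1, u2, hu2, a1, a2, hne⟩ := hcon u hu huc
    obtain ⟨u', hu', a', hne'⟩ : ∃ u' ∈ S, Γ.Adj u u' ∧ u' ≠ v := by
      by_cases h : u1 = v
      · exact ⟨u2, hu2, a2, fun h' => hne (h.trans h'.symm)⟩
      · exact ⟨u1, hu1, a1, h⟩
    have hsub : ∀ y, conn Γ u u' y → conn Γ v u y := by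
      rintro y ⟨p, hp⟩
      have hvp : v ∉ p.support := by
        intro h
        refine sep huniq huc hne' a' huv ⟨p.takeUntil v h, fun h' => hp (Walk.support_takeUntil_subset_support _ _ h')⟩
      refine ⟨Walk.cons a' p, ?_⟩
      rw [Walk.support_cons, List.mem_cons, not_or]
      exact ⟨huv.ne.symm, hvp⟩
    refine ih _ ?_ u' hu' u huc a'.symm rfl (fun z hz' h => hz z hz' (hsub z h))
    rw [← hn]
    apply Finset.card_lt_card
    rw [Finset.ssubset_iff_of_subset]
    · refine ⟨u, Finset.mem_filter.2 ⟨hu, conn.refl huv.ne.symm⟩, fun h => ?_⟩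
      exact (Finset.mem_filter.1 h).2.symm.ne rfl
    · intro y hy
      rw [Finset.mem_filter] at hy ⊢
      exact ⟨hy.1, hsub y hy.2⟩
  obtain ⟨v, hvS, hvc⟩ := hS
  obtain ⟨u1, hu1, u2, hu2, a1, a2, hne⟩ := hcon v hvS hvc
  by_cases h1 : ∀ z ∈ c.support, ¬ conn Γ v u1 z
  · exact main _ u1 hu1 v hvc a1.symm rfl h1
  by_cases h2 : ∀ z ∈ c.support, ¬ conn Γ v u2 z
  · exact main _ u2 hu2 v hvc a2.symm rfl h2
  push Not at h1 h2
  obtain ⟨z1, hz1, c1⟩ := h1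
  obtain ⟨z2, hz2, c2⟩ := h2
  exact sep huniq hvc hne a1 a2 (c1.trans ((zconn hvc hz1 hz2).trans c2.symm))

theorem cyc_exists (hc : c.IsCycle)
    (huniq : ∀ (w : U) (c' : Γ.Walk w w), c'.IsCycle → { e | e ∈ c'.edges } = { e | e ∈ c.edges }) : ∃ (n : ℕ) (f : ℕ → U), 3 ≤ n ∧ (∀ i j, i < n → j < n → f i = f j → i = j) ∧
   (∀ i j, i < n → j < n → (Γ.Adj (f i) (f j) ↔ (j = i + 1 ∨ i = j + 1 ∨ (i = 0 ∧ j = n - 1) ∨ (j = 0 ∧ i = n - 1)))) ∧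
   (∀ u, u ∈ c.support ↔ ∃ i < n, u = f i) := by
  have h3 := hc.three_le_length
  have hlast : c.getVert c.length = c.getVert 0 := by simp
  have hinj : ∀ i j, i < c.length → j < c.length → c.getVert i = c.getVert j → i = j := by
    intro i j hi hj h
    exact hc.getVert_injOn' (by simp; omega) (by simp; omega) h
  have hadj : ∀ i < c.length, Γ.Adj (c.getVert i) (c.getVert (i+1)) := fun i hi => c.adj_getVert_succ hi
  refine ⟨c.length, c.getVert, h3, hinj, ?_, ?_⟩
  · intro i j hi hj
    constructor
    · intro h
      have := chordless huniq (c.getVert_mem_support i) (c.getVert_mem_support j) h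
      obtain ⟨k, hk, e⟩ := (mem_edges_getVert _ _).1 this
      have hk1 : ∃ k', k' < c.length ∧ c.getVert (k+1) = c.getVert k' ∧ (k' = k + 1 ∨ (k' = 0 ∧ k = c.length - 1)) := by
        by_cases hkk : k + 1 < c.length
        · exact ⟨k+1, hkk, rfl, Or.inl rfl⟩
        · refine ⟨0, by omega, ?_, Or.inr ⟨rfl, by omega⟩⟩
          rw [show k + 1 = c.length by omega]; exact hlast
      obtain ⟨k', hk', e', e''⟩ := hk1
      rw [e', Sym2.eq_iff] at e
      rcases e with ⟨x, y⟩ | ⟨x, y⟩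
      · have := hinj _ _ hi hk x
        have := hinj _ _ hj hk' y
        omega
      · have := hinj _ _ hi hk' x
        have := hinj _ _ hj hk y
        omega
    · rintro (h | h | h | h)
      · subst h; exact hadj i hi
      · subst h; exact (hadj j hj).symm
      · have := hadj (c.length - 1) (by omega)
        rw [show c.length - 1 + 1 = c.length by omega, hlast] at this
        rw [h.1, h.2]; exact this.symm
      · have := hadj (c.length - 1) (by omega)
        rw [show c.length - 1 + 1 = c.length by omega, hlast] at this
        rw [h.1, h.2]; exact this
  · intro u
    rw [Walk.mem_support_iff_exists_getVert]
    constructor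
    · rintro ⟨k, rfl, hk⟩
      by_cases hkk : k < c.length
      · exact ⟨k, hkk, rfl⟩
      · refine ⟨0, by omega, ?_⟩
        rw [show k = c.length by omega]; exact hlast
    · rintro ⟨k, hk, rfl⟩
      exact ⟨k, rfl, by omega⟩

end UniC

end EIR


namespace EIR

section Str

variable {V : Type} [LinearOrder V] {K : Type} [Field K] {A : V → V → Prop}

/-- good weight function on `S` -/
def GW (A : V → V → Prop) (X Z : Set V) (S : Finset V) (w : V → ℕ) : Prop :=
  Set.InjOn w S ∧ (∀ x ∈ S, x ∈ X → ∀ z ∈ S, z ∉ X → w x < w z) ∧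
  (∀ x ∈ S, x ∈ Z → ∀ z ∈ S, z ∉ X → z ∉ Z → w x < w z) ∧
  (∀ v ∈ S, v ∉ X → v ∉ Z → ∀ u1 ∈ S, ∀ u2 ∈ S, u1 ∉ X → u2 ∉ X → A v u1 → A v u2 → w u1 < w v → w u2 < w v → u1 = u2)

theorem GW.step (hirr : ∀ u, ¬ A u u) {X Z : Set V} {S : Finset V} {w : V → ℕ} {v : V} (hv : v ∈ S) (h : GW A X Z (S.erase v) w)
    (h1 : v ∈ X → ∀ z ∈ S, z ∈ X) (h2 : v ∈ Z → ∀ z ∈ S, z ∉ X → z ∈ Z)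
    (h3 : v ∉ X → v ∉ Z → ∀ u1 ∈ S, ∀ u2 ∈ S, u1 ∉ X → u2 ∉ X → A v u1 → A v u2 → u1 = u2) :
    ∃ w', GW A X Z S w' := by
  classical
  let N := S.sup w + 1
  have hN : ∀ u ∈ S, w u < N := fun u hu => Nat.lt_succ_of_le (Finset.le_sup (f := w) hu)
  refine ⟨Function.update w v N, ?_, ?_, ?_, ?_⟩
  · intro a ha b hb hab
    by_cases hav : a = v <;> by_cases hbv : b = v
    · rw [hav, hbv]
    · subst hav
      rw [Function.update_self, Function.update_of_ne hbv] at hab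
      have := hN b hb; omega
    · subst hbv
      rw [Function.update_self, Function.update_of_ne hav] at hab
      have := hN a ha; omega
    · rw [Function.update_of_ne hav, Function.update_of_ne hbv] at hab
      exact h.1 (by simp [hav]; exact ha) (by simp [hbv]; exact hb) hab
  · intro x hx hxX z hz hzX
    have hxz : x ≠ z := fun e => hzX (e ▸ hxX)
    by_cases hxv : x = v
    · subst hxv; exact absurd (h1 hxX z hz) hzX
    rw [Function.update_of_ne hxv]
    by_cases hzv : z = v
    · subst hzv
      rw [Function.update_self]; exact hN x hx
    · rw [Function.update_of_ne hzv]
      exact h.2.1 x (Finset.mem_erase.2 ⟨hxv, hx⟩) hxX z (Finset.mem_erase.2 ⟨hzv, hz⟩) hzX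
  · intro x hx hxX z hz hzX hzZ
    by_cases hxv : x = v
    · subst hxv; exact absurd (h2 hxX z hz hzX) hzZ
    rw [Function.update_of_ne hxv]
    by_cases hzv : z = v
    · subst hzv
      rw [Function.update_self]; exact hN x hx
    · rw [Function.update_of_ne hzv]
      exact h.2.2.1 x (Finset.mem_erase.2 ⟨hxv, hx⟩) hxX z (Finset.mem_erase.2 ⟨hzv, hz⟩) hzX hzZ
  · intro y hy hyX hyZ u1 hu1 u2 hu2 hX1 hX2 a1 a2 l1 l2
    by_cases hyv : y = v
    · subst hyv; exact h3 hyX hyZ u1 hu1 u2 hu2 hX1 hX2 a1 a2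
    rw [Function.update_of_ne hyv] at l1 l2
    have n1 : u1 ≠ v := by
      rintro rfl; rw [Function.update_self] at l1
      have := hN y hy; omega
    have n2 : u2 ≠ v := by
      rintro rfl; rw [Function.update_self] at l2
      have := hN y hy; omega
    rw [Function.update_of_ne n1] at l1
    rw [Function.update_of_ne n2] at l2
    exact h.2.2.2 y (Finset.mem_erase.2 ⟨hyv, hy⟩) hyX hyZ u1 (Finset.mem_erase.2 ⟨n1, hu1⟩) u2 (Finset.mem_erase.2 ⟨n2, hu2⟩) hX1 hX2 a1 a2 l1 l2

theorem GW.exists (hirr : ∀ u, ¬ A u u) {X Z : Set V}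
    (hel : ∀ S : Finset V, (∀ s ∈ S, s ∉ X) → (∃ s ∈ S, s ∉ Z) → ∃ v ∈ S, v ∉ Z ∧
      ∀ u1 ∈ S, ∀ u2 ∈ S, A v u1 → A v u2 → u1 = u2) (n : ℕ) : ∀ S : Finset V, S.card = n → ∃ w, GW A X Z S w := by
  classical
  induction n with
  | zero =>
    intro S hS
    rw [Finset.card_eq_zero] at hS
    subst hS
    exact ⟨fun _ => 0, by simp [GW]⟩
  | succ n ih =>
    intro S hS
    by_cases h1 : ∃ s ∈ S.filter (fun s => s ∉ X), s ∉ Z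
    · obtain ⟨v, hv, hvZ, hv2⟩ := hel _ (fun s hs => (Finset.mem_filter.1 hs).2) h1
      rw [Finset.mem_filter] at hv
      obtain ⟨w, hw⟩ := ih (S.erase v) (by rw [Finset.card_erase_of_mem hv.1]; omega)
      refine hw.step hirr hv.1 (fun h => absurd h hv.2) (fun h => absurd h hvZ) ?_
      intro _ _ u1 hu1 u2 hu2 hX1 hX2 
      exact hv2 u1 (Finset.mem_filter.2 ⟨hu1, hX1⟩) u2 (Finset.mem_filter.2 ⟨hu2, hX2⟩)
    by_cases h2 : ∃ s ∈ S, s ∉ X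
    · obtain ⟨v, hv, hvX⟩ := h2
      have hZ : ∀ z ∈ S, z ∉ X → z ∈ Z := by
        intro z hz hzX
        by_contra h
        exact h1 ⟨z, Finset.mem_filter.2 ⟨hz, hzX⟩, h⟩
      obtain ⟨w, hw⟩ := ih (S.erase v) (by rw [Finset.card_erase_of_mem hv]; omega)
      exact hw.step hirr hv (fun h => absurd h hvX) (fun _ => hZ) (fun _ h => absurd (hZ v hv hvX) h)
    · push Not at h2
      obtain ⟨v, hv⟩ : S.Nonempty := by rw [← Finset.card_pos]; omega
      obtain ⟨w, hw⟩ := ih (S.erase v) (by rw [Finset.card_erase_of_mem hv]; omega)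
      exact hw.step hirr hv (fun _ => h2) (fun _ z hz h => absurd (h2 z hz) h) (fun h => absurd (h2 v hv) h)

theorem cyc_leaf (hA : ∀ u v, A u v → A v u) {f : ℕ → V} {n : ℕ} (h : Cyc A f n) {F : Set V} (h0 : f 0 ∉ F)
    (hE : ∀ u ∈ F, ∀ v ∈ F, A u v → ∃ i < n, u = f i) (hex : ∃ u ∈ F, ∃ v ∈ F, A u v) :
    ∃ x ∈ F, ∃ g ∈ F, A x g ∧ (∀ u ∈ F, A x u → u = g) ∧
        (∀ c ∈ F, A g c → c ≠ x → ∀ u ∈ F, A g u → u = x ∨ u = c) := by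
  classical
  have hn := h.1
  have hP : ∃ i, i + 1 < n ∧ f i ∈ F ∧ f (i+1) ∈ F := by
    obtain ⟨u, hu, v, hv, a⟩ := hex
    obtain ⟨i, hi, rfl⟩ := hE u hu v hv a
    obtain ⟨j, hj, rfl⟩ := hE v hv _ hu (hA _ _ a)
    have hi0 : i ≠ 0 := by rintro rfl; exact h0 hu
    have hj0 : j ≠ 0 := by rintro rfl; exact h0 hv
    rcases (h.2.2 i j hi hj).1 a with e | e | e | e
    · subst e; exact ⟨i, hj, hu, hv⟩
    · subst e; exact ⟨j, hi, hv, hu⟩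
    · exact absurd e.1 hi0
    · exact absurd e.1 hj0
  obtain ⟨h1, h2, h3⟩ := Nat.find_spec hP
  have hmin : ∀ j, j < Nat.find hP → ¬ (j + 1 < n ∧ f j ∈ F ∧ f (j+1) ∈ F) := fun j hj => Nat.find_min hP hj
  generalize Nat.find hP = i at *
  have hi0 : i ≠ 0 := by rintro rfl; exact h0 h2
  have hg : ∀ u ∈ F, A (f (i+1)) u → u = f i ∨ u = f (i+2) := by
    intro u hu a
    obtain ⟨j, hj, rfl⟩ := hE u hu _ h3 (hA _ _ a)
    have hj0 : j ≠ 0 := by rintro rfl; exact h0 hu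
    rcases (h.2.2 (i+1) j h1 hj).1 a with e | e | e | e
    · right; rw [e]
    · left; congr 1; omega
    · omega
    · omega
  refine ⟨f i, h2, f (i+1), h3, (h.2.2 i (i+1) (by omega) h1).2 (Or.inl rfl), ?_, ?_⟩
  · intro u hu a
    obtain ⟨j, hj, rfl⟩ := hE u hu _ h2 (hA _ _ a)
    have hj0 : j ≠ 0 := by rintro rfl; exact h0 hu
    rcases (h.2.2 i j (by omega) hj).1 a with e | e | e | e
    · rw [e]
    · exfalso
      subst e
      exact hmin j (by omega) ⟨by omega, hu, h2⟩
    · omega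
    · omega
  · intro c hc a hcx u hu a'
    rcases hg c hc a with e | e
    · exact absurd e hcx
    · rw [e]; exact hg u hu a'

theorem hstr_of (hA : ∀ u v, A u v → A v u) (hirr : ∀ u, ¬ A u u) {f : ℕ → V} {n : ℕ} (h : Cyc A f n) {X : Set V} {S : Finset V} {w : V → ℕ}
    (hw : GW A X {u | ∃ i < n, u = f i} S w) : ∀ F ⊆ (S : Set V), F ∩ X = ∅ → 
      (∃ x ∈ F, ∃ g ∈ F, A x g ∧ (∀ u ∈ F, A x u → u = g) ∧
        (∀ c ∈ F, A g c → c ≠ x → (w c < w x ∨ ∀ u ∈ F, A g u → u = x ∨ u = c))) ∨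
      (∀ d : ℤ, RegOn K F (quad A) d → ∀ a ∈ F, (∃ u ∈ F, A a u) → RegOn K (cn A F a) (quad A) (d - 1)) := by
  classical
  intro F hF hFX
  have hX : ∀ u ∈ F, u ∉ X := fun u hu hx => by
    have : u ∈ F ∩ X := ⟨hu, hx⟩
    rw [hFX] at this; exact this
  set Z : Set V := {u | ∃ i < n, u = f i} with hZ
  by_cases h1 : ∃ x ∈ S.filter (fun x => x ∈ F ∧ x ∉ Z ∧ ∃ u ∈ F, A x u), True
  · left
    obtain ⟨y, hy, -⟩ := h1
    obtain ⟨x, hx, hmax⟩ := Finset.exists_max_image _ w ⟨y, hy⟩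
    rw [Finset.mem_filter] at hx
    obtain ⟨hxS, hxF, hxZ, g, hgF, hxg⟩ := hx
    have low : ∀ u ∈ F, u ≠ x → (∃ v ∈ F, A u v) → w u < w x := by
      intro u hu hux hv
      by_cases huZ : u ∈ Z
      · exact hw.2.2.1 u (hF hu) huZ x hxS (hX x hxF) hxZ
      · have := hmax u (Finset.mem_filter.2 ⟨hF hu, hu, huZ, hv⟩)
        exact lt_of_le_of_ne this (fun e => hux (hw.1 (hF hu) hxS e))
    have nx : ∀ u, A x u → u ≠ x := fun u a e => hirr x (by rw [e] at a; exact a)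
    refine ⟨x, hxF, g, hgF, hxg, ?_, ?_⟩
    · intro u hu a
      exact hw.2.2.2 x hxS (hX x hxF) hxZ u (hF hu) g (hF hgF) (hX u hu) (hX g hgF) a hxg
        (low u hu (nx u a) ⟨x, hxF, hA _ _ a⟩) (low g hgF (nx g hxg) ⟨x, hxF, hA _ _ hxg⟩)
    · intro c hc a hcx
      exact Or.inl (low c hc hcx ⟨g, hgF, hA _ _ a⟩)
  · have hE : ∀ u ∈ F, ∀ v ∈ F, A u v → u ∈ Z := by
      intro u hu v hv a
      by_contra hc
      exact h1 ⟨u, Finset.mem_filter.2 ⟨hF hu, hu, hc, v, hv, a⟩, trivial⟩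
    by_cases h2 : ∃ u ∈ F, ∃ v ∈ F, A u v
    · by_cases h3 : ∀ i < n, f i ∈ F
      · right
        intro d hd a ha ha'
        exact h.good' hA hirr h3 hE hd a ha ha'
      · left
        push Not at h3
        obtain ⟨k, hk, hkF⟩ := h3
        obtain ⟨x, hx, g, hg, p, q, s⟩ := cyc_leaf hA (h.rot k) (F := F) (by
          simpa [Nat.mod_eq_of_lt hk] using hkF) (by
          intro u hu v hv a
          obtain ⟨i, hi, rfl⟩ := hE u hu v hv a
          refine ⟨(i + (n - k)) % n, Nat.mod_lt _ (by omega), ?_⟩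
          show f i = f _
          congr 1
          rw [Nat.mod_add_mod, show i + (n - k) + k = i + n by omega, Nat.add_mod_right, Nat.mod_eq_of_lt hi]) h2
        exact ⟨x, hx, g, hg, p, q, fun c hc a hcx => Or.inr (s c hc a hcx)⟩
    · right
      intro d hd a ha ⟨u, hu, hau⟩
      exact absurd ⟨a, ha, u, hu, hau⟩ h2

open EdgeIdealReg in
theorem structure_main (G : SimpleGraph V) (Hset T : Set V) (huni : Unicyclic (G.induce Hset))
    (hatt : CliqueAttachment G Hset T) (S : Finset V) (hS : ∀ u, u ∈ S ↔ ∃ v, G.Adj u v) :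
    ∃ (X : Set V) (w : V → ℕ), Set.InjOn w S ∧ ∀ F : Set V, F = S → Psi K G.Adj w F := by
  classical
  obtain ⟨z0, c, hc, huniq⟩ := huni
  have huniq' : ∀ (w : Hset) (c' : (G.induce Hset).Walk w w), c'.IsCycle → { e | e ∈ c'.edges } = { e | e ∈ c.edges } := huniq
  obtain ⟨n, f, hn, hinj, hadj, hsup⟩ := cyc_exists hc huniq'
  let f' : ℕ → V := fun i => (f i : V)
  have hcyc : Cyc G.Adj f' n := by
    refine ⟨hn, fun i j hi hj e => hinj i j hi hj (Subtype.ext e), fun i j hi hj => ?_⟩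
    rw [← hadj i j hi hj]; rfl
  let X : Set V := {x | x ∉ Hset ∧ ∃ i, x ∈ hatt.C i ∧ 3 ≤ (hatt.C i).card}
  let Z : Set V := {u | ∃ i < n, u = f' i}
  -- privates
  have priv : ∀ x, x ∉ Hset → ∀ i j, x ∈ hatt.C i → x ∈ hatt.C j → i = j := by
    intro x hx i j hi hj
    by_contra hne
    have := hatt.pairwise_inter i j hne ⟨hi, hj⟩
    rw [Set.mem_singleton_iff] at this
    exact hx (this ▸ hatt.T_sub (hatt.a_mem_T i))
  have nbr : ∀ x, x ∉ Hset → ∀ i, x ∈ hatt.C i → ∀ u, G.Adj x u ↔ (u ≠ x ∧ u ∈ hatt.C i) := by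
    intro x hx i hi u
    constructor
    · intro a
      refine ⟨a.ne.symm, ?_⟩
      rcases hatt.edges_sub x u a with h | ⟨j, hj, hu⟩
      · exact absurd h.1 hx
      · rwa [priv x hx i j hi hj]
    · rintro ⟨h1, h2⟩
      exact hatt.clique i hi h2 h1.symm
  have hel : ∀ S : Finset V, (∀ s ∈ S, s ∉ X) → (∃ s ∈ S, s ∉ Z) → ∃ v ∈ S, v ∉ Z ∧
      ∀ u1 ∈ S, ∀ u2 ∈ S, G.Adj v u1 → G.Adj v u2 → u1 = u2 := by
    intro S hSX hSZ
    by_cases hH : ∃ s ∈ S, s ∉ Hset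
    · obtain ⟨s, hs, hsH⟩ := hH
      refine ⟨s, hs, ?_, ?_⟩
      · rintro ⟨i, hi, e⟩
        exact hsH (e ▸ (f i).2)
      intro u1 _ u2 _ a1 a2
      have hcov : s ∈ Hset ∪ (⋃ i, (hatt.C i : Set V)) := by rw [hatt.cover]; trivial
      rcases hcov with h | h
      · exact absurd h hsH
      rw [Set.mem_iUnion] at h
      obtain ⟨i, hi⟩ := h
      have hi : s ∈ hatt.C i := hi
      have hcard : (hatt.C i).card < 3 := by
        by_contra h
        exact hSX s hs ⟨hsH, i, hi, by omega⟩
      rw [nbr s hsH i hi] at a1 a2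
      by_contra hne
      have : ({s, u1, u2} : Finset V) ⊆ hatt.C i := by
        intro y hy
        simp only [Finset.mem_insert, Finset.mem_singleton] at hy
        rcases hy with rfl | rfl | rfl
        exacts [hi, a1.2, a2.2]
      have := Finset.card_le_card this
      rw [Finset.card_eq_three.2 ⟨s, u1, u2, a1.1.symm, a2.1.symm, hne, rfl⟩] at this
      omega
    · push Not at hH
      obtain ⟨s, hs, hsZ⟩ := hSZ
      have key := elim huniq' (S.subtype (· ∈ Hset)) ⟨⟨s, hH s hs⟩, by simpa using hs, by
        rw [hsup]
        rintro ⟨i, hi, e⟩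
        exact hsZ ⟨i, hi, congrArg Subtype.val e⟩⟩
      obtain ⟨v, hv, hvc, hv2⟩ := key
      refine ⟨v, by simpa using hv, ?_, ?_⟩
      · rintro ⟨i, hi, e⟩
        exact hvc ((hsup v).2 ⟨i, hi, Subtype.ext e⟩)
      · intro u1 h1 u2 h2 a1 a2
        exact congrArg Subtype.val (hv2 ⟨u1, hH u1 h1⟩ (by simpa using h1) ⟨u2, hH u2 h2⟩ (by simpa using h2) a1 a2)
  have hirr : ∀ u, ¬ G.Adj u u := fun u => G.irrefl
  have hA : ∀ u v, G.Adj u v → G.Adj v u := fun u v h => h.symm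
  obtain ⟨w, hw⟩ := GW.exists (A := G.Adj) hirr hel S.card S rfl
  refine ⟨X, w, hw.1, ?_⟩
  rintro F rfl
  refine psi_main hA hirr w S X S.finite_toSet (fun x hx hxX z hz => hw.2.1 x hx hxX z hz) (hstr_of hA hirr hcyc hw) _ S subset_rfl rfl ?_
  rintro x hx ⟨hxH, i, hi, hcard⟩
  obtain ⟨x', hx', hne⟩ : ∃ x' ∈ hatt.C i, x' ∉ ({x, hatt.a i} : Finset V) := by
    by_contra hcon
    push Not at hcon
    have := Finset.card_le_card (s := hatt.C i) (t := {x, hatt.a i}) hcon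
    have := Finset.card_le_two (a := x) (b := hatt.a i)
    omega
  simp only [Finset.mem_insert, Finset.mem_singleton, not_or] at hne
  have hx'H : x' ∉ Hset := by
    intro h
    have : x' ∈ (hatt.C i : Set V) ∩ Hset := ⟨hx', h⟩
    rw [hatt.inter_H] at this
    exact hne.2 this
  have hadj' : G.Adj x x' := (nbr x hxH i hi x').2 ⟨hne.1, hx'⟩
  refine ⟨x', (hS x').2 ⟨x, hadj'.symm⟩, hadj', fun u h1 h2 => ?_⟩
  rw [nbr x hxH i hi, nbr x' hx'H i hx']
  tauto

end Str

end EIR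


namespace EIR

section Chains

open MvPolynomial

variable {V : Type} [LinearOrder V] {K : Type} [Field K]

open Classical in
/-- keep the monomials satisfying `Q` -/
noncomputable def flt (Q : (V →₀ ℕ) → Prop) (p : MvPolynomial V K) : MvPolynomial V K :=
  ∑ μ ∈ p.support.filter Q, monomial μ (coeff μ p)

open Classical in
theorem coeff_flt (Q : (V →₀ ℕ) → Prop) (p : MvPolynomial V K) (μ : V →₀ ℕ) :
    coeff μ (flt Q p) = if Q μ then coeff μ p else 0 := by
  rw [flt, coeff_sum]
  simp only [coeff_monomial]
  rw [Finset.sum_ite_eq']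
  simp only [Finset.mem_filter, mem_support_iff]
  by_cases h : Q μ <;> by_cases h' : coeff μ p = 0 <;> simp [h, h']

theorem flt_mul {Q Q' : (V →₀ ℕ) → Prop} {q : MvPolynomial V K} (h : ∀ α ∈ q.support, ∀ β, (Q' (α + β) ↔ Q β))
    (p : MvPolynomial V K) : flt Q' (q * p) = q * flt Q p := by
  classical
  ext μ
  rw [coeff_flt, coeff_mul, coeff_mul]
  split_ifs with hQ
  · refine Finset.sum_congr rfl fun x hx => ?_
    rw [Finset.HasAntidiagonal.mem_antidiagonal] at hx
    by_cases hα : x.1 ∈ q.support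
    · rw [coeff_flt, if_pos ((h _ hα _).1 (hx ▸ hQ))]
    · rw [mem_support_iff, not_not] at hα
      rw [hα]; simp
  · symm
    refine Finset.sum_eq_zero fun x hx => ?_
    rw [Finset.HasAntidiagonal.mem_antidiagonal] at hx
    by_cases hα : x.1 ∈ q.support
    · rw [coeff_flt, if_neg (fun h' => hQ (hx ▸ (h _ hα _).2 h'))]; simp
    · rw [mem_support_iff, not_not] at hα
      rw [hα]; simp

theorem flt_sum {ι : Type} (Q : (V →₀ ℕ) → Prop) (s : Finset ι) (f : ι → MvPolynomial V K) :
    flt Q (∑ i ∈ s, f i) = ∑ i ∈ s, flt Q (f i) := by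
  classical
  ext μ
  rw [coeff_flt, coeff_sum, coeff_sum]
  simp only [coeff_flt]
  split_ifs with h <;> simp

theorem flt_eq {Q : (V →₀ ℕ) → Prop} {p : MvPolynomial V K} (h : ∀ μ ∈ p.support, Q μ) : flt Q p = p := by
  classical
  ext μ
  rw [coeff_flt]
  split_ifs with h'
  · rfl
  · by_contra hc
    exact h' (h μ (mem_support_iff.2 (Ne.symm hc)))

theorem mem_flt {Q : (V →₀ ℕ) → Prop} {p : MvPolynomial V K} {μ : V →₀ ℕ} (h : μ ∈ (flt Q p).support) : Q μ ∧ μ ∈ p.support := by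
  classical
  rw [mem_support_iff, coeff_flt] at h
  by_cases hQ : Q μ
  · rw [if_pos hQ] at h; exact ⟨hQ, mem_support_iff.2 h⟩
  · rw [if_neg hQ] at h; exact absurd rfl h


variable (K) in
noncomputable def bd {M : Type} [AddCommGroup M] [Module (MvPolynomial V K) M] (B : Finset V) (z : Finset V → M) (τ : Finset V) : M :=
  ∑ v ∈ B \ τ, (C (sgn K v τ) * X v : MvPolynomial V K) • z (insert v τ)

theorem bd_map {M M' : Type} [AddCommGroup M] [Module (MvPolynomial V K) M] [AddCommGroup M'] [Module (MvPolynomial V K) M']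
    (B : Finset V) (L : M →ₗ[MvPolynomial V K] M') (z : Finset V → M) (τ : Finset V) :
    bd K B (fun σ => L (z σ)) τ = L (bd K B z τ) := by
  simp [bd]

theorem bd_sub {M : Type} [AddCommGroup M] [Module (MvPolynomial V K) M] (B : Finset V) (z z' : Finset V → M) (τ : Finset V) :
    bd K B (fun σ => z σ - z' σ) τ = bd K B z τ - bd K B z' τ := by
  simp [bd, smul_sub, Finset.sum_sub_distrib]

theorem bd_congr {M : Type} [AddCommGroup M] [Module (MvPolynomial V K) M] {B : Finset V} {z z' : Finset V → M} {τ : Finset V}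
    {i : ℕ} (hτ : τ ⊆ B) (hi : τ.card + 1 = i) (h : ∀ σ ⊆ B, σ.card = i → z σ = z' σ) : bd K B z τ = bd K B z' τ := by
  unfold bd
  refine Finset.sum_congr rfl fun v hv => ?_
  rw [Finset.mem_sdiff] at hv
  rw [h _ (Finset.insert_subset hv.1 hτ) (by rw [Finset.card_insert_of_notMem hv.2]; exact hi)]

theorem bd_mem {M : Type} [AddCommGroup M] [Module (MvPolynomial V K) M] {B : Finset V} {z : Finset V → M} {τ : Finset V}
    {i : ℕ} (hτ : τ ⊆ B) (hi : τ.card + 1 = i) (N : Submodule (MvPolynomial V K) M) (h : ∀ σ ⊆ B, σ.card = i → z σ ∈ N) : bd K B z τ ∈ N := by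
  unfold bd
  refine N.sum_mem fun v hv => N.smul_mem _ ?_
  rw [Finset.mem_sdiff] at hv
  exact h _ (Finset.insert_subset hv.1 hτ) (by rw [Finset.card_insert_of_notMem hv.2]; exact hi)

theorem bd_apply {n : ℕ} (B : Finset V) (z : Finset V → Fin n → MvPolynomial V K) (τ : Finset V) (k : Fin n) :
    bd K B z τ k = bd K B (fun σ => z σ k) τ := by
  simp [bd]

open Classical in
/-- multidegree `b` part of a chain -/
noncomputable def hat (z : Finset V → MvPolynomial V K) (b : V →₀ ℕ) (σ : Finset V) : K :=
  if ind σ ≤ b then coeff (b - ind σ) (z σ) else 0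

theorem ind_le_iff {σ : Finset V} {b : V →₀ ℕ} : ind σ ≤ b ↔ σ ⊆ b.support := by
  constructor
  · intro h v hv
    have := h v
    rw [ind_apply, if_pos hv] at this
    rw [Finsupp.mem_support_iff]; omega
  · intro h v
    rw [ind_apply]
    split_ifs with hv
    · have := Finsupp.mem_support_iff.1 (h hv); omega
    · omega

theorem hat_bd (B : Finset V) (z : Finset V → MvPolynomial V K) {b : V →₀ ℕ} {τ : Finset V} (hτ : ind τ ≤ b) :
    hat (bd K B z) b τ = dl (B ∩ b.support) (hat z b) τ := by
  classical
  rw [hat, if_pos hτ, bd, dl, coeff_sum]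
  symm
  have hsub : (B ∩ b.support) \ τ ⊆ B \ τ := Finset.sdiff_subset_sdiff Finset.inter_subset_left le_rfl
  rw [← Finset.sum_subset hsub]
  · refine Finset.sum_congr rfl fun v hv => ?_
    rw [Finset.mem_sdiff, Finset.mem_inter] at hv
    obtain ⟨⟨hvB, hvb⟩, hvτ⟩ := hv
    have hle : ind (insert v τ) ≤ b := by
      rw [ind_le_iff] at hτ ⊢
      exact Finset.insert_subset hvb hτ
    have hmem : v ∈ (b - ind τ).support := by
      rw [Finsupp.mem_support_iff, Finsupp.tsub_apply, ind_apply, if_neg hvτ]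
      have := Finsupp.mem_support_iff.1 hvb
      omega
    rw [hat, if_pos hle, smul_eq_mul, mul_assoc, coeff_C_mul, coeff_X_mul', if_pos hmem, ind_insert hvτ, tsub_tsub]
  · intro v hv hv'
    rw [Finset.mem_sdiff] at hv
    have hvb : v ∉ b.support := fun h => hv' (Finset.mem_sdiff.2 ⟨Finset.mem_inter.2 ⟨hv.1, h⟩, hv.2⟩)
    have hmem : v ∉ (b - ind τ).support := by
      rw [Finsupp.mem_support_iff, Finsupp.tsub_apply, ind_apply, if_neg hv.2]
      have := Finsupp.notMem_support_iff.1 hvb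
      omega
    rw [smul_eq_mul, mul_assoc, coeff_C_mul, coeff_X_mul', if_neg hmem, mul_zero]

theorem coeff_eq_hat (z : Finset V → MvPolynomial V K) (μ : V →₀ ℕ) (σ : Finset V) :
    coeff μ (z σ) = hat z (μ + ind σ) σ := by
  classical
  rw [hat, if_pos le_add_self, add_tsub_cancel_right]

theorem supp_add_ind (μ : V →₀ ℕ) (σ : Finset V) : σ ⊆ (μ + ind σ).support := by
  rw [← ind_le_iff]; exact le_add_self

theorem dl_congr {B : Finset V} {c c' : Finset V → K} {τ : Finset V} (hτ : τ ⊆ B) (h : ∀ σ ⊆ B, c σ = c' σ) :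
    dl B c τ = dl B c' τ := by
  unfold dl
  refine Finset.sum_congr rfl fun v hv => ?_
  rw [Finset.mem_sdiff] at hv
  rw [h _ (Finset.insert_subset hv.1 hτ)]

theorem bd_bd1 (B : Finset V) (z : Finset V → MvPolynomial V K) {τ : Finset V} (hτ : τ ⊆ B) : bd K B (bd K B z) τ = 0 := by
  ext μ
  have hs := supp_add_ind μ τ
  rw [coeff_eq_hat (bd K B (bd K B z)) μ τ, hat_bd B _ (ind_le_iff.2 hs)]
  rw [dl_congr (c' := dl (B ∩ (μ + ind τ).support) (hat z (μ + ind τ))) (Finset.subset_inter hτ hs), dl_dl]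
  · simp
  · intro σ hσ
    exact hat_bd B z (ind_le_iff.2 (hσ.trans Finset.inter_subset_right))

theorem bd_bd {n : ℕ} (B : Finset V) (z : Finset V → Fin n → MvPolynomial V K) {τ : Finset V} (hτ : τ ⊆ B) :
    bd K B (bd K B z) τ = 0 := by
  ext1 k
  rw [bd_apply]
  have : (fun σ => bd K B z σ k) = bd K B (fun σ => z σ k) := by
    ext1 σ; exact bd_apply B z σ k
  rw [this, bd_bd1 B _ hτ]; rfl

theorem asm (B : Finset V) (J R : (V →₀ ℕ) → Prop) (i : ℕ)
    (hvan : ∀ b, R b → Van K (B ∩ b.support) (fun σ => ¬ J (b - ind σ)) i)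
    (z : Finset V → MvPolynomial V K) (hz : ∀ σ ⊆ B, σ.card = i → ∀ μ ∈ (z σ).support, R (μ + ind σ))
    (hd : ∀ τ ⊆ B, τ.card + 1 = i → ∀ μ ∈ (bd K B z τ).support, J μ) :
    ∃ w : Finset V → MvPolynomial V K, (∀ σ, ∀ μ ∈ (w σ).support, R (μ + ind σ)) ∧
      ∀ σ ⊆ B, σ.card = i → ∀ μ ∈ (z σ - bd K B w σ).support, J μ := by
  classical
  have hex : ∀ b, ∃ w : Finset V → K, R b → ∀ σ, σ ⊆ B ∩ b.support → ¬ J (b - ind σ) → σ.card = i →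
      hat z b σ = dl (B ∩ b.support) w σ := by
    intro b
    by_cases hb : R b
    · obtain ⟨w, hw⟩ := hvan b hb (hat z b) (by
        intro τ h1 h2 h3
        have hle := ind_le_iff.2 (h1.trans Finset.inter_subset_right)
        rw [← hat_bd B z hle, hat, if_pos hle]
        by_contra hne
        exact h2 (hd τ (h1.trans Finset.inter_subset_left) h3 _ (mem_support_iff.2 hne)))
      exact ⟨w, fun _ => hw⟩
    · exact ⟨fun _ => 0, fun h => absurd h hb⟩
  choose wb hwb using hex
  let Bs : Finset (V →₀ ℕ) := (B.powerset.filter (fun σ => σ.card = i)).biUnion (fun σ => (z σ).support.image (· + ind σ))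
  have hBs : ∀ b, b ∈ Bs ↔ ∃ σ ⊆ B, σ.card = i ∧ ∃ μ ∈ (z σ).support, μ + ind σ = b := by
    intro b
    simp only [Bs, Finset.mem_biUnion, Finset.mem_filter, Finset.mem_powerset, Finset.mem_image, and_assoc]
  have hBR : ∀ b ∈ Bs, R b := by
    intro b hb
    obtain ⟨σ, h1, h2, μ, h3, rfl⟩ := (hBs b).1 hb
    exact hz σ h1 h2 μ h3
  let w : Finset V → MvPolynomial V K := fun σ => ∑ b ∈ Bs.filter (fun b => ind σ ≤ b), monomial (b - ind σ) (wb b σ)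
  have hw : ∀ b σ, ind σ ≤ b → hat w b σ = if b ∈ Bs then wb b σ else 0 := by
    intro b σ hle
    rw [hat, if_pos hle, coeff_sum]
    simp only [coeff_monomial]
    rw [Finset.sum_congr rfl (g := fun b' => if b' = b then wb b' σ else 0), Finset.sum_ite_eq']
    · simp [hle]
    · intro b' hb'
      rw [Finset.mem_filter] at hb'
      have : b' - ind σ = b - ind σ ↔ b' = b := by
        constructor
        · intro h
          rw [← tsub_add_cancel_of_le hb'.2, h, tsub_add_cancel_of_le hle]
        · rintro rfl; rfl
      simp [this]
  refine ⟨w, ?_, ?_⟩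
  · intro σ μ hμ
    have h1 : hat w (μ + ind σ) σ ≠ 0 := by
      rw [← coeff_eq_hat]; exact mem_support_iff.1 hμ
    rw [hw _ _ le_add_self] at h1
    by_cases hb : μ + ind σ ∈ Bs
    · exact hBR _ hb
    · rw [if_neg hb] at h1; exact absurd rfl h1
  · intro σ hσ hi μ hμ
    by_contra hJ
    have hs := supp_add_ind μ σ
    have hσ' : σ ⊆ B ∩ (μ + ind σ).support := Finset.subset_inter hσ hs
    apply mem_support_iff.1 hμ
    rw [coeff_sub, coeff_eq_hat z μ σ, coeff_eq_hat (bd K B w) μ σ, hat_bd B _ (ind_le_iff.2 hs)]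
    by_cases hb : μ + ind σ ∈ Bs
    · rw [hwb _ (hBR _ hb) σ hσ' (by rwa [add_tsub_cancel_right]) hi, sub_eq_zero]
      refine dl_congr hσ' fun ρ hρ => ?_
      rw [hw _ _ (ind_le_iff.2 (hρ.trans Finset.inter_subset_right)), if_pos hb]
    · have h0 : hat z (μ + ind σ) σ = 0 := by
        rw [← coeff_eq_hat]
        by_contra hne
        exact hb ((hBs _).2 ⟨σ, hσ, hi, μ, mem_support_iff.2 hne, rfl⟩)
      rw [h0, dl_congr (c' := fun _ => 0) hσ']
      · simp [dl]
      · intro ρ hρ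
        rw [hw _ _ (ind_le_iff.2 (hρ.trans Finset.inter_subset_right)), if_neg hb]

theorem koszul1 (B : Finset V) (R : (V →₀ ℕ) → Prop) (i : ℕ) (hR : ∀ b, R b → 1 ≤ i ∨ (B ∩ b.support).Nonempty)
    (z : Finset V → MvPolynomial V K) (hz : ∀ σ ⊆ B, σ.card = i → ∀ μ ∈ (z σ).support, R (μ + ind σ))
    (hd : ∀ τ ⊆ B, τ.card + 1 = i → bd K B z τ = 0) :
    ∃ w : Finset V → MvPolynomial V K, (∀ σ, ∀ μ ∈ (w σ).support, R (μ + ind σ)) ∧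
      ∀ σ ⊆ B, σ.card = i → z σ = bd K B w σ := by
  obtain ⟨w, h1, h2⟩ := asm B (fun _ => False) R i (by
    intro b hb
    by_cases hne : (B ∩ b.support).Nonempty
    · obtain ⟨x, hx⟩ := hne
      exact Van.free hx (fun _ _ h => h)
    · rcases hR b hb with h | h
      · refine Van.of_empty fun σ hσ hc => ?_
        rw [Finset.not_nonempty_iff_eq_empty] at hne
        rw [hne, Finset.subset_empty] at hσ
        rw [hσ, Finset.card_empty] at hc
        omega
      · exact absurd h hne) z hz (by
    intro τ h1 h2 μ hμ
    rw [hd τ h1 h2] at hμ; simp at hμ)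
  refine ⟨w, h1, fun σ hσ hi => ?_⟩
  rw [← sub_eq_zero]
  by_contra hne
  obtain ⟨μ, hμ⟩ := MvPolynomial.support_nonempty.2 hne
  exact h2 σ hσ hi μ hμ

theorem koszul {n : ℕ} (B : Finset V) (R : Fin n → (V →₀ ℕ) → Prop) (i : ℕ) (hR : ∀ k b, R k b → 1 ≤ i ∨ (B ∩ b.support).Nonempty)
    (z : Finset V → Fin n → MvPolynomial V K) (hz : ∀ σ ⊆ B, σ.card = i → ∀ k, ∀ μ ∈ (z σ k).support, R k (μ + ind σ))
    (hd : ∀ τ ⊆ B, τ.card + 1 = i → bd K B z τ = 0) :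
    ∃ w : Finset V → Fin n → MvPolynomial V K, (∀ σ k, ∀ μ ∈ (w σ k).support, R k (μ + ind σ)) ∧
      ∀ σ ⊆ B, σ.card = i → z σ = bd K B w σ := by
  have := fun k => koszul1 B (R k) i (hR k) (fun σ => z σ k) (fun σ h1 h2 => hz σ h1 h2 k) (by
    intro τ h1 h2
    rw [← bd_apply, hd τ h1 h2]; rfl)
  choose w hw1 hw2 using this
  refine ⟨fun σ k => w k σ, fun σ k => hw1 k σ, fun σ h1 h2 => ?_⟩
  ext1 k
  rw [bd_apply]
  exact hw2 k σ h1 h2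

end Chains

end EIR


namespace EIR

section Bridge1

open MvPolynomial EdgeIdealReg

variable {V : Type} [LinearOrder V] {K : Type} [Field K]

theorem bd_flt (B : Finset V) (R : (V →₀ ℕ) → Prop) (z : Finset V → MvPolynomial V K) (τ : Finset V) :
    flt (fun α => R (α + ind τ)) (bd K B z τ) = bd K B (fun σ => flt (fun α => R (α + ind σ)) (z σ)) τ := by
  classical
  unfold bd
  rw [flt_sum]
  refine Finset.sum_congr rfl fun v hv => ?_
  rw [Finset.mem_sdiff] at hv
  rw [smul_eq_mul, smul_eq_mul]
  apply flt_mul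
  intro α hα β
  have : α = e1 v := by
    by_contra hne
    rw [mem_support_iff] at hα
    apply hα
    rw [coeff_C_mul, coeff_X', if_neg (Ne.symm hne), mul_zero]
  rw [this, ind_insert hv.2, show e1 v + β + ind τ = β + (ind τ + e1 v) by abel]

theorem mat_flt {n m : ℕ} (A : Matrix (Fin n) (Fin m) (MvPolynomial V K)) (R : Fin n → (V →₀ ℕ) → Prop) (R' : Fin m → (V →₀ ℕ) → Prop)
    (h : ∀ k l, ∀ α ∈ (A k l).support, ∀ β, (R k (α + β) ↔ R' l β)) (x : Fin m → MvPolynomial V K) (k : Fin n) :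
    flt (R k) (A.mulVec x k) = A.mulVec (fun l => flt (R' l) (x l)) k := by
  simp only [Matrix.mulVec, dotProduct]
  rw [flt_sum]
  exact Finset.sum_congr rfl fun l _ => flt_mul (h k l) _

theorem degree_ind (σ : Finset V) : (ind σ).degree = σ.card := by
  classical
  induction σ using Finset.induction_on with
  | empty =>
    have : ind (∅ : Finset V) = 0 := by ext v; simp [ind_apply]
    rw [this]; simp
  | insert v τ hv ih =>
    rw [ind_insert hv, map_add, ih, Finset.card_insert_of_notMem hv]
    simp [e1]

/-- relevance predicate -/
def Rl (B : Finset V) (j : ℤ) {n : ℕ} (deg : Fin n → ℕ) (k : Fin n) (b : V →₀ ℕ) : Prop :=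
  (b.degree : ℤ) + deg k = j ∧ b.support ⊆ B

theorem supp_add (α β : V →₀ ℕ) : (α + β).support = α.support ∪ β.support := by
  classical
  ext v
  simp only [Finsupp.mem_support_iff, Finset.mem_union, Finsupp.add_apply]
  omega

theorem Rl_mat {B : Finset V} {j : ℤ} {n m : ℕ} {deg : Fin n → ℕ} {deg' : Fin m → ℕ} (A : Matrix (Fin n) (Fin m) (MvPolynomial V K))
    (hom : ∀ k l, A k l = 0 ∨ ∃ e, deg' l = deg k + e ∧ (A k l).IsHomogeneous e)
    (hB : ∀ k l, ∀ μ ∈ (A k l).support, μ.support ⊆ B) (τ : Finset V) :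
    ∀ k l, ∀ α ∈ (A k l).support, ∀ β, (Rl B j deg k (α + β + ind τ) ↔ Rl B j deg' l (β + ind τ)) := by
  intro k l α hα β
  have h1 : (α.degree : ℤ) + deg k = deg' l := by
    rcases hom k l with h | ⟨e, h1, h2⟩
    · rw [h] at hα; simp at hα
    · have : α.degree = e := by
        by_contra hne
        exact mem_support_iff.1 hα (h2.coeff_eq_zero hne)
      rw [this]; omega
  have h2 := hB k l α hα
  unfold Rl
  rw [add_assoc, map_add, supp_add]
  push_cast
  constructor
  · rintro ⟨p, q⟩
    exact ⟨by linarith, (Finset.union_subset_iff.1 q).2⟩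
  · rintro ⟨p, q⟩
    exact ⟨by linarith, Finset.union_subset h2 q⟩

theorem P1 {I : Ideal (MvPolynomial V K)} (F : GradedFreeResolution I) (d : ℤ) (hdeg : ∀ i k, (F.deg i k : ℤ) ≤ d + i) (B : Finset V)
    (i : ℕ) : ∀ t, (∀ s, s < t + i → ∀ k l, ∀ μ ∈ (F.mat s k l).support, μ.support ⊆ B) → ∀ j : ℤ, d + t + i < j →
    ∀ y : Finset V → Fin (F.rank t) → MvPolynomial V K,
    (∀ σ ⊆ B, σ.card = i → ∀ k, ∀ μ ∈ (y σ k).support, Rl B j (F.deg t) k (μ + ind σ)) →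
    (∃ y' : Finset V → Fin (F.rank (t+1)) → MvPolynomial V K, ∀ τ ⊆ B, τ.card + 1 = i → bd K B y τ = (F.mat t).mulVec (y' τ)) →
    ∃ (w : Finset V → Fin (F.rank t) → MvPolynomial V K) (y' : Finset V → Fin (F.rank (t+1)) → MvPolynomial V K),
      ∀ σ ⊆ B, σ.card = i → y σ = bd K B w σ + (F.mat t).mulVec (y' σ) := by
  induction i with
  | zero =>
    intro t _ j hj y hy _
    obtain ⟨w, -, hw⟩ := koszul B (Rl B j (F.deg t)) 0 (by
      rintro k b ⟨h1, h2⟩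
      right
      rw [Finset.inter_eq_right.2 h2]
      by_contra hne
      rw [Finset.not_nonempty_iff_eq_empty, Finsupp.support_eq_empty] at hne
      rw [hne] at h1
      have := hdeg t k
      simp at h1 hj
      omega) y hy (fun τ _ h => by omega)
    refine ⟨w, fun _ => 0, fun σ h1 h2 => ?_⟩
    rw [Matrix.mulVec_zero, add_zero]
    exact hw σ h1 h2
  | succ i ih =>
    intro t hB j hj y hy ⟨y', hy'⟩
    let y1 : Finset V → Fin (F.rank (t+1)) → MvPolynomial V K := fun σ l =>
      flt (fun β => Rl B j (F.deg (t+1)) l (β + ind σ)) (y' σ l)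
    have h1 : ∀ τ ⊆ B, τ.card + 1 = i + 1 → bd K B y τ = (F.mat t).mulVec (y1 τ) := by
      intro τ hτ hc
      ext1 k
      rw [← mat_flt (F.mat t) (fun k α => Rl B j (F.deg t) k (α + ind τ)) (fun l β => Rl B j (F.deg (t+1)) l (β + ind τ))
        (Rl_mat (F.mat t) (F.homog t) (hB t (by omega)) τ), ← hy' τ hτ hc, bd_apply, bd_flt]
      refine bd_congr hτ hc fun σ h1 h2 => ?_
      exact (flt_eq (hy σ h1 h2 k)).symm
    have h2 : ∀ τ ⊆ B, τ.card + 1 = i → ∃ x, bd K B y1 τ = (F.mat (t+1)).mulVec x := by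
      intro τ hτ hc
      have : bd K B y1 τ ∈ LinearMap.ker (Matrix.mulVecLin (F.mat t)) := by
        rw [LinearMap.mem_ker, ← bd_map B (Matrix.mulVecLin (F.mat t)) y1 τ]
        rw [← bd_bd B y hτ]
        refine bd_congr hτ hc fun σ h1' h2' => ?_
        rw [h1 σ h1' (by omega)]; rfl
      rw [F.isExact t] at this
      obtain ⟨x, hx⟩ := this
      exact ⟨x, hx.symm⟩
    have h2' : ∀ τ, ∃ x, τ ⊆ B → τ.card + 1 = i → bd K B y1 τ = (F.mat (t+1)).mulVec x := by
      intro τ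
      by_cases h : τ ⊆ B ∧ τ.card + 1 = i
      · obtain ⟨x, hx⟩ := h2 τ h.1 h.2
        exact ⟨x, fun _ _ => hx⟩
      · exact ⟨0, fun a b => absurd ⟨a, b⟩ h⟩
    choose y2 hy2 using h2'
    obtain ⟨w, y3, hw⟩ := ih (t+1) (fun s hs => hB s (by omega)) j (by push_cast at hj ⊢; omega) y1 
      (fun σ _ _ k μ hμ => (mem_flt hμ).1) ⟨y2, hy2⟩
    have h3 : ∀ σ ⊆ B, σ.card + 1 = i + 1 → bd K B y σ = bd K B (fun σ => (F.mat t).mulVec (w σ)) σ := by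
      intro σ hσ hc
      rw [h1 σ hσ hc, hw σ hσ (by omega), Matrix.mulVec_add]
      have hz : (F.mat t).mulVec ((F.mat (t+1)).mulVec (y3 σ)) = 0 := by
        have : (F.mat (t+1)).mulVec (y3 σ) ∈ LinearMap.ker (Matrix.mulVecLin (F.mat t)) := by
          rw [F.isExact t]; exact ⟨_, rfl⟩
        exact this
      rw [hz, add_zero]
      exact (bd_map B (Matrix.mulVecLin (F.mat t)) w σ).symm
    obtain ⟨u, -, hu⟩ := koszul B (fun _ _ => True) (i+1) (fun _ _ _ => Or.inl (by omega)) (fun σ => y σ - (F.mat t).mulVec (w σ))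
      (fun _ _ _ _ _ _ => trivial) (by
        intro τ hτ hc
        rw [bd_sub, h3 τ hτ hc, sub_self])
    refine ⟨u, w, fun σ h1 h2 => ?_⟩
    rw [← hu σ h1 h2]; abel

theorem bridge1 {I : Ideal (MvPolynomial V K)} {J : (V →₀ ℕ) → Prop} (hJ : ∀ f, f ∈ I ↔ ∀ μ ∈ f.support, J μ)
    (F : GradedFreeResolution I) (d : ℤ) (hdeg : ∀ i k, (F.deg i k : ℤ) ≤ d + i) : RegOn K Set.univ J d := by
  classical
  intro b _ i hb c hc
  let B : Finset V := b.support ∪ (Finset.range i).biUnion (fun s => Finset.univ.biUnion fun k => Finset.univ.biUnion fun l =>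
    (F.mat s k l).support.biUnion fun μ => μ.support)
  have hBb : b.support ⊆ B := Finset.subset_union_left
  have hBm : ∀ s, s < 0 + i → ∀ k l, ∀ μ ∈ (F.mat s k l).support, μ.support ⊆ B := by
    intro s hs k l μ hμ v hv
    refine Finset.mem_union_right _ ?_
    simp only [Finset.mem_biUnion, Finset.mem_univ, true_and]
    exact ⟨s, Finset.mem_range.2 (by omega), k, l, μ, hμ, hv⟩
  have hBi : B ∩ b.support = b.support := Finset.inter_eq_right.2 hBb
  let z : Finset V → MvPolynomial V K := fun σ => if σ ⊆ b.support then monomial (b - ind σ) (c σ) else 0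
  have hz : ∀ σ, ∀ μ ∈ (z σ).support, μ + ind σ = b := by
    intro σ μ hμ
    by_cases hσ : σ ⊆ b.support
    · simp only [z, if_pos hσ] at hμ
      have := Finset.mem_singleton.1 (support_monomial_subset hμ)
      rw [this, tsub_add_cancel_of_le (ind_le_iff.2 hσ)]
    · simp [z, if_neg hσ] at hμ
  have hhat : ∀ σ ⊆ b.support, hat z b σ = c σ := by
    intro σ hσ
    rw [hat, if_pos (ind_le_iff.2 hσ)]
    simp [z, hσ]
  have hbz : ∀ τ, τ ⊆ B → τ.card + 1 = i → bd K B z τ ∈ I := by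
    intro τ hτ hi
    rw [hJ]
    intro μ hμ
    have e : flt (fun α => α + ind τ = b) (bd K B z τ) = bd K B z τ := by
      rw [bd_flt B (fun α => α = b)]
      congr 1
      ext1 σ
      exact flt_eq (hz σ)
    have hμb : μ + ind τ = b := by
      rw [← e] at hμ; exact (mem_flt hμ).1
    by_contra hJμ
    apply mem_support_iff.1 hμ
    have hs : τ ⊆ b.support := by rw [← hμb]; exact supp_add_ind _ _
    rw [coeff_eq_hat (bd K B z), hμb, hat_bd B z (ind_le_iff.2 hs), hBi, dl_congr hs hhat]
    apply hc τ hs _ hi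
    rwa [← hμb, add_tsub_cancel_right]
  have hr : ∀ f, f ∈ I → ∃ x, (fun _ => f) = (F.mat 0).mulVec x := by
    intro f hf
    obtain ⟨x, hx⟩ := (F.range_zero f).1 hf
    exact ⟨x, hx.symm⟩
  have hy' : ∀ τ, ∃ x, τ ⊆ B → τ.card + 1 = i → bd K B (fun σ (_ : Fin (F.rank 0)) => z σ) τ = (F.mat 0).mulVec x := by
    intro τ
    by_cases h : τ ⊆ B ∧ τ.card + 1 = i
    · obtain ⟨x, hx⟩ := hr _ (hbz τ h.1 h.2)
      refine ⟨x, fun _ _ => ?_⟩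
      rw [← hx]
      ext1 k
      rw [bd_apply]
    · exact ⟨0, fun h1 h2 => absurd ⟨h1, h2⟩ h⟩
  choose y' hy' using hy'
  obtain ⟨w, y2, hw⟩ := P1 F d hdeg B i 0 hBm (b.degree : ℤ) (by push_cast; linarith) (fun σ _ => z σ) (by
    intro σ _ _ k μ hμ
    rw [hz σ μ hμ]
    exact ⟨by rw [F.deg_zero]; simp, hBb⟩) ⟨y', hy'⟩
  let k0 : Fin (F.rank 0) := ⟨0, by rw [F.rank_zero]; omega⟩
  refine ⟨hat (fun σ => w σ k0) b, fun σ hσ hJσ hi => ?_⟩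
  have h1 := congrFun (hw σ (hσ.trans hBb) hi) k0
  rw [Pi.add_apply, bd_apply] at h1
  have h2 : (F.mat 0).mulVec (y2 σ) k0 ∈ I := by
    rw [F.range_zero]
    refine ⟨y2 σ, ?_⟩
    ext1 k
    have : k = k0 := by
      apply Fin.ext
      have := k.2
      have := F.rank_zero
      show k.1 = 0
      omega
    rw [this]; rfl
  have h3 : coeff (b - ind σ) ((F.mat 0).mulVec (y2 σ) k0) = 0 := by
    by_contra hne
    exact hJσ ((hJ _).1 h2 _ (mem_support_iff.2 hne))
  rw [← hhat σ hσ, ← hBi, ← hat_bd B _ (ind_le_iff.2 hσ), hat, hat, if_pos (ind_le_iff.2 hσ), if_pos (ind_le_iff.2 hσ), h1, coeff_add, h3, add_zero]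

end Bridge1

end EIR


namespace EIR

section Bridge2

open MvPolynomial EdgeIdealReg

variable {V : Type} [LinearOrder V] [Fintype V] {K : Type} [Field K]

variable (V K) in
/-- a stage in the construction of the resolution -/
structure Stg (d : ℤ) (t : ℕ) where
  n : ℕ
  deg : Fin n → ℕ
  N : Submodule (MvPolynomial V K) (Fin n → MvPolynomial V K)
  hdeg : ∀ k, (deg k : ℤ) ≤ d + t
  hom : ∀ x ∈ N, ∀ j : ℤ, (fun k => flt (Rl Finset.univ j deg k) (x k)) ∈ N
  van : ∀ i : ℕ, 1 ≤ i → ∀ j : ℤ, d + t + i < j → ∀ z : Finset V → Fin n → MvPolynomial V K,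
    (∀ σ, σ.card = i → ∀ k, ∀ μ ∈ (z σ k).support, Rl Finset.univ j deg k (μ + ind σ)) →
    (∀ τ, τ.card + 1 = i → bd K Finset.univ z τ ∈ N) →
    ∃ w : Finset V → Fin n → MvPolynomial V K, ∀ σ, σ.card = i → z σ - bd K Finset.univ w σ ∈ N

theorem comp_sum {n : ℕ} (deg : Fin n → ℕ) (x : Fin n → MvPolynomial V K) :
    ∃ M : ℕ, x = ∑ j ∈ Finset.range M, (fun k => flt (Rl Finset.univ (j : ℤ) deg k) (x k)) := by
  classical
  refine ⟨(Finset.univ.sup fun k => (x k).support.sup fun μ => μ.degree + deg k) + 1, ?_⟩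
  ext1 k
  rw [Finset.sum_apply]
  ext μ
  rw [coeff_sum]
  simp only [coeff_flt]
  by_cases h : coeff μ (x k) = 0
  · simp [h]
  · have hle : μ.degree + deg k ≤ Finset.univ.sup fun k => (x k).support.sup fun μ => μ.degree + deg k :=
      le_trans (Finset.le_sup (f := fun μ : V →₀ ℕ => μ.degree + deg k) (mem_support_iff.2 h))
        (Finset.le_sup (f := fun k => (x k).support.sup fun μ : V →₀ ℕ => μ.degree + deg k) (Finset.mem_univ k))
    rw [Finset.sum_eq_single (μ.degree + deg k)]
    · rw [if_pos]
      exact ⟨by push_cast; rfl, Finset.subset_univ _⟩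
    · intro j _ hj
      rw [if_neg]
      rintro ⟨h1, -⟩
      apply hj
      exact_mod_cast h1.symm
    · intro hn
      exact absurd (Finset.mem_range.2 (Nat.lt_succ_of_le hle)) hn

theorem Rl_shift {j : ℕ} {n : ℕ} {deg : Fin n → ℕ} {k : Fin n} {σ : Finset V} (hσ : σ.card = 1) (α : V →₀ ℕ) :
    Rl (Finset.univ : Finset V) ((j + 1 : ℕ) : ℤ) deg k (α + ind σ) ↔ Rl Finset.univ (j : ℤ) deg k α := by
  unfold Rl
  rw [map_add, degree_ind, hσ]
  push_cast
  constructor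
  · rintro ⟨h, -⟩; exact ⟨by linarith, Finset.subset_univ _⟩
  · rintro ⟨h, -⟩; exact ⟨by linarith, Finset.subset_univ _⟩

theorem Stg.gen {d : ℤ} {t : ℕ} (s : Stg V K d t) : ∃ (n' : ℕ) (deg' : Fin n' → ℕ) (A : Matrix (Fin s.n) (Fin n') (MvPolynomial V K)),
    (∀ k, (deg' k : ℤ) ≤ d + t + 1) ∧ (∀ k l, A k l = 0 ∨ ∃ e, deg' l = s.deg k + e ∧ (A k l).IsHomogeneous e) ∧
    LinearMap.range (Matrix.mulVecLin A) = s.N := by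
  classical
  let G0 : Set (Fin s.n → MvPolynomial V K) := {x | x ∈ s.N ∧ ∃ j : ℕ, (j : ℤ) ≤ d + t + 1 ∧ ∀ k, ∀ μ ∈ (x k).support, Rl Finset.univ (j : ℤ) s.deg k μ}
  have key : ∀ j : ℕ, ∀ x ∈ s.N, (∀ k, ∀ μ ∈ (x k).support, Rl Finset.univ (j : ℤ) s.deg k μ) → x ∈ Submodule.span (MvPolynomial V K) G0 := by
    intro j
    induction j with
    | zero =>
      intro x hx hR
      by_cases hj : (0 : ℤ) ≤ d + t + 1
      · exact Submodule.subset_span ⟨hx, 0, by exact_mod_cast hj, hR⟩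
      · have : x = 0 := by
          ext1 k
          by_contra hne
          have := s.hdeg k
          omega
        rw [this]; exact Submodule.zero_mem _
    | succ j ih =>
      intro x hx hR
      by_cases hj : ((j + 1 : ℕ) : ℤ) ≤ d + t + 1
      · exact Submodule.subset_span ⟨hx, j + 1, hj, hR⟩
      have hi0 : ind (∅ : Finset V) = 0 := by ext v; simp [ind_apply]
      obtain ⟨w, hwR, hw⟩ := koszul Finset.univ (Rl Finset.univ ((j + 1 : ℕ) : ℤ) s.deg) 0 (by
        rintro k b ⟨h1, h2⟩
        right
        rw [Finset.univ_inter]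
        by_contra hne
        rw [Finset.not_nonempty_iff_eq_empty, Finsupp.support_eq_empty] at hne
        rw [hne] at h1
        have := s.hdeg k
        simp at h1 hj
        omega) (fun _ => x) (by
        intro σ _ hσ k μ hμ
        rw [Finset.card_eq_zero] at hσ
        rw [hσ, hi0, add_zero]
        exact hR k μ hμ) (fun τ _ h => by omega)
      have hx0 := hw ∅ (Finset.empty_subset _) rfl
      obtain ⟨w2, hw2⟩ := s.van 1 le_rfl ((j + 1 : ℕ) : ℤ) (by push_cast at hj ⊢; omega) w (fun σ _ => hwR σ) (by
        intro τ hτ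
        have : τ = ∅ := Finset.card_eq_zero.1 (by omega)
        rw [this, ← hx0]; exact hx)
      have hx1 : x = bd K Finset.univ (fun σ => w σ - bd K Finset.univ w2 σ) ∅ := by
        rw [bd_sub, bd_bd Finset.univ w2 (Finset.empty_subset _), sub_zero]; exact hx0
      have hx2 : x = bd K Finset.univ (fun σ k => flt (fun α => Rl Finset.univ ((j + 1 : ℕ) : ℤ) s.deg k (α + ind σ)) ((w σ - bd K Finset.univ w2 σ) k)) ∅ := by
        ext1 k
        rw [bd_apply]
        rw [← bd_flt Finset.univ (Rl Finset.univ ((j + 1 : ℕ) : ℤ) s.deg k) (fun σ => (w σ - bd K Finset.univ w2 σ) k) ∅]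
        rw [← bd_apply Finset.univ (fun σ => w σ - bd K Finset.univ w2 σ), ← hx1]
        symm
        apply flt_eq
        intro μ hμ
        rw [hi0, add_zero]
        exact hR k μ hμ
      rw [hx2]
      refine bd_mem (i := 1) (Finset.empty_subset _) rfl _ fun σ _ hσ => ?_
      have e : (fun k => flt (fun α => Rl Finset.univ ((j + 1 : ℕ) : ℤ) s.deg k (α + ind σ)) ((w σ - bd K Finset.univ w2 σ) k)) =
          (fun k => flt (Rl Finset.univ (j : ℤ) s.deg k) ((w σ - bd K Finset.univ w2 σ) k)) := by
        ext1 k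
        congr 1
        ext1 α
        exact propext (Rl_shift hσ α)
      rw [e]
      exact ih _ (s.hom _ (hw2 σ hσ) _) (fun k μ hμ => (mem_flt hμ).1)
  have hspan : Submodule.span (MvPolynomial V K) G0 = s.N := by
    apply le_antisymm
    · rw [Submodule.span_le]; exact fun x hx => hx.1
    · intro x hx
      obtain ⟨M, hM⟩ := comp_sum s.deg x
      rw [hM]
      exact Submodule.sum_mem _ fun j _ => key j _ (s.hom x hx j) (fun k μ hμ => (mem_flt hμ).1)
  have hfg : (Submodule.span (MvPolynomial V K) G0).FG := IsNoetherian.noetherian _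
  rw [Submodule.fg_span_iff_fg_span_finset_subset] at hfg
  obtain ⟨T, hT, hT2⟩ := hfg
  let e := T.equivFin.symm
  have hdegs : ∀ x : T, ∃ j : ℕ, (j : ℤ) ≤ d + t + 1 ∧ ∀ k, ∀ μ ∈ ((x : Fin s.n → MvPolynomial V K) k).support, Rl Finset.univ (j : ℤ) s.deg k μ :=
    fun x => (hT x.2).2
  choose dg hdg1 hdg2 using hdegs
  refine ⟨T.card, fun l => dg (e l), fun k l => (e l : Fin s.n → MvPolynomial V K) k, fun l => hdg1 _, ?_, ?_⟩
  · intro k l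
    by_cases h0 : (e l : Fin s.n → MvPolynomial V K) k = 0
    · exact Or.inl h0
    · right
      obtain ⟨μ, hμ⟩ := MvPolynomial.support_nonempty.2 h0
      have h1 := (hdg2 (e l) k μ hμ).1
      refine ⟨μ.degree, by show dg (e l) = _; omega, ?_⟩
      intro ν hν
      have h2 := (hdg2 (e l) k ν (mem_support_iff.2 hν)).1
      have h3 : ν.degree = μ.degree := by omega
      rw [← h3, Finsupp.degree_eq_weight_one]
      rfl
  · refine (Matrix.range_mulVecLin _).trans ?_
    rw [← hspan, hT2]
    congr 1
    ext x
    constructor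
    · rintro ⟨l, rfl⟩
      exact (e l).2
    · intro hx
      exact ⟨e.symm ⟨x, hx⟩, by
        ext1 k
        show ((e (e.symm ⟨x, hx⟩) : T) : Fin s.n → MvPolynomial V K) k = x k
        rw [Equiv.apply_symm_apply]⟩

theorem Stg.next {d : ℤ} {t : ℕ} (s : Stg V K d t) : ∃ (s' : Stg V K d (t+1)) (A : Matrix (Fin s.n) (Fin s'.n) (MvPolynomial V K)),
    (∀ k l, A k l = 0 ∨ ∃ e, s'.deg l = s.deg k + e ∧ (A k l).IsHomogeneous e) ∧
    LinearMap.range (Matrix.mulVecLin A) = s.N ∧ s'.N = LinearMap.ker (Matrix.mulVecLin A) := by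
  classical
  obtain ⟨n', deg', A, hd, hom, hr⟩ := s.gen
  have hcomp : ∀ (σ : Finset V) (j : ℤ) (x : Fin n' → MvPolynomial V K) k, flt (fun α => Rl Finset.univ j s.deg k (α + ind σ)) (A.mulVec x k) =
      A.mulVec (fun l => flt (fun α => Rl Finset.univ j deg' l (α + ind σ)) (x l)) k := by
    intro σ j x k
    exact mat_flt A (fun k α => Rl Finset.univ j s.deg k (α + ind σ)) (fun l α => Rl Finset.univ j deg' l (α + ind σ))
      (Rl_mat A hom (fun _ _ _ _ => Finset.subset_univ _) σ) x k
  refine ⟨⟨n', deg', LinearMap.ker (Matrix.mulVecLin A), fun k => by have := hd k; push_cast; linarith, ?_, ?_⟩, A, hom, hr, rfl⟩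
  · intro x hx j
    rw [LinearMap.mem_ker, Matrix.mulVecLin_apply] at hx ⊢
    have hi0 : ind (∅ : Finset V) = 0 := by ext v; simp [ind_apply]
    ext1 k
    have := hcomp ∅ j x k
    simp only [hi0, add_zero] at this
    rw [show (fun k => flt (Rl Finset.univ j deg' k) (x k)) = (fun l => flt (fun α => Rl Finset.univ j deg' l α) (x l)) from rfl, ← this, hx]
    ext μ
    rw [coeff_flt]; simp
  · intro i hi j hj z hz hbz
    obtain ⟨u, huR, hu⟩ := koszul Finset.univ (Rl Finset.univ j s.deg) i (fun _ _ _ => Or.inl hi) (fun σ => A.mulVec (z σ)) (by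
      intro σ _ hσ k μ hμ
      have h1 : (fun l => flt (fun α => Rl Finset.univ j deg' l (α + ind σ)) (z σ l)) = z σ := by
        ext1 l
        exact flt_eq (hz σ hσ l)
      have h2 := hcomp σ j (z σ) k
      rw [h1] at h2
      rw [← h2] at hμ
      exact (mem_flt hμ).1) (by
      intro τ _ hτ
      rw [show (fun σ => A.mulVec (z σ)) = (fun σ => Matrix.mulVecLin A (z σ)) from rfl, bd_map]
      exact hbz τ hτ)
    obtain ⟨w, hw⟩ := s.van (i+1) (by omega) j (by push_cast at hj ⊢; linarith) u (fun σ _ => huR σ) (by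
      intro τ hτ
      rw [← hu τ (Finset.subset_univ _) (by omega), ← hr]
      exact ⟨_, rfl⟩)
    have hx : ∀ σ : Finset V, ∃ x, σ.card = i + 1 → u σ - bd K Finset.univ w σ = A.mulVec x := by
      intro σ
      by_cases h : σ.card = i + 1
      · have := hw σ h
        rw [← hr] at this
        obtain ⟨x, hx⟩ := this
        exact ⟨x, fun _ => hx.symm⟩
      · exact ⟨0, fun h' => absurd h' h⟩
    choose x hx using hx
    refine ⟨x, fun σ hσ => ?_⟩
    rw [LinearMap.mem_ker, map_sub, sub_eq_zero, ← bd_map, Matrix.mulVecLin_apply, hu σ (Finset.subset_univ _) hσ]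
    rw [← sub_zero (bd K Finset.univ u σ), ← bd_bd Finset.univ w (Finset.subset_univ σ), ← bd_sub]
    refine bd_congr (i := i + 1) (Finset.subset_univ σ) (by omega) fun ρ _ hρ => ?_
    exact hx ρ hρ

theorem Stg.start {I : Ideal (MvPolynomial V K)} {J : (V →₀ ℕ) → Prop} (hJ : ∀ f, f ∈ I ↔ ∀ μ ∈ f.support, J μ)
    {d : ℤ} (hd0 : 0 ≤ d) (hreg : RegOn K Set.univ J d) : ∃ s : Stg V K d 0, s.n = 1 ∧ (∀ k, s.deg k = 0) ∧
      ∀ f, f ∈ I ↔ (fun _ => f) ∈ s.N := by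
  classical
  refine ⟨⟨1, fun _ => 0, Submodule.comap (LinearMap.proj 0) I, fun k => by simpa using hd0, ?_, ?_⟩, rfl, fun _ => rfl, ?_⟩
  · intro x hx j
    rw [Submodule.mem_comap, LinearMap.proj_apply] at hx ⊢
    rw [hJ] at hx ⊢
    exact fun μ hμ => hx μ (mem_flt hμ).2
  · intro i hi j hj z hz hbz
    obtain ⟨w, -, hw⟩ := asm Finset.univ J (fun b => (b.degree : ℤ) = j) i (by
      intro b hb
      rw [Finset.univ_inter]
      exact hreg b (Set.subset_univ _) i (by push_cast at hj; linarith)) (fun σ => z σ 0) (by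
      intro σ _ hσ μ hμ
      have := (hz σ hσ 0 μ hμ).1
      simpa using this) (by
      intro τ _ hτ
      have := hbz τ hτ
      rw [Submodule.mem_comap, LinearMap.proj_apply, bd_apply, hJ] at this
      exact this)
    refine ⟨fun σ _ => w σ, fun σ hσ => ?_⟩
    rw [Submodule.mem_comap, LinearMap.proj_apply, Pi.sub_apply, bd_apply, hJ]
    exact hw σ (Finset.subset_univ _) hσ
  · intro f
    rw [Submodule.mem_comap, LinearMap.proj_apply]

theorem bridge2 {I : Ideal (MvPolynomial V K)} {J : (V →₀ ℕ) → Prop} (hJ : ∀ f, f ∈ I ↔ ∀ μ ∈ f.support, J μ)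
    {d : ℤ} (hd0 : 0 ≤ d) (hreg : RegOn K Set.univ J d) : ∃ F : GradedFreeResolution I, ∀ i k, (F.deg i k : ℤ) ≤ d + i := by
  obtain ⟨s0, h1, h2, h3⟩ := Stg.start hJ hd0 hreg
  choose nx A hA1 hA2 hA3 using fun (t : ℕ) (s : Stg V K d t) => s.next
  let st : (t : ℕ) → Stg V K d t := fun t => Nat.rec s0 nx t
  refine ⟨⟨fun t => (st t).n, fun t => (st t).deg, h1, h2, fun t => A t (st t), fun t => hA1 t (st t), ?_, ?_⟩, fun t => (st t).hdeg⟩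
  · intro f
    rw [h3, hA2 0 (st 0)]
    exact Iff.rfl
  · intro t
    rw [hA2 (t+1) (st (t+1))]
    exact (hA3 t (st t)).symm

end Bridge2

end EIR


namespace EIR

section Transport

open MvPolynomial EdgeIdealReg

/-! base change of exactness -/

theorem exact_base {R S : Type} [CommRing R] [CommRing S] [Algebra R S] {ι : Type} (b : Module.Basis ι R S) {n m p : ℕ}
    (A : Matrix (Fin n) (Fin m) R) (B : Matrix (Fin m) (Fin p) R)
    (h : LinearMap.ker (Matrix.mulVecLin A) = LinearMap.range (Matrix.mulVecLin B)) :
    LinearMap.ker (Matrix.mulVecLin (A.map (algebraMap R S))) = LinearMap.range (Matrix.mulVecLin (B.map (algebraMap R S))) := by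
  classical
  have rp : ∀ {n m : ℕ} (A : Matrix (Fin n) (Fin m) R) (x : Fin m → S) (i : ι) (k : Fin n),
      b.repr ((A.map (algebraMap R S)).mulVec x k) i = A.mulVec (fun l => b.repr (x l) i) k := by
    intro n m A x i k
    simp only [Matrix.mulVec, dotProduct, Matrix.map_apply]
    rw [map_sum, Finsupp.finset_sum_apply]
    refine Finset.sum_congr rfl fun l _ => ?_
    rw [← Algebra.smul_def, map_smul, Finsupp.smul_apply, smul_eq_mul]
  apply le_antisymm
  · intro x hx
    rw [LinearMap.mem_ker, Matrix.mulVecLin_apply] at hx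
    have h1 : ∀ i, ∃ y, B.mulVec y = fun l => b.repr (x l) i := by
      intro i
      have : (fun l => b.repr (x l) i) ∈ LinearMap.range (Matrix.mulVecLin B) := by
        rw [← h, LinearMap.mem_ker, Matrix.mulVecLin_apply]
        ext1 k
        rw [← rp, hx]; simp
      exact this
    choose y hy using h1
    let T : Finset ι := Finset.univ.biUnion fun l => (b.repr (x l)).support
    refine ⟨fun j => ∑ i ∈ T, y i j • b i, ?_⟩
    rw [Matrix.mulVecLin_apply]
    ext1 l
    apply b.repr.injective
    ext i
    rw [rp]
    have h2 : (fun j => b.repr (∑ i ∈ T, y i j • b i) i) = fun j => if i ∈ T then y i j else 0 := by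
      ext1 j
      rw [map_sum, Finsupp.finset_sum_apply]
      simp [Finsupp.single_apply]
    rw [h2]
    by_cases hi : i ∈ T
    · simp only [if_pos hi]
      exact congrFun (hy i) l
    · simp only [if_neg hi]
      have h3 : b.repr (x l) i = 0 := by
        by_contra hne
        exact hi (Finset.mem_biUnion.2 ⟨l, Finset.mem_univ _, Finsupp.mem_support_iff.2 hne⟩)
      rw [h3]
      simp [Matrix.mulVec, dotProduct]
  · rintro _ ⟨y, rfl⟩
    rw [LinearMap.mem_ker, Matrix.mulVecLin_apply, Matrix.mulVecLin_apply]
    ext1 k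
    apply b.repr.injective
    ext i
    rw [rp]
    have h2 : (fun l => b.repr ((B.map (algebraMap R S)).mulVec y l) i) ∈ LinearMap.ker (Matrix.mulVecLin A) := by
      rw [h]
      exact ⟨fun j => b.repr (y j) i, by ext1 l; rw [rp]; rfl⟩
    rw [LinearMap.mem_ker, Matrix.mulVecLin_apply] at h2
    rw [h2]; simp

theorem exact_rename {V K : Type} [Field K] (W : Set V) {n m p : ℕ}
    (A : Matrix (Fin n) (Fin m) (MvPolynomial W K)) (B : Matrix (Fin m) (Fin p) (MvPolynomial W K))
    (h : LinearMap.ker (Matrix.mulVecLin A) = LinearMap.range (Matrix.mulVecLin B)) :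
    LinearMap.ker (Matrix.mulVecLin (A.map (rename (Subtype.val : W → V)))) = LinearMap.range (Matrix.mulVecLin (B.map (rename (Subtype.val : W → V)))) := by
  classical
  letI : Algebra (MvPolynomial W K) (MvPolynomial V K) := (rename (R := K) (Subtype.val : W → V)).toRingHom.toAlgebra
  let ρ : MvPolynomial V K ≃ₐ[K] MvPolynomial (Wᶜ : Set V) (MvPolynomial W K) :=
    (renameEquiv K ((Equiv.sumComm _ _).trans (Equiv.Set.sumCompl W)).symm).trans (sumAlgEquiv K _ _)
  have hρ : ∀ p : MvPolynomial W K, ρ (rename Subtype.val p) = C p := by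
    intro p
    have : (ρ.toAlgHom.comp (rename (Subtype.val : W → V))) = (IsScalarTower.toAlgHom K (MvPolynomial W K) (MvPolynomial (Wᶜ : Set V) (MvPolynomial W K))) := by
      apply MvPolynomial.algHom_ext
      intro i
      simp [ρ, MvPolynomial.algebraMap_eq]
    exact congrArg (fun g : MvPolynomial W K →ₐ[K] _ => g p) this
  let l : MvPolynomial (Wᶜ : Set V) (MvPolynomial W K) ≃ₗ[MvPolynomial W K] MvPolynomial V K :=
    { ρ.symm with
      map_smul' := by
        intro c x
        show ρ.symm (c • x) = rename Subtype.val c * ρ.symm x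
        apply ρ.injective
        rw [map_mul, hρ, AlgEquiv.apply_symm_apply, AlgEquiv.apply_symm_apply, MvPolynomial.smul_eq_C_mul] }
  exact exact_base ((MvPolynomial.basisMonomials (Wᶜ : Set V) (MvPolynomial W K)).map l) A B h

theorem res_rename {V K : Type} [Field K] (W : Set V) {I : Ideal (MvPolynomial W K)} (F : GradedFreeResolution I) :
    ∃ F' : GradedFreeResolution (I.map (rename (R := K) (Subtype.val : W → V))), ∀ d : ℤ, (∀ i k, (F.deg i k : ℤ) ≤ d + i) →
      ∀ i k, (F'.deg i k : ℤ) ≤ d + i := by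
  classical
  refine ⟨⟨F.rank, F.deg, F.rank_zero, F.deg_zero, fun i => (F.mat i).map (rename (Subtype.val : W → V)), ?_, ?_, fun i => exact_rename W _ _ (F.isExact i)⟩, fun d h => h⟩
  · intro i k j
    rcases F.homog i k j with h | ⟨e, h1, h2⟩
    · left; rw [Matrix.map_apply, h, map_zero]
    · right; exact ⟨e, h1, by rw [Matrix.map_apply]; exact h2.rename_isHomogeneous⟩
  · intro f
    have k0 : Fin (F.rank 0) := ⟨0, by rw [F.rank_zero]; omega⟩
    have hk : ∀ k : Fin (F.rank 0), k = k0 := by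
      intro k; ext; have h1 := k.2; have h2 := k0.2; have h3 := F.rank_zero; omega
    constructor
    · intro hf
      let L : MvPolynomial V K →ₗ[MvPolynomial V K] (Fin (F.rank 0) → MvPolynomial V K) := LinearMap.pi fun _ => LinearMap.id
      have : I.map (rename (R := K) (Subtype.val : W → V)) ≤ Submodule.comap L (LinearMap.range (Matrix.mulVecLin ((F.mat 0).map (rename (Subtype.val : W → V))))) := by
        refine Ideal.span_le.2 ?_
        rintro _ ⟨g, hg, rfl⟩
        obtain ⟨x, hx⟩ := (F.range_zero g).1 hg
        refine ⟨fun l => rename Subtype.val (x l), ?_⟩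
        ext1 k
        have := congrFun hx k
        simp only [Matrix.mulVecLin_apply, Matrix.mulVec, dotProduct] at this ⊢
        simp only [Matrix.map_apply, ← map_mul, ← map_sum, this]
        rfl
      exact this hf
    · rintro ⟨x, hx⟩
      have := congrFun hx k0
      simp only [Matrix.mulVecLin_apply, Matrix.mulVec, dotProduct, Matrix.map_apply] at this
      rw [← this]
      refine Ideal.sum_mem _ fun l _ => Ideal.mul_mem_right _ _ (Ideal.mem_map_of_mem _ ?_)
      rw [F.range_zero]
      refine ⟨Pi.single l 1, ?_⟩
      ext1 k
      rw [hk k]; simp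

/-! transport of regularity bounds -/

variable {V V' : Type} [LinearOrder V] [LinearOrder V'] {K : Type} [Field K]

theorem dl_map (φ : V' ↪o V) (B τ : Finset V') (c : Finset V → K) :
    dl (B.map φ.toEmbedding) c (τ.map φ.toEmbedding) = dl B (fun σ => c (σ.map φ.toEmbedding)) τ := by
  classical
  unfold dl
  rw [← Finset.map_sdiff, Finset.sum_map]
  refine Finset.sum_congr rfl fun v _ => ?_
  rw [← Finset.map_insert]
  congr 1
  unfold sgn
  rw [Finset.filter_map, Finset.card_map]
  congr 2
  ext u
  simp

theorem Van.transport (φ : V' ↪o V) {B : Finset V'} {A : Finset V → Prop} {i : ℕ} (h : Van K (B.map φ.toEmbedding) A i) :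
    Van K B (fun σ => A (σ.map φ.toEmbedding)) i := by
  classical
  intro c hc
  let c' : Finset V → K := fun σ => c (σ.preimage φ φ.injective.injOn)
  have hc' : (fun σ : Finset V' => c' (σ.map φ.toEmbedding)) = c := by
    ext1 σ
    show c _ = c _
    congr 1
    ext u
    simp
  obtain ⟨w, hw⟩ := h c' (by
    intro τ hτ h1 h2
    obtain ⟨τ', hτ', rfl⟩ := Finset.subset_map_iff.1 hτ
    rw [dl_map, hc']
    rw [Finset.card_map] at h2
    exact hc τ' hτ' h1 h2)
  refine ⟨fun σ => w (σ.map φ.toEmbedding), fun σ h1 h2 h3 => ?_⟩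
  rw [← dl_map, ← hw _ (Finset.map_subset_map.2 h1) h2 (by rw [Finset.card_map, h3])]
  exact (congrFun hc' σ).symm

theorem emb_sub_ind (φ : V' ↪o V) (b : V' →₀ ℕ) (σ : Finset V') :
    Finsupp.embDomain φ.toEmbedding (b - ind σ) = Finsupp.embDomain φ.toEmbedding b - ind (σ.map φ.toEmbedding) := by
  classical
  ext v
  by_cases hv : v ∈ Set.range φ.toEmbedding
  · obtain ⟨u, rfl⟩ := hv
    rw [Finsupp.tsub_apply, Finsupp.embDomain_apply_self, Finsupp.embDomain_apply_self, Finsupp.tsub_apply, ind_apply, ind_apply]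
    simp
  · rw [Finsupp.tsub_apply, Finsupp.embDomain_notin_range _ _ _ hv, Finsupp.embDomain_notin_range _ _ _ hv]
    simp

theorem RegOn.transport (φ : V' ↪o V) {Y : Set V} (hY : ∀ u, φ u ∈ Y) {J : (V →₀ ℕ) → Prop} {d : ℤ} (h : RegOn K Y J d) :
    RegOn K Set.univ (fun f => J (Finsupp.embDomain φ.toEmbedding f)) d := by
  classical
  intro b _ i hi
  have h1 := h (Finsupp.embDomain φ.toEmbedding b) (by
    rw [Finsupp.support_embDomain]
    intro v hv
    rw [Finset.mem_coe, Finset.mem_map] at hv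
    obtain ⟨u, -, rfl⟩ := hv
    exact hY u) i (by
    have : (Finsupp.embDomain φ.toEmbedding b).degree = b.degree := by
      rw [Finsupp.degree_apply, Finsupp.degree_apply, Finsupp.support_embDomain, Finset.sum_map]
      exact Finset.sum_congr rfl fun u _ => Finsupp.embDomain_apply_self _ _ _
    rw [this]; exact hi)
  rw [Finsupp.support_embDomain] at h1
  refine h1.transport.congr fun σ _ => ?_
  beta_reduce
  rw [emb_sub_ind]

theorem emb_le (φ : V' ↪o V) {f g : V' →₀ ℕ} : Finsupp.embDomain φ.toEmbedding f ≤ Finsupp.embDomain φ.toEmbedding g ↔ f ≤ g := by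
  constructor
  · intro h u
    have := h (φ.toEmbedding u)
    rwa [Finsupp.embDomain_apply_self, Finsupp.embDomain_apply_self] at this
  · intro h v
    by_cases hv : v ∈ Set.range φ.toEmbedding
    · obtain ⟨u, rfl⟩ := hv
      rw [Finsupp.embDomain_apply_self, Finsupp.embDomain_apply_self]; exact h u
    · rw [Finsupp.embDomain_notin_range _ _ _ hv]; exact Nat.zero_le _

theorem emb_ed (φ : V' ↪o V) (e : Sym2 V') : ed (e.map φ) = Finsupp.embDomain φ.toEmbedding (ed e) := by
  induction e with
  | _ u v =>
    rw [Sym2.map_mk, ed_mk, ed_mk, Finsupp.embDomain_add, Finsupp.embDomain_single, Finsupp.embDomain_single]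
    rfl

theorem emb_dg (φ : V' ↪o V) (N : Multiset (Sym2 V')) : dg (N.map (Sym2.map φ)) = Finsupp.embDomain φ.toEmbedding (dg N) := by
  induction N using Multiset.induction_on with
  | empty => simp [dg_zero]
  | cons e N ih => rw [Multiset.map_cons, dg_cons, dg_cons, ih, emb_ed, Finsupp.embDomain_add]

theorem Jp_emb (φ : V' ↪o V) {A : V → V → Prop} (hA : ∀ u v, A u v → u ∈ Set.range φ ∧ v ∈ Set.range φ) (s : ℕ) (f : V' →₀ ℕ) :
    Jp (fun u v => A (φ u) (φ v)) s f ↔ Jp A s (Finsupp.embDomain φ.toEmbedding f) := by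
  constructor
  · rintro ⟨N, h1, h2, h3⟩
    refine ⟨N.map (Sym2.map φ), by simpa using h1, ?_, ?_⟩
    · intro e he
      obtain ⟨e', he', rfl⟩ := Multiset.mem_map.1 he
      obtain ⟨u, v, h, rfl⟩ := h2 e' he'
      exact ⟨φ u, φ v, h, rfl⟩
    · rw [emb_dg]; exact (emb_le φ).2 h3
  · rintro ⟨N, h1, h2, h3⟩
    have : ∃ N' : Multiset (Sym2 V'), N'.map (Sym2.map φ) = N ∧ ∀ e ∈ N', IsE (fun u v => A (φ u) (φ v)) e := by
      clear h1 h3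
      induction N using Multiset.induction_on with
      | empty => exact ⟨0, rfl, by simp⟩
      | cons e N ih =>
        obtain ⟨N', h4, h5⟩ := ih (fun e he => h2 e (Multiset.mem_cons_of_mem he))
        obtain ⟨u, v, h, rfl⟩ := h2 e (Multiset.mem_cons_self _ _)
        obtain ⟨⟨u', rfl⟩, ⟨v', rfl⟩⟩ := hA u v h
        refine ⟨s(u', v') ::ₘ N', by rw [Multiset.map_cons, h4]; rfl, ?_⟩
        intro e he
        rcases Multiset.mem_cons.1 he with rfl | he
        · exact ⟨u', v', h, rfl⟩
        · exact h5 e he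
    obtain ⟨N', rfl, h5⟩ := this
    refine ⟨N', by simpa using h1, h5, ?_⟩
    rw [emb_dg] at h3
    exact (emb_le φ).1 h3

/-- powers of the edge ideal are monomial ideals -/
theorem mem_edgePow (G : SimpleGraph V) (r : ℕ) (f : MvPolynomial V K) :
    f ∈ (edgeIdeal K G) ^ r ↔ ∀ μ ∈ f.support, Jp G.Adj r μ := by
  classical
  let S : ℕ → Set (V →₀ ℕ) := fun r => {m | ∃ N : Multiset (Sym2 V), Multiset.card N = r ∧ (∀ e ∈ N, IsE G.Adj e) ∧ dg N = m}
  have key : ∀ r, (edgeIdeal K G) ^ r = Ideal.span ((fun s => monomial s (1 : K)) '' S r) := by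
    intro r
    induction r with
    | zero =>
      rw [pow_zero, Ideal.one_eq_top, eq_comm, Ideal.eq_top_iff_one]
      apply Ideal.subset_span
      exact ⟨0, ⟨0, rfl, by simp, dg_zero⟩, rfl⟩
    | succ r ih =>
      rw [pow_succ, ih, edgeIdeal, Ideal.span_mul_span']
      congr 1
      ext p
      have hX : ∀ u v : V, (X u * X v : MvPolynomial V K) = monomial (ed s(u, v)) 1 := by
        intro u v
        rw [ed_mk, X, X, monomial_mul, one_mul]
      constructor
      · rintro ⟨_, ⟨_, ⟨N, h1, h2, rfl⟩, rfl⟩, _, ⟨u, v, h, rfl⟩, rfl⟩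
        refine ⟨dg (s(u, v) ::ₘ N), ⟨_, by simp [h1], ?_, rfl⟩, ?_⟩
        · intro e he
          rcases Multiset.mem_cons.1 he with rfl | he
          · exact ⟨u, v, h, rfl⟩
          · exact h2 e he
        · show monomial _ _ = monomial _ _ * (X u * X v)
          rw [hX, monomial_mul, one_mul, dg_cons, add_comm]
      · rintro ⟨_, ⟨N, h1, h2, rfl⟩, rfl⟩
        obtain ⟨e, N', rfl⟩ := Multiset.card_pos_iff_exists_mem.1 (by omega : 0 < Multiset.card N) |>.imp
          fun e he => Multiset.exists_cons_of_mem he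
        obtain ⟨u, v, h, rfl⟩ := h2 e (Multiset.mem_cons_self _ _)
        refine ⟨_, ⟨_, ⟨N', by simpa using h1, fun e he => h2 e (Multiset.mem_cons_of_mem he), rfl⟩, rfl⟩, _, ⟨u, v, h, rfl⟩, ?_⟩
        show monomial _ _ * (X u * X v) = monomial _ _
        rw [hX, monomial_mul, one_mul, dg_cons, add_comm]
  rw [key, mem_ideal_span_monomial_image]
  refine forall₂_congr fun μ _ => ?_
  constructor
  · rintro ⟨_, ⟨N, h1, h2, rfl⟩, h3⟩
    exact ⟨N, h1, h2, h3⟩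
  · rintro ⟨N, h1, h2, h3⟩
    exact ⟨_, ⟨N, h1, h2, rfl⟩, h3⟩

end Transport

end EIR


namespace EIR

section Final

open MvPolynomial EdgeIdealReg

theorem quad_card {V : Type} [LinearOrder V] {K : Type} [Field K] {D : V → V → Prop} (hD : ∀ u v, D u v → D v u) (hirr : ∀ u, ¬ D u u) (W : Finset V) :
    RegOn K (W : Set V) (quad D) W.card := by
  classical
  induction hn : W.card generalizing W with
  | zero =>
    rw [Finset.card_eq_zero] at hn
    subst hn
    exact RegOn.of_no_edges (by simp) (by simp)
  | succ n ih =>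
    obtain ⟨x, hx⟩ : W.Nonempty := Finset.card_pos.1 (by omega)
    have h1 := ih (W.erase x) (by rw [Finset.card_erase_of_mem hx, hn]; rfl)
    rw [Finset.coe_erase] at h1
    refine RegOn.removeVertex hD x (h1.mono subset_rfl (by push_cast; omega)) ?_
    refine RegOn.free (Z := ((W : Set V) \ {u | D x u}) \ {x}) ?_ (h1.mono (by
      rintro u ⟨⟨h2, -⟩, h3⟩; exact ⟨h2, h3⟩) (by push_cast; omega))
    rintro y hy hyZ f hf ⟨a, b, hab, hle⟩
    have hyx : y = x := by
      by_contra hne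
      exact hyZ ⟨hy, hne⟩
    subst hyx
    have hs : ∀ v ∈ (f + e1 y).support, v ∈ (W : Set V) \ {u | D y u} := by
      intro v hv
      by_cases hvy : v = y
      · rw [hvy]; exact hy
      · apply hf
        rw [Finset.mem_coe]
        rw [Finsupp.mem_support_iff] at hv ⊢
        rw [Finsupp.add_apply, e1_apply, if_neg (Ne.symm hvy), add_zero] at hv
        exact hv
    have ha : a ≠ y := by
      rintro rfl
      exact (hs b (le_supp hle).2).2 hab
    have hb : b ≠ y := by
      rintro rfl
      exact (hs a (le_supp hle).1).2 (hD _ _ hab)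
    refine ⟨a, b, hab, fun v => ?_⟩
    by_cases hv : v = y
    · subst hv
      simp [e1_apply, ha, hb]
    · have := hle v
      rw [Finsupp.add_apply f, e1_apply y, if_neg (Ne.symm hv), add_zero] at this
      exact this

theorem deg_nonneg {V K : Type} [Field K] {I : Ideal (MvPolynomial V K)} {d : ℤ}
    (h : ∃ F : GradedFreeResolution I, ∀ i (k : Fin (F.rank i)), (F.deg i k : ℤ) ≤ d + i) : 0 ≤ d := by
  obtain ⟨F, hF⟩ := h
  have := hF 0 ⟨0, by rw [F.rank_zero]; omega⟩
  rw [F.deg_zero] at this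
  simpa using this

/-- a finitely resolved power has finitely many edges -/
theorem fin_edges {V K : Type} [LinearOrder V] [Field K] (G : SimpleGraph V) {r : ℕ} (hr : 1 ≤ r) (F : GradedFreeResolution ((edgeIdeal K G) ^ r)) :
    ∃ W : Finset V, ∀ u v, G.Adj u v → u ∈ W := by
  classical
  let k0 : Fin (F.rank 0) := ⟨0, by rw [F.rank_zero]; omega⟩
  have hk : ∀ k : Fin (F.rank 0), k = k0 := by
    intro k; ext; have h1 := k.2; have h2 := k0.2; have h3 := F.rank_zero; omega
  refine ⟨Finset.univ.biUnion fun l => (F.mat 0 k0 l).vars, fun u v huv => ?_⟩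
  have hmem : (X u * X v : MvPolynomial V K) ^ r ∈ (edgeIdeal K G) ^ r :=
    Ideal.pow_mem_pow (show X u * X v ∈ edgeIdeal K G from Ideal.subset_span ⟨u, v, huv, rfl⟩) r
  have hmon : (X u * X v : MvPolynomial V K) ^ r = monomial (r • (e1 u + e1 v)) 1 := by
    rw [X, X, monomial_mul, one_mul, monomial_pow, one_pow]
  rw [F.range_zero] at hmem
  obtain ⟨x, hx⟩ := hmem
  have h1 := congrFun hx k0
  simp only [Matrix.mulVecLin_apply, Matrix.mulVec, dotProduct] at h1
  rw [hmon] at h1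
  have h2 := congrArg (coeff (r • (e1 u + e1 v))) h1
  rw [coeff_monomial, if_pos rfl, coeff_sum] at h2
  obtain ⟨l, -, hl⟩ := Finset.exists_ne_zero_of_sum_ne_zero (h2.trans_ne one_ne_zero)
  rw [coeff_mul] at hl
  obtain ⟨⟨μ, ν⟩, h3, h4⟩ := Finset.exists_ne_zero_of_sum_ne_zero hl
  rw [Finset.HasAntidiagonal.mem_antidiagonal] at h3
  have hμ : μ ∈ (F.mat 0 k0 l).support := mem_support_iff.2 (left_ne_zero_of_mul h4)
  have hI : F.mat 0 k0 l ∈ (edgeIdeal K G) ^ r := by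
    rw [F.range_zero]
    refine ⟨Pi.single l 1, ?_⟩
    ext1 k
    rw [hk k]; simp
  obtain ⟨N, h5, h6, h7⟩ := (mem_edgePow G r _).1 hI μ hμ
  obtain ⟨e, N', rfl⟩ := Multiset.card_pos_iff_exists_mem.1 (by omega : 0 < Multiset.card N) |>.imp
    fun e he => Multiset.exists_cons_of_mem he
  obtain ⟨a, b, hab, rfl⟩ := h6 e (Multiset.mem_cons_self _ _)
  have h8 : e1 a + e1 b ≤ μ := le_trans (by rw [dg_cons, ed_mk]; simp) h7
  have hsup : ∀ w ∈ μ.support, w = u ∨ w = v := by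
    intro w hw
    by_contra hne
    push Not at hne
    have h9 : (μ + ν) w = 0 := by
      have : (μ + ν) w = (r • (e1 u + e1 v)) w := congrArg (fun g : V →₀ ℕ => g w) h3
      rw [this]
      simp [Finsupp.single_apply, Ne.symm hne.1, Ne.symm hne.2]
    rw [Finsupp.mem_support_iff] at hw
    rw [Finsupp.add_apply] at h9
    omega
  have hu : u ∈ μ.support := by
    by_contra hu
    obtain ⟨ha, hb⟩ := le_supp h8
    have e1' : a = v := (hsup a ha).resolve_left (fun h => hu (h ▸ ha))
    have e2' : b = v := (hsup b hb).resolve_left (fun h => hu (h ▸ hb))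
    exact G.loopless.irrefl v (by rw [e1', e2'] at hab; exact hab)
  exact Finset.mem_biUnion.2 ⟨l, Finset.mem_univ _, (mem_vars _).2 ⟨μ, hμ, hu⟩⟩

/-- from combinatorial bounds to resolutions -/
theorem bridge3 {V K : Type} [LinearOrder V] [Field K] (G : SimpleGraph V) (W : Finset V) (hW : ∀ u v, G.Adj u v → u ∈ W) (r : ℕ)
    {d : ℤ} (hd : 0 ≤ d) (h : RegOn K (W : Set V) (Jp G.Adj r) d) :
    ∃ F : GradedFreeResolution ((edgeIdeal K G) ^ r), ∀ i (k : Fin (F.rank i)), (F.deg i k : ℤ) ≤ d + i := by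
  classical
  let φ : ((W : Set V) : Type) ↪o V := OrderEmbedding.subtype _
  let G' : SimpleGraph ((W : Set V) : Type) := G.comap φ
  have h1 := h.transport φ (fun u => u.2)
  have hr : ∀ u v, G.Adj u v → u ∈ Set.range φ ∧ v ∈ Set.range φ := fun u v huv =>
    ⟨⟨⟨u, hW u v huv⟩, rfl⟩, ⟨⟨v, hW v u huv.symm⟩, rfl⟩⟩
  obtain ⟨F, hF⟩ := bridge2 (I := (edgeIdeal K G') ^ r) (J := fun f => Jp G.Adj r (Finsupp.embDomain φ.toEmbedding f)) (by
    intro f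
    rw [mem_edgePow]
    refine forall₂_congr fun μ _ => ?_
    exact Jp_emb φ hr r μ) hd h1
  obtain ⟨F', hF'⟩ := res_rename (W : Set V) F
  have hI : ((edgeIdeal K G') ^ r).map (rename (R := K) (Subtype.val : ((W : Set V) : Type) → V)) = (edgeIdeal K G) ^ r := by
    rw [Ideal.map_pow, edgeIdeal, Ideal.map_span, edgeIdeal]
    congr 2
    ext p
    constructor
    · rintro ⟨_, ⟨u, v, huv, rfl⟩, rfl⟩
      exact ⟨u, v, huv, by simp⟩
    · rintro ⟨u, v, huv, rfl⟩
      exact ⟨_, ⟨⟨u, hW u v huv⟩, ⟨v, hW v u huv.symm⟩, huv, rfl⟩, by simp⟩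
  rw [← hI]
  exact ⟨F', hF' d hF⟩

theorem edgePow_ne_top {V K : Type} [Field K] (G : SimpleGraph V) {r : ℕ} (hr : 1 ≤ r) : (edgeIdeal K G) ^ r ≠ ⊤ := by
  intro h
  have h1 : edgeIdeal K G = ⊤ := top_le_iff.1 (h ▸ Ideal.pow_le_self (by omega))
  have h2 : edgeIdeal K G ≤ RingHom.ker (constantCoeff : MvPolynomial V K →+* K) := by
    refine Ideal.span_le.2 ?_
    rintro _ ⟨u, v, -, rfl⟩
    simp [RingHom.mem_ker]
  rw [h1, top_le_iff] at h2
  have : (1 : MvPolynomial V K) ∈ RingHom.ker (constantCoeff : MvPolynomial V K →+* K) := by rw [h2]; trivial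
  simp [RingHom.mem_ker] at this

theorem final {V K : Type} [Field K]
    (G : SimpleGraph V) (Hset T : Set V) (huni : Unicyclic (G.induce Hset))
    (hatt : Nonempty (CliqueAttachment G Hset T)) (r : ℕ) (hr : 1 ≤ r) :
    regQuot ((edgeIdeal K G) ^ r) ≤
      ((2 * (r : ℤ) - 2 : ℤ) : WithBot ℤ) + regQuot (edgeIdeal K G) := by
  classical
  letI : LinearOrder V := linearOrderOfSTO WellOrderingRel
  obtain ⟨hatt⟩ := hatt
  have hne := edgePow_ne_top (K := K) G hr
  have hne1 : edgeIdeal K G ≠ ⊤ := by simpa using edgePow_ne_top (K := K) G (le_refl 1)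
  unfold regQuot
  rw [if_neg hne, if_neg hne1, ← WithBot.coe_add, WithBot.coe_le_coe]
  set S1 : Set ℤ := {d : ℤ | ∃ F : GradedFreeResolution (edgeIdeal K G), ∀ i (k : Fin (F.rank i)), (F.deg i k : ℤ) ≤ d + i} with hS1
  set Sr : Set ℤ := {d : ℤ | ∃ F : GradedFreeResolution ((edgeIdeal K G) ^ r), ∀ i (k : Fin (F.rank i)), (F.deg i k : ℤ) ≤ d + i} with hSr
  have hb1 : BddBelow S1 := ⟨0, fun d hd => deg_nonneg hd⟩
  have hbr : BddBelow Sr := ⟨0, fun d hd => deg_nonneg hd⟩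
  by_cases hemp : Sr.Nonempty
  swap
  · rw [Set.not_nonempty_iff_eq_empty] at hemp
    rw [hemp, Int.csInf_empty]
    have : 0 ≤ sInf S1 := by
      by_cases h : S1.Nonempty
      · exact deg_nonneg (Int.csInf_mem h hb1)
      · rw [Set.not_nonempty_iff_eq_empty] at h
        rw [h, Int.csInf_empty]
    have : (1 : ℤ) ≤ r := by exact_mod_cast hr
    linarith
  obtain ⟨_, F0, -⟩ := hemp
  obtain ⟨W0, hW0⟩ := fin_edges G hr F0
  let W : Finset V := W0.filter fun u => ∃ v, G.Adj u v
  have hW1 : ∀ u, u ∈ W ↔ ∃ v, G.Adj u v := by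
    intro u
    rw [Finset.mem_filter]
    exact ⟨fun h => h.2, fun h => ⟨h.elim fun v hv => hW0 u v hv, h⟩⟩
  have hW2 : ∀ u v, G.Adj u v → u ∈ W := fun u v h => (hW1 u).2 ⟨v, h⟩
  have hsymm : ∀ u v, G.Adj u v → G.Adj v u := fun u v h => h.symm
  have hirr : ∀ u, ¬ G.Adj u u := fun u => G.loopless.irrefl u
  have hne1' : S1.Nonempty := by
    refine ⟨(W.card : ℤ), ?_⟩
    have := bridge3 (K := K) G W hW2 1 (d := W.card) (by simp) ((quad_card hsymm hirr W).congr fun f _ => (Jp_one f).symm)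
    rwa [pow_one] at this
  have hmem := Int.csInf_mem hne1' hb1
  set d0 := sInf S1 with hd0
  obtain ⟨F1, hF1⟩ := hmem
  have hreg : RegOn K Set.univ (quad G.Adj) d0 := by
    refine bridge1 (I := edgeIdeal K G) ?_ F1 d0 hF1
    intro f
    have := mem_edgePow (K := K) G 1 f
    rw [pow_one] at this
    rw [this]
    exact forall₂_congr fun μ _ => Jp_one μ
  have hregW : RegOn K (W : Set V) (quad G.Adj) d0 := hreg.mono (Set.subset_univ _) le_rfl
  have h0 : 0 ≤ d0 := hreg.nonneg (quad_zero _)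
  obtain ⟨-, w, hw, hpsi⟩ := structure_main (K := K) G Hset T huni hatt W hW1
  have hAF : AF G.Adj (W : Set V) = G.Adj := by
    ext u v
    exact ⟨fun h => h.1, fun h => ⟨h, hW2 u v h, hW2 v u h.symm⟩⟩
  have hP := hpsi (W : Set V) rfl d0 hregW
  rw [hAF] at hP
  have hfin := powers_bound hsymm hirr w W (fun u v h => ⟨hW2 u v h, hW2 v u h.symm⟩) hw d0 hregW hP (r - 1)
  rw [Nat.sub_add_cancel hr] at hfin
  refine csInf_le hbr ?_
  have e : (2 * ((r - 1 : ℕ) : ℤ) + d0) = 2 * (r : ℤ) - 2 + d0 := by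
    rw [Nat.cast_sub hr]; push_cast; ring
  rw [e] at hfin
  have : (1 : ℤ) ≤ r := by exact_mod_cast hr
  exact bridge3 G W hW2 r (by linarith) hfin

end Final

end EIR


open EdgeIdealReg in
/-- If `H` is unicyclic and `G = H_T` is obtained by attaching unions of complete graphs at
the vertices of `T ⊆ V(H)`, then `reg(S/I(G)^r) ≤ 2r + reg(S/I(G)) - 2` for all `r ≥ 1`. -/
theorem reg_pow_unicyclic_attached_bound {V K : Type} [Field K]
    (G : SimpleGraph V) (Hset T : Set V) (huni : Unicyclic (G.induce Hset))
    (hatt : Nonempty (CliqueAttachment G Hset T)) (r : ℕ) (hr : 1 ≤ r) :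
    regQuot ((edgeIdeal K G) ^ r) ≤
      ((2 * (r : ℤ) - 2 : ℤ) : WithBot ℤ) + regQuot (edgeIdeal K G) := by
  exact EIR.final G Hset T huni hatt r hr
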